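/- arXiv:2007.09498 — 2 statements merged into one kernel-verified Lean document; each statement's English description precedes it below -/
import Mathlib

section
/- Let Ω' be an open set whose closure is compact and contained in Ω_a^-, and for n ∈ ℕ set a_n := a⁺ − n a⁻, where a⁺ and a⁻ are the positive and negative parts of a. Assume either λ ≤ 0, or p = 2 and λ ≤ λ₁. Then there exists n₀ ∈ ℕ such that for every n ≥ n₀, every Dirichlet weak solution u of (P_λ) with weight a_n satisfies u(x) = 0 for all x ∈ Ω'. -/
open MeasureTheory RealInnerProductSpace

noncomputable section

/-- A test function: smooth, compactly supported, with support contained in `Ω`. -/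
def IsTestFun {N : ℕ} (Ω : Set (EuclideanSpace ℝ (Fin N)))
    (φ : EuclideanSpace ℝ (Fin N) → ℝ) : Prop :=
  ContDiff ℝ (⊤ : ℕ∞) φ ∧ HasCompactSupport φ ∧ tsupport φ ⊆ Ω

/-- A Dirichlet weak solution of `(P_λ)` with exponent `q` and weight `a`:
continuous on the closure of `Ω`, continuously differentiable in `Ω`, nonnegative in `Ω`,
vanishing on the boundary, with `∫_Ω ‖∇u‖^p < ∞`, satisfying the weak form of
`-Δ_p u = λ u^{p-1} + a u^{q-1}`. -/
def DirichletSol {N : ℕ} (Ω : Set (EuclideanSpace ℝ (Fin N))) (p q lam : ℝ)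
    (a u : EuclideanSpace ℝ (Fin N) → ℝ) : Prop :=
  ContinuousOn u (closure Ω) ∧
  (∀ x ∈ Ω, DifferentiableAt ℝ u x) ∧
  ContinuousOn (fun x => gradient u x) Ω ∧
  (∀ x ∈ Ω, 0 ≤ u x) ∧
  (∀ x ∈ frontier Ω, u x = 0) ∧
  IntegrableOn (fun x => ‖gradient u x‖ ^ p) Ω ∧
  ∀ φ : EuclideanSpace ℝ (Fin N) → ℝ, IsTestFun Ω φ →
    (∫ x in Ω, ‖gradient u x‖ ^ (p - 2) * ⟪gradient u x, gradient φ x⟫)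
      = ∫ x in Ω, (lam * u x ^ (p - 1) + a x * u x ^ (q - 1)) * φ x

/-- `λ₁`: the infimum of `∫_Ω ‖∇φ‖^p` over test functions normalized in `L^p`. -/
def lambda1 {N : ℕ} (Ω : Set (EuclideanSpace ℝ (Fin N))) (p : ℝ) : ℝ :=
  sInf { E : ℝ | ∃ φ : EuclideanSpace ℝ (Fin N) → ℝ, IsTestFun Ω φ ∧
    (∫ x in Ω, |φ x| ^ p) = 1 ∧ E = ∫ x in Ω, ‖gradient φ x‖ ^ p }

/-- `λ*(a,r)`: the infimum of `∫_Ω ‖∇φ‖^p` over normalized test functions with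
`∫_Ω a |φ|^r ≥ 0`. -/
def lambdaStar {N : ℕ} (Ω : Set (EuclideanSpace ℝ (Fin N))) (p r : ℝ)
    (a : EuclideanSpace ℝ (Fin N) → ℝ) : ℝ :=
  sInf { E : ℝ | ∃ φ : EuclideanSpace ℝ (Fin N) → ℝ, IsTestFun Ω φ ∧
    (∫ x in Ω, |φ x| ^ p) = 1 ∧ (0 ≤ ∫ x in Ω, a x * |φ x| ^ r) ∧
    E = ∫ x in Ω, ‖gradient φ x‖ ^ p }

section Auxiliary

open Filter Topology Set

/-- A `C¹` function with compact support contained in `Ω`. -/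
structure IsC1TestFun {N : ℕ} (Ω : Set (EuclideanSpace ℝ (Fin N)))
    (φ : EuclideanSpace ℝ (Fin N) → ℝ) : Prop where
  contDiff : ContDiff ℝ 1 φ
  hasCompactSupport : HasCompactSupport φ
  tsupport_subset : tsupport φ ⊆ Ω

section Gradient

variable {N : ℕ} {Ω : Set (EuclideanSpace ℝ (Fin N))} {φ : EuclideanSpace ℝ (Fin N) → ℝ}

lemma gradient_eq_toDual_symm (f : EuclideanSpace ℝ (Fin N) → ℝ) :
    gradient f = fun x => (InnerProductSpace.toDual ℝ _).symm (fderiv ℝ f x) := rfl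

lemma norm_gradient_eq (f : EuclideanSpace ℝ (Fin N) → ℝ) (x : EuclideanSpace ℝ (Fin N)) :
    ‖gradient f x‖ = ‖fderiv ℝ f x‖ := by
  rw [gradient_eq_toDual_symm, LinearIsometryEquiv.norm_map]

lemma ContDiff.continuous_gradient (h : ContDiff ℝ 1 φ) : Continuous (gradient φ) := by
  rw [gradient_eq_toDual_symm]
  exact (LinearIsometryEquiv.continuous _).comp (h.continuous_fderiv one_ne_zero)

lemma gradient_of_notMem_tsupport {x : EuclideanSpace ℝ (Fin N)} (hx : x ∉ tsupport φ) :
    gradient φ x = 0 := by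
  have : φ =ᶠ[𝓝 x] fun _ => 0 := notMem_tsupport_iff_eventuallyEq.1 hx
  rw [gradient_eq_toDual_symm]
  simp only [this.fderiv_eq]
  simp

lemma contDiffOn_one_of_gradient {u : EuclideanSpace ℝ (Fin N) → ℝ} (hΩ : IsOpen Ω)
    (hd : ∀ x ∈ Ω, DifferentiableAt ℝ u x) (hc : ContinuousOn (gradient u) Ω) :
    ContDiffOn ℝ 1 u Ω := by
  rw [show (1 : WithTop ℕ∞) = 0 + 1 by simp, contDiffOn_succ_iff_fderiv_of_isOpen hΩ]
  refine ⟨fun x hx => (hd x hx).differentiableWithinAt, by simp, ?_⟩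
  rw [contDiffOn_zero]
  have h := (InnerProductSpace.toDual ℝ (EuclideanSpace ℝ (Fin N))).continuous.comp_continuousOn hc
  refine h.congr fun x _ => ?_
  simp [gradient_eq_toDual_symm]

lemma ContDiffOn.continuousOn_gradient {u : EuclideanSpace ℝ (Fin N) → ℝ} (hΩ : IsOpen Ω)
    (h : ContDiffOn ℝ 1 u Ω) : ContinuousOn (gradient u) Ω := by
  rw [gradient_eq_toDual_symm]
  exact (LinearIsometryEquiv.continuous _).comp_continuousOn
    (h.continuousOn_fderiv_of_isOpen hΩ (by simp))

namespace IsC1TestFun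

lemma mono {Ω' : Set (EuclideanSpace ℝ (Fin N))} (h : IsC1TestFun Ω φ) (hs : Ω ⊆ Ω') :
    IsC1TestFun Ω' φ := ⟨h.1, h.2, h.3.trans hs⟩

lemma eq_zero (h : IsC1TestFun Ω φ) {x : EuclideanSpace ℝ (Fin N)} (hx : x ∉ Ω) : φ x = 0 :=
  image_eq_zero_of_notMem_tsupport fun h' => hx (h.3 h')

lemma gradient_eq_zero (h : IsC1TestFun Ω φ) {x : EuclideanSpace ℝ (Fin N)} (hx : x ∉ Ω) :
    gradient φ x = 0 := gradient_of_notMem_tsupport fun h' => hx (h.3 h')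

lemma differentiable (h : IsC1TestFun Ω φ) : Differentiable ℝ φ := h.1.differentiable one_ne_zero

lemma continuous (h : IsC1TestFun Ω φ) : Continuous φ := h.1.continuous

lemma continuous_gradient (h : IsC1TestFun Ω φ) : Continuous (gradient φ) :=
  h.1.continuous_gradient

lemma hasCompactSupport_gradient (h : IsC1TestFun Ω φ) : HasCompactSupport (gradient φ) :=
  h.2.mono' fun x hx => by
    by_contra h'
    exact hx (gradient_of_notMem_tsupport h')

lemma exists_bound (h : IsC1TestFun Ω φ) : ∃ C, 0 ≤ C ∧ ∀ x, |φ x| ≤ C ∧ ‖gradient φ x‖ ≤ C := by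
  obtain ⟨C₁, h₁⟩ := h.2.exists_bound_of_continuous h.continuous
  obtain ⟨C₂, h₂⟩ := h.hasCompactSupport_gradient.exists_bound_of_continuous h.continuous_gradient
  exact ⟨max C₁ C₂, (norm_nonneg _).trans ((h₁ 0).trans (le_max_left _ _)),
    fun x => ⟨(h₁ x).trans (le_max_left _ _), (h₂ x).trans (le_max_right _ _)⟩⟩

end IsC1TestFun

/-- Approximation of `C¹` test functions by smooth ones. -/
lemma IsC1TestFun.exists_approx (hΩ : IsOpen Ω) (h : IsC1TestFun Ω φ) :
    ∃ K : Set (EuclideanSpace ℝ (Fin N)), ∃ C : ℝ, ∃ ψ : ℕ → EuclideanSpace ℝ (Fin N) → ℝ,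
      IsCompact K ∧ K ⊆ Ω ∧ (∀ k, IsTestFun Ω (ψ k)) ∧
      (∀ k, ∀ x ∉ K, ψ k x = 0 ∧ gradient (ψ k) x = 0) ∧
      (∀ k x, |ψ k x| ≤ C ∧ ‖gradient (ψ k) x‖ ≤ C) ∧
      ∀ x, Tendsto (fun k => ψ k x) atTop (𝓝 (φ x)) ∧
        Tendsto (fun k => gradient (ψ k) x) atTop (𝓝 (gradient φ x)) := by
  obtain ⟨d, hd, hdΩ⟩ := h.2.exists_cthickening_subset_open hΩ h.3
  obtain ⟨C, hC, hb⟩ := h.exists_bound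
  have hpos : ∀ k : ℕ, 0 < d / (k + 1) := fun k => by positivity
  let ρ : ℕ → ContDiffBump (0 : EuclideanSpace ℝ (Fin N)) := fun k =>
    { rIn := d / (k + 1) / 2
      rOut := d / (k + 1)
      rIn_pos := half_pos (hpos k)
      rIn_lt_rOut := half_lt_self (hpos k) }
  have hρ : Tendsto (fun k => (ρ k).rOut) atTop (𝓝 0) := by
    have := (tendsto_one_div_add_atTop_nhds_zero_nat (𝕜 := ℝ)).const_mul d
    simp only [mul_one_div, mul_zero] at this
    exact this
  let ψ : ℕ → EuclideanSpace ℝ (Fin N) → ℝ := fun k =>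
    convolution ((ρ k).normed volume) φ (ContinuousLinearMap.lsmul ℝ ℝ) volume
  have hder : ∀ k x, HasFDerivAt (ψ k) (convolution ((ρ k).normed volume) (fderiv ℝ φ)
      (ContinuousLinearMap.lsmul ℝ ℝ) volume x) x := by
    intro k x
    exact h.2.hasFDerivAt_convolution_right (ContinuousLinearMap.lsmul ℝ ℝ)
      ((ρ k).continuous_normed.locallyIntegrable) h.1 x
  have hts : ∀ k, tsupport (ψ k) ⊆ Metric.cthickening d (tsupport φ) := by
    intro k
    refine closure_minimal ?_ Metric.isClosed_cthickening
    refine (support_convolution_subset _).trans ?_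
    rintro _ ⟨y, hy, z, hz, rfl⟩
    rw [(ρ k).support_normed_eq] at hy
    refine Metric.mem_cthickening_of_dist_le _ z _ _ (subset_tsupport _ hz) ?_
    have hy' : ‖y‖ < d / (k + 1) := by simpa [ρ] using hy
    have : d / (k + 1) ≤ d := div_le_self hd.le (by linarith [(Nat.cast_nonneg k : (0 : ℝ) ≤ k)])
    simpa [dist_eq_norm] using hy'.le.trans this
  have hK : IsCompact (Metric.cthickening d (tsupport φ)) := h.2.isCompact.cthickening
  refine ⟨Metric.cthickening d (tsupport φ), C, ψ, hK, hdΩ, fun k => ⟨?_, ?_, ?_⟩, ?_, ?_, ?_⟩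
  · exact ((ρ k).hasCompactSupport_normed).contDiff_convolution_left _ ((ρ k).contDiff_normed)
      h.continuous.locallyIntegrable
  · exact hK.of_isClosed_subset (isClosed_tsupport _) (hts k)
  · exact (hts k).trans hdΩ
  · exact fun k x hx => ⟨image_eq_zero_of_notMem_tsupport fun h' => hx (hts k h'),
      gradient_of_notMem_tsupport fun h' => hx (hts k h')⟩
  · intro k x
    constructor
    · have := dist_convolution_le (μ := volume) (f := (ρ k).normed volume) (g := φ) (x₀ := x)
        (z₀ := 0) (R := (ρ k).rOut) hC ((ρ k).support_normed_eq.subset) (ρ k).nonneg_normed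
        (ρ k).integral_normed h.continuous.aestronglyMeasurable
        (fun y _ => by simpa using (hb y).1)
      simpa using this
    · have := dist_convolution_le (μ := volume) (f := (ρ k).normed volume) (g := fderiv ℝ φ)
        (x₀ := x) (z₀ := 0) (R := (ρ k).rOut) hC ((ρ k).support_normed_eq.subset)
        (ρ k).nonneg_normed (ρ k).integral_normed
        (h.1.continuous_fderiv one_ne_zero).aestronglyMeasurable
        (fun y _ => by simpa [norm_gradient_eq] using (hb y).2)
      rw [norm_gradient_eq, (hder k x).fderiv]
      simpa using this
  · intro x
    refine ⟨ContDiffBump.convolution_tendsto_right_of_continuous hρ h.continuous x, ?_⟩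
    have := ContDiffBump.convolution_tendsto_right_of_continuous (μ := volume) hρ
      (h.1.continuous_fderiv one_ne_zero) x
    simp only [gradient_eq_toDual_symm]
    refine ((LinearIsometryEquiv.continuous _).tendsto _).comp ?_
    exact this.congr fun k => ((hder k x).fderiv).symm

end Gradient

section Extension

variable {N : ℕ} {Ω : Set (EuclideanSpace ℝ (Fin N))}

lemma ContinuousOn.integrable_indicator_norm {E' : Type*} [NormedAddCommGroup E']
    {K : Set (EuclideanSpace ℝ (Fin N))} {F : EuclideanSpace ℝ (Fin N) → E'} (hK : IsCompact K)
    (hF : ContinuousOn F K) (C : ℝ) : Integrable (K.indicator fun x => ‖F x‖ * C) := by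
  rw [integrable_indicator_iff hK.measurableSet]
  exact (hF.norm.mul continuousOn_const).integrableOn_compact hK

/-- A weak formulation tested on smooth functions holds for `C¹` test functions. -/
lemma weak_form_extend (hΩ : IsOpen Ω)
    {F : EuclideanSpace ℝ (Fin N) → EuclideanSpace ℝ (Fin N)} {g : EuclideanSpace ℝ (Fin N) → ℝ}
    (hF : ContinuousOn F Ω) (hg : ContinuousOn g Ω)
    (hw : ∀ φ, IsTestFun Ω φ → ∫ x in Ω, ⟪F x, gradient φ x⟫ = ∫ x in Ω, g x * φ x)
    {φ : EuclideanSpace ℝ (Fin N) → ℝ} (hφ : IsC1TestFun Ω φ) :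
    ∫ x in Ω, ⟪F x, gradient φ x⟫ = ∫ x in Ω, g x * φ x := by
  obtain ⟨K, C, ψ, hK, hKΩ, htest, hzero, hbd, hlim⟩ := hφ.exists_approx hΩ
  have h1 : Tendsto (fun k => ∫ x in Ω, ⟪F x, gradient (ψ k) x⟫) atTop
      (𝓝 (∫ x in Ω, ⟪F x, gradient φ x⟫)) := by
    refine tendsto_integral_of_dominated_convergence (K.indicator fun x => ‖F x‖ * C) ?_
      ((hF.mono hKΩ).integrable_indicator_norm hK C).integrableOn ?_ ?_
    · intro k
      refine (ContinuousOn.inner hF ?_).aestronglyMeasurable hΩ.measurableSet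
      exact (((htest k).1.of_le (by exact_mod_cast le_top)).continuous_gradient).continuousOn
    · refine fun k => Eventually.of_forall fun x => ?_
      by_cases hx : x ∈ K
      · rw [indicator_of_mem hx]
        exact (norm_inner_le_norm _ _).trans
          (mul_le_mul_of_nonneg_left (hbd k x).2 (norm_nonneg _))
      · simp [hx, (hzero k x hx).2]
    · exact Eventually.of_forall fun x => tendsto_const_nhds.inner (hlim x).2
  have h2 : Tendsto (fun k => ∫ x in Ω, g x * ψ k x) atTop (𝓝 (∫ x in Ω, g x * φ x)) := by
    refine tendsto_integral_of_dominated_convergence (K.indicator fun x => ‖g x‖ * C) ?_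
      ((hg.mono hKΩ).integrable_indicator_norm hK C).integrableOn ?_ ?_
    · intro k
      exact (hg.mul (htest k).1.continuous.continuousOn).aestronglyMeasurable hΩ.measurableSet
    · refine fun k => Eventually.of_forall fun x => ?_
      by_cases hx : x ∈ K
      · rw [indicator_of_mem hx, norm_mul]
        exact mul_le_mul_of_nonneg_left (hbd k x).1 (norm_nonneg _)
      · simp [hx, (hzero k x hx).1]
    · exact Eventually.of_forall fun x => tendsto_const_nhds.mul (hlim x).1
  exact tendsto_nhds_unique h1 (h2.congr fun k => (hw _ (htest k)).symm)

/-- The Poincaré inequality extends from smooth to `C¹` test functions. -/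
lemma poincare_extend (hΩ : IsOpen Ω) {lam : ℝ}
    (hw : ∀ φ, IsTestFun Ω φ → lam * ∫ x in Ω, φ x ^ 2 ≤ ∫ x in Ω, ‖gradient φ x‖ ^ 2)
    {φ : EuclideanSpace ℝ (Fin N) → ℝ} (hφ : IsC1TestFun Ω φ) :
    lam * ∫ x, φ x ^ 2 ≤ ∫ x, ‖gradient φ x‖ ^ 2 := by
  obtain ⟨K, C, ψ, hK, hKΩ, htest, hzero, hbd, hlim⟩ := hφ.exists_approx hΩ
  have hint : Integrable (K.indicator fun _ => ‖C ^ 2‖ * 1) :=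
    continuousOn_const.integrable_indicator_norm hK 1
  have hcont : ∀ k, Continuous (gradient (ψ k)) := fun k =>
    ((htest k).1.of_le (by exact_mod_cast le_top)).continuous_gradient
  have h1 : Tendsto (fun k => ∫ x, ‖gradient (ψ k) x‖ ^ 2) atTop
      (𝓝 (∫ x, ‖gradient φ x‖ ^ 2)) := by
    refine tendsto_integral_of_dominated_convergence _ ?_ hint ?_ ?_
    · exact fun k => ((hcont k).norm.pow 2).aestronglyMeasurable
    · refine fun k => Eventually.of_forall fun x => ?_
      by_cases hx : x ∈ K
      · rw [indicator_of_mem hx, mul_one, norm_pow, norm_norm, norm_pow]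
        exact pow_le_pow_left₀ (norm_nonneg _) ((hbd k x).2.trans (le_abs_self _)) _
      · simp [hx, (hzero k x hx).2]
    · exact Eventually.of_forall fun x => ((hlim x).2.norm).pow 2
  have h2 : Tendsto (fun k => ∫ x, ψ k x ^ 2) atTop (𝓝 (∫ x, φ x ^ 2)) := by
    refine tendsto_integral_of_dominated_convergence _ ?_ hint ?_ ?_
    · exact fun k => ((htest k).1.continuous.pow 2).aestronglyMeasurable
    · refine fun k => Eventually.of_forall fun x => ?_
      by_cases hx : x ∈ K
      · rw [indicator_of_mem hx, mul_one, norm_pow, norm_pow]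
        exact pow_le_pow_left₀ (norm_nonneg _) ((hbd k x).1.trans (le_abs_self _)) _
      · simp [hx, (hzero k x hx).1]
    · exact Eventually.of_forall fun x => (hlim x).1.pow 2
  refine le_of_tendsto_of_tendsto (h2.const_mul lam) h1 (Eventually.of_forall fun k => ?_)
  have := hw _ (htest k)
  rwa [setIntegral_eq_integral_of_forall_compl_eq_zero,
    setIntegral_eq_integral_of_forall_compl_eq_zero] at this
  · intro x hx
    simp [(hzero k x fun h => hx (hKΩ h)).2]
  · intro x hx
    simp [(hzero k x fun h => hx (hKΩ h)).1]

end Extension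

section Dilation

variable {N : ℕ} {Ω : Set (EuclideanSpace ℝ (Fin N))}

lemma hasDerivAt_integral_dilation {φ η : EuclideanSpace ℝ (Fin N) → ℝ} (hφ : IsC1TestFun Ω φ)
    (hη : Integrable η) (hη' : Integrable fun y => ‖y‖ * ‖η y‖) (x₀ : EuclideanSpace ℝ (Fin N))
    (s : ℝ) :
    HasDerivAt (fun s : ℝ => ∫ y, φ (x₀ + s • y) * η y)
      (∫ y, ⟪gradient φ (x₀ + s • y), y⟫ * η y) s := by
  obtain ⟨C, hC, hb⟩ := hφ.exists_bound
  have hcs : ∀ s : ℝ, Continuous fun y : EuclideanSpace ℝ (Fin N) => x₀ + s • y := fun s => by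
    fun_prop
  refine (hasDerivAt_integral_of_dominated_loc_of_deriv_le (bound := fun y => C * (‖y‖ * ‖η y‖))
    (F' := fun (s : ℝ) y => ⟪gradient φ (x₀ + s • y), y⟫ * η y)
    (s := univ) univ_mem ?_ ?_ ?_ ?_ ?_ ?_).2
  · exact Eventually.of_forall fun s =>
      (hφ.continuous.comp (hcs s)).aestronglyMeasurable.mul hη.aestronglyMeasurable
  · exact hη.bdd_mul (hφ.continuous.comp (hcs s)).aestronglyMeasurable
      (Eventually.of_forall fun y => (hb _).1)
  · exact (((hφ.continuous_gradient.comp (hcs s)).inner continuous_id).aestronglyMeasurable).mul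
      hη.aestronglyMeasurable
  · refine Eventually.of_forall fun y s _ => ?_
    rw [norm_mul, ← mul_assoc]
    refine mul_le_mul_of_nonneg_right ?_ (norm_nonneg _)
    exact (norm_inner_le_norm _ _).trans (mul_le_mul_of_nonneg_right (hb _).2 (norm_nonneg _))
  · exact hη'.const_mul C
  · refine Eventually.of_forall fun y s _ => HasDerivAt.mul_const ?_ _
    have h1 : HasDerivAt (fun s : ℝ => x₀ + s • y) y s := by
      simpa using ((hasDerivAt_id s).smul_const y).const_add x₀
    have h2 := (hφ.differentiable (x₀ + s • y)).hasFDerivAt.comp_hasDerivAt s h1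
    rw [inner_gradient_left]
    exact h2

/-- Divergence theorem for the radial field `‖x - x₀‖ ^ γ • (x - x₀)`. -/
lemma integral_radial_field {φ : EuclideanSpace ℝ (Fin N) → ℝ} (hφ : IsC1TestFun Ω φ)
    (x₀ : EuclideanSpace ℝ (Fin N)) {γ : ℝ} (hγ : 0 ≤ γ) :
    ∫ x, ⟪‖x - x₀‖ ^ γ • (x - x₀), gradient φ x⟫ = -((N + γ) * ∫ x, ‖x - x₀‖ ^ γ * φ x) := by
  obtain ⟨R, hR⟩ := (hφ.2.isCompact.isBounded).subset_closedBall x₀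
  have hR0 : tsupport φ ⊆ Metric.closedBall x₀ |R| :=
    hR.trans (Metric.closedBall_subset_closedBall (le_abs_self R))
  let B : Set (EuclideanSpace ℝ (Fin N)) := Metric.closedBall 0 (2 * |R|)
  have hB : IsCompact B := isCompact_closedBall _ _
  have hcγ : Continuous fun y : EuclideanSpace ℝ (Fin N) => ‖y‖ ^ γ :=
    continuous_norm.rpow_const fun _ => Or.inr hγ
  let η : EuclideanSpace ℝ (Fin N) → ℝ := B.indicator fun y => ‖y‖ ^ γ
  have hη : Integrable η := by
    rw [integrable_indicator_iff hB.measurableSet]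
    exact hcγ.continuousOn.integrableOn_compact hB
  have hη' : Integrable fun y => ‖y‖ * ‖η y‖ := by
    have : (fun y => ‖y‖ * ‖η y‖) = B.indicator fun y => ‖y‖ * ‖‖y‖ ^ γ‖ := by
      ext y
      by_cases hy : y ∈ B <;> simp [η, hy]
    rw [this, integrable_indicator_iff hB.measurableSet]
    exact (continuous_norm.mul hcγ.norm).continuousOn.integrableOn_compact hB
  have hd := hasDerivAt_integral_dilation hφ hη hη' x₀ 1
  set I : ℝ := ∫ x, ‖x - x₀‖ ^ γ * φ x with hI
  have key : ∀ s : ℝ, 1 / 2 < s →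
      ∫ y, φ (x₀ + s • y) * η y = s ^ (-(N + γ)) * I := by
    intro s hs
    have hs0 : 0 < s := by linarith
    have h1 : ∀ y, φ (x₀ + s • y) * η y = s ^ (-γ) * (‖s • y‖ ^ γ * φ (x₀ + s • y)) := by
      intro y
      rw [norm_smul, Real.norm_of_nonneg hs0.le, Real.mul_rpow hs0.le (norm_nonneg _)]
      by_cases hy : y ∈ B
      · simp only [η, indicator_of_mem hy]
        rw [Real.rpow_neg hs0.le]
        have := (Real.rpow_pos_of_pos hs0 γ).ne'
        field_simp
      · have : φ (x₀ + s • y) = 0 := by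
          refine image_eq_zero_of_notMem_tsupport fun h => hy ?_
          have := hR0 h
          simp only [Metric.mem_closedBall, dist_self_add_left, norm_smul,
            Real.norm_of_nonneg hs0.le, B, dist_zero_right] at this ⊢
          nlinarith [norm_nonneg y]
        simp [this]
    simp_rw [h1]
    rw [integral_const_mul]
    have h2 := Measure.integral_comp_smul (volume : Measure (EuclideanSpace ℝ (Fin N)))
      (fun z => ‖z‖ ^ γ * φ (x₀ + z)) s
    rw [h2, finrank_euclideanSpace_fin, abs_of_pos (by positivity)]
    have h3 : ∫ z, ‖z‖ ^ γ * φ (x₀ + z) = I := by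
      rw [hI, ← integral_add_left_eq_self (fun x => ‖x - x₀‖ ^ γ * φ x) x₀]
      simp only [add_sub_cancel_left]
    rw [h3, smul_eq_mul, ← mul_assoc, neg_add, Real.rpow_add hs0, Real.rpow_neg hs0.le (N : ℝ),
      Real.rpow_natCast]
    ring
  have hd2 : HasDerivAt (fun s : ℝ => ∫ y, φ (x₀ + s • y) * η y) (-(N + γ) * I) 1 := by
    have h := (Real.hasDerivAt_rpow_const (x := 1) (p := -(N + γ)) (Or.inl one_ne_zero)).mul_const I
    simp only [Real.one_rpow, mul_one] at h
    refine h.congr_of_eventuallyEq ?_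
    filter_upwards [lt_mem_nhds (show (1 / 2 : ℝ) < 1 by norm_num)] with s hs using key s hs
  have h4 := hd.unique hd2
  rw [neg_mul] at h4
  rw [← h4, ← integral_add_left_eq_self _ x₀]
  refine integral_congr_ae (Eventually.of_forall fun y => ?_)
  simp only [add_sub_cancel_left, one_smul]
  rw [real_inner_smul_left, real_inner_comm, mul_comm]
  by_cases hy : y ∈ B
  · simp [η, hy]
  · have : gradient φ (x₀ + y) = 0 := by
      refine gradient_of_notMem_tsupport fun h => hy ?_
      have := hR0 h
      simp only [Metric.mem_closedBall, dist_self_add_left, B, dist_zero_right] at this ⊢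
      linarith [abs_nonneg R]
    simp [this]

end Dilation

section RadialKernel

lemma hasDerivAt_max_zero_sq (t : ℝ) :
    HasDerivAt (fun t : ℝ => max t 0 ^ 2) (2 * max t 0) t := by
  rcases lt_trichotomy t 0 with ht | rfl | ht
  · rw [max_eq_right ht.le, mul_zero]
    refine (hasDerivAt_const t (0 : ℝ)).congr_of_eventuallyEq ?_
    filter_upwards [gt_mem_nhds ht] with s hs
    simp [max_eq_right hs.le]
  · rw [max_self, mul_zero, hasDerivAt_iff_isLittleO_nhds_zero]
    simp only [zero_add, max_self, smul_zero, sub_zero, ne_eq, OfNat.ofNat_ne_zero,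
      not_false_eq_true, zero_pow]
    refine Asymptotics.IsBigO.trans_isLittleO (g := fun h : ℝ => h ^ 2) ?_ ?_
    · refine Asymptotics.isBigO_of_le _ fun h => ?_
      rw [norm_pow, norm_pow]
      refine pow_le_pow_left₀ (norm_nonneg _) ?_ 2
      rw [Real.norm_eq_abs, Real.norm_eq_abs, abs_of_nonneg (le_max_right _ _)]
      exact max_le (le_abs_self _) (abs_nonneg _)
    · simpa using Asymptotics.isLittleO_pow_pow (𝕜 := ℝ) (m := 1) (n := 2) (by norm_num)
  · rw [max_eq_left ht.le]
    have : HasDerivAt (fun t : ℝ => t ^ 2) (2 * t) t := by simpa using hasDerivAt_pow 2 t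
    refine this.congr_of_eventuallyEq ?_
    filter_upwards [lt_mem_nhds ht] with s hs
    simp [max_eq_left hs.le]

lemma contDiff_max_zero_sq : ContDiff ℝ 1 fun t : ℝ => max t 0 ^ 2 := by
  rw [contDiff_one_iff_deriv]
  refine ⟨fun t => (hasDerivAt_max_zero_sq t).differentiableAt, ?_⟩
  rw [funext fun t => (hasDerivAt_max_zero_sq t).deriv]
  fun_prop

variable {N : ℕ}

/-- The radial weight `(1 - ‖y‖²)⁺`. -/
def radialWeight (y : EuclideanSpace ℝ (Fin N)) : ℝ := max (1 - ‖y‖ ^ 2) 0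

/-- The `C¹` radial bump of radius `s` centred at `x₀`. -/
def radialBump (x₀ : EuclideanSpace ℝ (Fin N)) (s : ℝ) (x : EuclideanSpace ℝ (Fin N)) : ℝ :=
  radialWeight (s⁻¹ • (x - x₀)) ^ 2

lemma continuous_radialWeight : Continuous (radialWeight (N := N)) := by
  unfold radialWeight; fun_prop

lemma radialWeight_nonneg (y : EuclideanSpace ℝ (Fin N)) : 0 ≤ radialWeight y := le_max_right _ _

lemma radialWeight_le_one (y : EuclideanSpace ℝ (Fin N)) : radialWeight y ≤ 1 :=
  max_le (by nlinarith [norm_nonneg y]) zero_le_one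

lemma radialWeight_eq_zero {y : EuclideanSpace ℝ (Fin N)} (hy : 1 ≤ ‖y‖) : radialWeight y = 0 :=
  max_eq_right (by nlinarith)

lemma hasCompactSupport_radialWeight : HasCompactSupport (radialWeight (N := N)) := by
  refine HasCompactSupport.of_support_subset_isCompact (isCompact_closedBall 0 1) fun y hy => ?_
  rw [mem_closedBall_zero_iff]
  by_contra h
  exact hy (radialWeight_eq_zero (not_le.1 h).le)

lemma integrable_radialWeight : Integrable (radialWeight (N := N)) :=
  continuous_radialWeight.integrable_of_hasCompactSupport hasCompactSupport_radialWeight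

lemma integral_radialWeight_pos : 0 < ∫ y, radialWeight (N := N) y := by
  refine continuous_radialWeight.integral_pos_of_hasCompactSupport_nonneg_nonzero
    hasCompactSupport_radialWeight radialWeight_nonneg (x := 0) ?_
  simp [radialWeight]

lemma contDiff_radialBump (x₀ : EuclideanSpace ℝ (Fin N)) (s : ℝ) :
    ContDiff ℝ 1 (radialBump x₀ s) := by
  refine contDiff_max_zero_sq.comp (contDiff_const.sub ?_)
  exact ((contDiff_id.sub contDiff_const).const_smul _).norm_sq ℝ

lemma radialBump_nonneg (x₀ : EuclideanSpace ℝ (Fin N)) (s : ℝ) (x : EuclideanSpace ℝ (Fin N)) :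
    0 ≤ radialBump x₀ s x := sq_nonneg _

lemma tsupport_radialBump_subset (x₀ : EuclideanSpace ℝ (Fin N)) {s : ℝ} (hs : 0 < s) :
    tsupport (radialBump x₀ s) ⊆ Metric.closedBall x₀ s := by
  refine closure_minimal (fun x hx => ?_) Metric.isClosed_closedBall
  rw [Metric.mem_closedBall, dist_eq_norm]
  by_contra h
  refine hx ?_
  rw [radialBump, radialWeight_eq_zero, zero_pow two_ne_zero]
  rw [norm_smul, norm_inv, Real.norm_of_nonneg hs.le, inv_mul_eq_div, one_le_div hs]
  exact (not_le.1 h).le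

lemma isC1TestFun_radialBump {Ω : Set (EuclideanSpace ℝ (Fin N))} {x₀ : EuclideanSpace ℝ (Fin N)}
    {s : ℝ} (hs : 0 < s) (h : Metric.closedBall x₀ s ⊆ Ω) : IsC1TestFun Ω (radialBump x₀ s) :=
  ⟨contDiff_radialBump x₀ s, (isCompact_closedBall x₀ s).of_isClosed_subset (isClosed_tsupport _)
    (tsupport_radialBump_subset x₀ hs), (tsupport_radialBump_subset x₀ hs).trans h⟩

lemma gradient_radialBump (x₀ : EuclideanSpace ℝ (Fin N)) (s : ℝ)
    (x : EuclideanSpace ℝ (Fin N)) :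
    gradient (radialBump x₀ s) x =
      (-(4 * s⁻¹) * radialWeight (s⁻¹ • (x - x₀))) • (s⁻¹ • (x - x₀)) := by
  refine HasGradientAt.gradient ?_
  rw [hasGradientAt_iff_hasFDerivAt]
  have h1 : HasFDerivAt (fun x => s⁻¹ • (x - x₀))
      (s⁻¹ • ContinuousLinearMap.id ℝ (EuclideanSpace ℝ (Fin N))) x :=
    ((hasFDerivAt_id x).sub_const x₀).const_smul s⁻¹
  have h2 := (h1.norm_sq).const_sub 1
  have h3 := (hasDerivAt_max_zero_sq (1 - ‖s⁻¹ • (x - x₀)‖ ^ 2)).comp_hasFDerivAt x h2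
  refine h3.congr_fderiv ?_
  ext v
  simp [radialWeight]
  ring

lemma norm_gradient_radialBump_le (x₀ : EuclideanSpace ℝ (Fin N)) {s : ℝ} (hs : 0 < s)
    (x : EuclideanSpace ℝ (Fin N)) :
    ‖gradient (radialBump x₀ s) x‖ ≤ 4 * s⁻¹ := by
  rw [gradient_radialBump, norm_smul, norm_mul, norm_neg, Real.norm_of_nonneg (by positivity),
    Real.norm_of_nonneg (radialWeight_nonneg _), mul_assoc]
  refine mul_le_of_le_one_right (by positivity) ?_
  rcases le_total 1 ‖s⁻¹ • (x - x₀)‖ with h | h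
  · simp [radialWeight_eq_zero h]
  · exact mul_le_one₀ (radialWeight_le_one _) (norm_nonneg _) h

lemma integral_comp_affine (g : EuclideanSpace ℝ (Fin N) → ℝ) (x₀ : EuclideanSpace ℝ (Fin N))
    {s : ℝ} (hs : 0 < s) : ∫ y, g (x₀ + s • y) = (s ^ N)⁻¹ * ∫ x, g x := by
  have h2 := Measure.integral_comp_smul (volume : Measure (EuclideanSpace ℝ (Fin N)))
    (fun z => g (x₀ + z)) s
  rw [h2, finrank_euclideanSpace_fin, abs_of_pos (by positivity), smul_eq_mul,
    integral_add_left_eq_self g x₀]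

lemma integral_dilation_eq (φ : EuclideanSpace ℝ (Fin N) → ℝ) (x₀ : EuclideanSpace ℝ (Fin N))
    {s : ℝ} (hs : 0 < s) : ∫ y, φ (x₀ + s • y) * radialWeight y =
      (s ^ N)⁻¹ * ∫ x, φ x * radialWeight (s⁻¹ • (x - x₀)) := by
  rw [← integral_comp_affine _ x₀ hs]
  simp [hs.ne']

/-- The derivative in `s` of the radial averages of `φ` over balls of radius `s`. -/
lemma hasDerivAt_radial_average {Ω : Set (EuclideanSpace ℝ (Fin N))}
    {φ : EuclideanSpace ℝ (Fin N) → ℝ} (hφ : IsC1TestFun Ω φ) (x₀ : EuclideanSpace ℝ (Fin N)) :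
    Differentiable ℝ (fun s : ℝ => ∫ y, φ (x₀ + s • y) * radialWeight y) ∧
    ∀ s : ℝ, 0 < s → deriv (fun s : ℝ => ∫ y, φ (x₀ + s • y) * radialWeight y) s =
      -((s / 4) * ((s ^ N)⁻¹ * ∫ x, ⟪gradient φ x, gradient (radialBump x₀ s) x⟫)) := by
  have hη' : Integrable fun y : EuclideanSpace ℝ (Fin N) => ‖y‖ * ‖radialWeight y‖ :=
    (continuous_norm.mul continuous_radialWeight.norm).integrable_of_hasCompactSupport
      (hasCompactSupport_radialWeight.norm.mul_left)
  have hd := hasDerivAt_integral_dilation hφ integrable_radialWeight hη' x₀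
  refine ⟨fun s => (hd s).differentiableAt, fun s hs => ?_⟩
  rw [(hd s).deriv, ← integral_comp_affine _ x₀ hs, ← integral_const_mul, ← integral_neg]
  refine integral_congr_ae (Eventually.of_forall fun y => ?_)
  simp only [gradient_radialBump, add_sub_cancel_left, inv_smul_smul₀ hs.ne', real_inner_smul_right]
  field_simp

end RadialKernel

section Harnack

variable {N : ℕ}

/-- A sup bound by the `L¹` norm for weak subsolutions on the whole space. -/
lemma exists_sup_bound (N : ℕ) {c b : ℝ} (hc : 0 ≤ c) (hb : 0 ≤ b) :
    ∃ C : ℝ, 0 ≤ C ∧ ∀ φ : EuclideanSpace ℝ (Fin N) → ℝ, IsC1TestFun univ φ → (∀ x, 0 ≤ φ x) →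
      (∀ ψ, IsC1TestFun univ ψ → (∀ x, 0 ≤ ψ x) →
        ∫ x, ⟪gradient φ x, gradient ψ x⟫ ≤ c * ∫ x, (φ x + b) * ψ x) →
      ∀ x, φ x ≤ C * ((∫ y, φ y) + 1) := by
  set κ := ∫ y, radialWeight (N := N) y with hκ
  have hκ0 : 0 < κ := integral_radialWeight_pos
  refine ⟨Real.exp c * (1 / κ + b), by positivity, fun φ hφ h0 hsub x₀ => ?_⟩
  obtain ⟨hdiff, hderiv⟩ := hasDerivAt_radial_average hφ x₀
  set m : ℝ → ℝ := fun s => ∫ y, φ (x₀ + s • y) * radialWeight y with hm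
  have hint : ∀ s : ℝ, Integrable fun y => (φ (x₀ + s • y) + b) * radialWeight y := fun s =>
    (((hφ.continuous.comp (by fun_prop)).add continuous_const).mul
      continuous_radialWeight).integrable_of_hasCompactSupport
      (hasCompactSupport_radialWeight.mul_left)
  have hV : ∀ s, m s + b * κ = ∫ y, (φ (x₀ + s • y) + b) * radialWeight y := by
    intro s
    simp_rw [add_mul]
    rw [integral_add, integral_const_mul]
    · exact ((hφ.continuous.comp (by fun_prop)).mul
        continuous_radialWeight).integrable_of_hasCompactSupport
        (hasCompactSupport_radialWeight.mul_left)
    · exact integrable_radialWeight.const_mul b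
  have hV0 : ∀ s, 0 ≤ m s + b * κ := fun s => by
    rw [hV]
    exact integral_nonneg fun y => mul_nonneg (add_nonneg (h0 _) hb) (radialWeight_nonneg _)
  have hlow : ∀ s, 0 < s → s < 1 → -(c * (m s + b * κ)) ≤ deriv m s := by
    intro s hs hs1
    rw [hderiv s hs, neg_le_neg_iff]
    have h1 := hsub _ (isC1TestFun_radialBump (x₀ := x₀) hs (subset_univ _)) (radialBump_nonneg _ _)
    have h2 : (s ^ N)⁻¹ * ∫ x, (φ x + b) * radialBump x₀ s x ≤ m s + b * κ := by
      rw [← integral_comp_affine _ x₀ hs, hV]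
      have heq : ∀ y, radialBump x₀ s (x₀ + s • y) = radialWeight y ^ 2 := fun y => by
        simp [radialBump, hs.ne']
      refine integral_mono_of_nonneg (Eventually.of_forall fun y => mul_nonneg
        (add_nonneg (h0 _) hb) (radialBump_nonneg _ _ _)) (hint s) (Eventually.of_forall fun y => ?_)
      simp only [heq]
      refine mul_le_mul_of_nonneg_left ?_ (add_nonneg (h0 _) hb)
      nlinarith [radialWeight_nonneg y, radialWeight_le_one y]
    have h3 : (s ^ N)⁻¹ * ∫ x, ⟪gradient φ x, gradient (radialBump x₀ s) x⟫ ≤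
        c * (m s + b * κ) := by
      refine (mul_le_mul_of_nonneg_left h1 (by positivity)).trans ?_
      rw [mul_left_comm]
      exact mul_le_mul_of_nonneg_left h2 hc
    have h4 : 0 ≤ c * (m s + b * κ) := mul_nonneg hc (hV0 s)
    nlinarith
  have hmono : MonotoneOn (fun s => Real.exp (c * s) * (m s + b * κ)) (Icc 0 1) := by
    have hdm : Differentiable ℝ fun s => Real.exp (c * s) * (m s + b * κ) := by fun_prop
    refine monotoneOn_of_deriv_nonneg (convex_Icc 0 1) hdm.continuous.continuousOn
      hdm.differentiableOn fun s hs => ?_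
    rw [interior_Icc] at hs
    have hd : HasDerivAt (fun s => Real.exp (c * s) * (m s + b * κ))
        (Real.exp (c * s) * c * (m s + b * κ) + Real.exp (c * s) * deriv m s) s := by
      refine HasDerivAt.mul ?_ ((hdiff s).hasDerivAt.add_const _)
      simpa using ((hasDerivAt_id s).const_mul c).exp
    rw [hd.deriv]
    have := mul_le_mul_of_nonneg_left (hlow s hs.1 hs.2) (Real.exp_pos (c * s)).le
    linarith
  have h01 := hmono (left_mem_Icc.2 zero_le_one) (right_mem_Icc.2 zero_le_one) zero_le_one
  simp only [mul_zero, Real.exp_zero, one_mul, mul_one] at h01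
  have hm0 : m 0 = φ x₀ * κ := by simp [hm, integral_const_mul, hκ]
  have hm1 : m 1 ≤ ∫ y, φ y := by
    rw [← integral_add_left_eq_self φ x₀]
    simp only [hm, one_smul]
    refine integral_mono_of_nonneg
      (Eventually.of_forall fun y => mul_nonneg (h0 _) (radialWeight_nonneg _)) ?_
      (Eventually.of_forall fun y => mul_le_of_le_one_right (h0 _) (radialWeight_le_one _))
    exact (hφ.continuous.integrable_of_hasCompactSupport hφ.2).comp_add_left x₀
  have hS : 0 ≤ ∫ y, φ y := integral_nonneg h0
  have h5 : φ x₀ * κ ≤ Real.exp c * ((∫ y, φ y) + b * κ) := by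
    have := mul_le_mul_of_nonneg_left (add_le_add_left hm1 (b * κ)) (Real.exp_pos c).le
    have : 0 ≤ b * κ := by positivity
    linarith
  calc φ x₀ = φ x₀ * κ / κ := by field_simp
    _ ≤ Real.exp c * ((∫ y, φ y) + b * κ) / κ := by gcongr
    _ = Real.exp c * (1 / κ * (∫ y, φ y) + b) := by field_simp
    _ ≤ Real.exp c * ((1 / κ + b) * ((∫ y, φ y) + 1)) := by
      gcongr
      have : 0 ≤ 1 / κ := by positivity
      nlinarith [mul_nonneg hb hS]
    _ = _ := by ring

end Harnack

section HarnackChain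

variable {N : ℕ}

/-- Nonnegative test functions on `D` that are weakly superharmonic up to an error of size `σ`. -/
structure AlmostSuperharmonic (D : Set (EuclideanSpace ℝ (Fin N)))
    (φ : EuclideanSpace ℝ (Fin N) → ℝ) (σ : ℝ) : Prop where
  isC1TestFun : IsC1TestFun D φ
  nonneg : ∀ x, 0 ≤ φ x
  error_nonneg : 0 ≤ σ
  lower : ∀ ψ, IsC1TestFun D ψ → (∀ x, 0 ≤ ψ x) →
    -(σ * √(∫ x, ‖gradient ψ x‖ ^ 2)) ≤ ∫ x, ⟪gradient φ x, gradient ψ x⟫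

lemma IsC1TestFun.integrable {D : Set (EuclideanSpace ℝ (Fin N))}
    {φ : EuclideanSpace ℝ (Fin N) → ℝ} (h : IsC1TestFun D φ) : Integrable φ :=
  h.continuous.integrable_of_hasCompactSupport h.2

/-- The weak Harnack inequality on concentric balls. -/
lemma exists_concentric_harnack {D : Set (EuclideanSpace ℝ (Fin N))}
    {y : EuclideanSpace ℝ (Fin N)} {τ R : ℝ} (hτ : 0 < τ) (hτR : τ ≤ R)
    (hR : Metric.closedBall y R ⊆ D) :
    ∃ C : ℝ, 0 ≤ C ∧ ∀ φ σ, AlmostSuperharmonic D φ σ →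
      ∫ x in Metric.ball y (R / 2), φ x ≤ C * ((∫ x in Metric.ball y τ, φ x) + σ) := by
  have hR0 : 0 < R := hτ.trans_le hτR
  set L : ℝ := √((4 * τ⁻¹) ^ 2 * volume.real (Metric.closedBall y R)) with hL
  set A : ℝ := R / 4 * ((τ ^ N)⁻¹ * L) with hA
  have hA0 : 0 ≤ A := by positivity
  refine ⟨4 / 3 * R ^ N * ((τ ^ N)⁻¹ + A * R), by positivity, fun φ σ hφ => ?_⟩
  obtain ⟨hdiff, hderiv⟩ := hasDerivAt_radial_average hφ.1 y
  have h0 := hφ.nonneg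
  have hσ := hφ.error_nonneg
  set m : ℝ → ℝ := fun s => ∫ z, φ (y + s • z) * radialWeight z with hm
  have hup : ∀ s ∈ interior (Icc τ R), deriv m s ≤ A * σ := by
    intro s hs
    rw [interior_Icc] at hs
    have hs0 : 0 < s := hτ.trans hs.1
    have htest : IsC1TestFun D (radialBump y s) :=
      isC1TestFun_radialBump hs0 ((Metric.closedBall_subset_closedBall hs.2.le).trans hR)
    rw [hderiv s hs0]
    have h1 := hφ.lower _ htest (radialBump_nonneg _ _)
    have h2 : √(∫ x, ‖gradient (radialBump y s) x‖ ^ 2) ≤ L := by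
      refine Real.sqrt_le_sqrt ?_
      rw [← setIntegral_eq_integral_of_forall_compl_eq_zero (s := Metric.closedBall y R)]
      · have : ∀ x ∈ Metric.closedBall y R, ‖‖gradient (radialBump y s) x‖ ^ 2‖ ≤
            (4 * τ⁻¹) ^ 2 := by
          intro x _
          rw [norm_pow, norm_norm]
          refine pow_le_pow_left₀ (norm_nonneg _)
            ((norm_gradient_radialBump_le y hs0 x).trans ?_) 2
          have := hs.1.le
          gcongr
        exact (Real.le_norm_self _).trans
          (norm_setIntegral_le_of_norm_le_const measure_closedBall_lt_top this)
      · intro x hx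
        rw [gradient_of_notMem_tsupport, norm_zero, zero_pow two_ne_zero]
        exact fun h => hx (Metric.closedBall_subset_closedBall hs.2.le
          (tsupport_radialBump_subset y hs0 h))
    have h3 : -∫ x, ⟪gradient φ x, gradient (radialBump y s) x⟫ ≤ L * σ := by
      nlinarith
    rw [← mul_neg, ← mul_neg]
    have hLσ : 0 ≤ L * σ := by positivity
    calc s / 4 * ((s ^ N)⁻¹ * -∫ x, ⟪gradient φ x, gradient (radialBump y s) x⟫)
        ≤ s / 4 * ((s ^ N)⁻¹ * (L * σ)) := by gcongr
      _ ≤ R / 4 * ((τ ^ N)⁻¹ * (L * σ)) := by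
        have := hs.1.le
        have := hs.2.le
        gcongr
      _ = A * σ := by rw [hA]; ring
  have h1 : m R - m τ ≤ A * σ * (R - τ) :=
    (convex_Icc τ R).image_sub_le_mul_sub_of_deriv_le hdiff.continuous.continuousOn
      hdiff.differentiableOn hup τ (left_mem_Icc.2 hτR) R (right_mem_Icc.2 hτR) hτR
  have hmint : ∀ s : ℝ, Integrable fun x => φ x * radialWeight (s⁻¹ • (x - y)) := fun s =>
    (hφ.1.continuous.mul (continuous_radialWeight.comp
      (by fun_prop))).integrable_of_hasCompactSupport hφ.1.2.mul_right
  have hmR : (R ^ N)⁻¹ * (3 / 4 * ∫ x in Metric.ball y (R / 2), φ x) ≤ m R := by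
    rw [hm]
    simp only
    rw [integral_dilation_eq φ y hR0]
    refine mul_le_mul_of_nonneg_left ?_ (by positivity)
    rw [← integral_const_mul]
    refine le_trans ?_ (setIntegral_le_integral (s := Metric.ball y (R / 2)) (hmint R)
      (Eventually.of_forall fun x => mul_nonneg (h0 x) (radialWeight_nonneg _)))
    refine setIntegral_mono_on (hφ.1.integrable.const_mul _).integrableOn (hmint R).integrableOn
      measurableSet_ball fun x hx => ?_
    rw [mul_comm]
    refine mul_le_mul_of_nonneg_left ?_ (h0 x)
    refine le_trans ?_ (le_max_left _ _)
    have hx' : ‖R⁻¹ • (x - y)‖ ≤ 1 / 2 := by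
      rw [norm_smul, norm_inv, Real.norm_of_nonneg hR0.le, inv_mul_le_iff₀ hR0]
      rw [Metric.mem_ball, dist_eq_norm] at hx
      linarith
    nlinarith [norm_nonneg (R⁻¹ • (x - y))]
  have hmτ : m τ ≤ (τ ^ N)⁻¹ * ∫ x in Metric.ball y τ, φ x := by
    rw [hm]
    simp only
    rw [integral_dilation_eq φ y hτ]
    refine mul_le_mul_of_nonneg_left ?_ (by positivity)
    rw [← setIntegral_eq_integral_of_forall_compl_eq_zero (s := Metric.ball y τ)]
    · exact setIntegral_mono_on (hmint τ).integrableOn hφ.1.integrable.integrableOn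
        measurableSet_ball fun x _ => mul_le_of_le_one_right (h0 x) (radialWeight_le_one _)
    · intro x hx
      rw [radialWeight_eq_zero, mul_zero]
      rw [norm_smul, norm_inv, Real.norm_of_nonneg hτ.le, inv_mul_eq_div, one_le_div hτ]
      simpa [dist_eq_norm] using hx
  have hI : 0 ≤ ∫ x in Metric.ball y τ, φ x := integral_nonneg h0
  have h2 : (R ^ N)⁻¹ * (3 / 4 * ∫ x in Metric.ball y (R / 2), φ x) ≤
      ((τ ^ N)⁻¹ + A * R) * ((∫ x in Metric.ball y τ, φ x) + σ) := by
    have e1 : 0 ≤ (τ ^ N)⁻¹ * σ := by positivity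
    have e2 : 0 ≤ A * R * ∫ x in Metric.ball y τ, φ x := by positivity
    have e3 : 0 ≤ A * σ * τ := by positivity
    nlinarith
  calc ∫ x in Metric.ball y (R / 2), φ x
      = 4 / 3 * R ^ N * ((R ^ N)⁻¹ * (3 / 4 * ∫ x in Metric.ball y (R / 2), φ x)) := by
        field_simp
    _ ≤ 4 / 3 * R ^ N * (((τ ^ N)⁻¹ + A * R) * ((∫ x in Metric.ball y τ, φ x) + σ)) := by
        gcongr
    _ = _ := by ring

lemma AlmostSuperharmonic.setIntegral_mono {D s t : Set (EuclideanSpace ℝ (Fin N))}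
    {φ : EuclideanSpace ℝ (Fin N) → ℝ} {σ : ℝ} (h : AlmostSuperharmonic D φ σ) (hst : s ⊆ t) :
    ∫ x in s, φ x ≤ ∫ x in t, φ x :=
  setIntegral_mono_set h.1.integrable.integrableOn (Eventually.of_forall h.nonneg)
    (Eventually.of_forall hst)

/-- The weak Harnack inequality along chains of balls in a connected open set. -/
lemma exists_harnack {D : Set (EuclideanSpace ℝ (Fin N))} (hD : IsOpen D)
    (hDc : IsPreconnected D) {x₀ : EuclideanSpace ℝ (Fin N)} (hx₀ : x₀ ∈ D) {r : ℝ} (hr : 0 < r)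
    {K : Set (EuclideanSpace ℝ (Fin N))} (hK : IsCompact K) (hKD : K ⊆ D) :
    ∃ C : ℝ, 0 ≤ C ∧ ∀ φ σ, AlmostSuperharmonic D φ σ →
      ∫ x in K, φ x ≤ C * ((∫ x in Metric.ball x₀ r, φ x) + σ) := by
  let P : Set (EuclideanSpace ℝ (Fin N)) → Prop := fun s =>
    ∃ C : ℝ, 0 ≤ C ∧ ∀ φ σ, AlmostSuperharmonic D φ σ →
      ∫ x in s, φ x ≤ C * ((∫ x in Metric.ball x₀ r, φ x) + σ)
  have hPmono : ∀ ⦃s t⦄, s ⊆ t → P t → P s := by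
    rintro s t hst ⟨C, hC, h⟩
    exact ⟨C, hC, fun φ σ hφ => (hφ.setIntegral_mono hst).trans (h φ σ hφ)⟩
  let E : Set (EuclideanSpace ℝ (Fin N)) := {x | ∃ ρ > 0, P (Metric.ball x ρ)}
  have hEo : IsOpen E := by
    rw [Metric.isOpen_iff]
    rintro x ⟨ρ, hρ, h⟩
    refine ⟨ρ / 2, half_pos hρ, fun y hy => ⟨ρ / 2, half_pos hρ, hPmono ?_ h⟩⟩
    refine Metric.ball_subset_ball' ?_
    rw [Metric.mem_ball] at hy
    linarith
  have hDE : D ⊆ E := by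
    refine hDc.subset_of_closure_inter_subset hEo ⟨x₀, hx₀, r, hr, 1, zero_le_one, ?_⟩ ?_
    · intro φ σ hφ
      linarith [hφ.error_nonneg]
    · rintro x ⟨hxE, hxD⟩
      obtain ⟨ε, hε, hball⟩ := Metric.isOpen_iff.1 hD x hxD
      obtain ⟨y, ⟨ρ, hρ, C₁, hC₁, h₁⟩, hxy⟩ := Metric.mem_closure_iff.1 hxE (ε / 8) (by positivity)
      rw [dist_comm] at hxy
      have hτ : 0 < min ρ (ε / 2) := by positivity
      obtain ⟨C₂, hC₂, h₂⟩ := exists_concentric_harnack (D := D) (y := y) hτ (min_le_right _ _)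
        ((Metric.closedBall_subset_ball' (by linarith)).trans hball)
      refine ⟨ε / 8, by positivity, C₂ * (C₁ + 1), by positivity, fun φ σ hφ => ?_⟩
      have e1 := h₁ φ σ hφ
      have e2 := h₂ φ σ hφ
      have e3 : ∫ z in Metric.ball y (min ρ (ε / 2)), φ z ≤ ∫ z in Metric.ball y ρ, φ z :=
        hφ.setIntegral_mono (Metric.ball_subset_ball (min_le_left _ _))
      have e4 : ∫ z in Metric.ball x (ε / 8), φ z ≤ ∫ z in Metric.ball y (ε / 2 / 2), φ z :=
        hφ.setIntegral_mono (Metric.ball_subset_ball' (by rw [dist_comm]; linarith))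
      have e5 : 0 ≤ ∫ z in Metric.ball x₀ r, φ z := integral_nonneg hφ.nonneg
      calc _ ≤ _ := e4
        _ ≤ _ := e2
        _ ≤ C₂ * (C₁ * ((∫ z in Metric.ball x₀ r, φ z) + σ) + σ) := by gcongr; exact e3.trans e1
        _ ≤ C₂ * ((C₁ + 1) * ((∫ z in Metric.ball x₀ r, φ z) + σ)) := by gcongr; linarith
        _ = _ := by ring
  refine hK.induction_on (p := P) ⟨0, le_rfl, fun φ σ _ => by simp⟩ hPmono ?_ ?_
  · rintro s t ⟨C₁, hC₁, h₁⟩ ⟨C₂, hC₂, h₂⟩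
    refine ⟨C₁ + C₂, by positivity, fun φ σ hφ => ?_⟩
    have hle : ∫ x in s ∪ t, φ x ≤ (∫ x in s, φ x) + ∫ x in t, φ x := by
      rw [← integral_add_measure hφ.1.integrable.integrableOn hφ.1.integrable.integrableOn]
      exact integral_mono_measure (Measure.restrict_union_le s t)
        (Eventually.of_forall hφ.nonneg)
        (integrable_add_measure.2 ⟨hφ.1.integrable.restrict, hφ.1.integrable.restrict⟩)
    linarith [h₁ φ σ hφ, h₂ φ σ hφ]
  · intro x hx
    obtain ⟨ρ, hρ, h⟩ := hDE (hKD hx)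
    exact ⟨Metric.ball x ρ, mem_nhdsWithin_of_mem_nhds (Metric.ball_mem_nhds x hρ), h⟩

end HarnackChain

section Cutoff

variable {N : ℕ} {B : Set (EuclideanSpace ℝ (Fin N))} {v φ ψ : EuclideanSpace ℝ (Fin N) → ℝ}
  {G : ℝ → ℝ}

lemma HasGradientAt.comp_real {x : EuclideanSpace ℝ (Fin N)} {g' : ℝ}
    {v' : EuclideanSpace ℝ (Fin N)} (hG : HasDerivAt G g' (v x)) (hv : HasGradientAt v v' x) :
    HasGradientAt (fun y => G (v y)) (g' • v') x := by
  rw [hasGradientAt_iff_hasFDerivAt] at *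
  rw [map_smul]
  exact hG.comp_hasFDerivAt x hv

lemma gradient_mul_of_differentiableAt {x : EuclideanSpace ℝ (Fin N)}
    (hφ : DifferentiableAt ℝ φ x) (hψ : DifferentiableAt ℝ ψ x) :
    gradient (fun y => φ y * ψ y) x = φ x • gradient ψ x + ψ x • gradient φ x := by
  have h1 := hφ.hasFDerivAt.mul hψ.hasFDerivAt
  rw [gradient_eq_toDual_symm, gradient_eq_toDual_symm, gradient_eq_toDual_symm]
  simp only
  rw [← map_smul, ← map_smul, ← map_add, ← h1.fderiv]
  rfl

lemma IsC1TestFun.mul {D : Set (EuclideanSpace ℝ (Fin N))} (hφ : IsC1TestFun B φ)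
    (hψ : IsC1TestFun D ψ) : IsC1TestFun B fun x => φ x * ψ x :=
  ⟨hφ.1.mul hψ.1, hφ.2.mul_right, (tsupport_mul_subset_left (f := φ) (g := ψ)).trans hφ.3⟩

/-- Composing with a function vanishing near `(-∞, 0]` turns functions that are nonpositive on the
boundary into test functions. -/
lemma isC1TestFun_indicator_comp (hB : IsOpen B) (hBb : Bornology.IsBounded B)
    (hv : ContinuousOn v (closure B)) (hfr : ∀ x ∈ frontier B, v x ≤ 0)
    (hd : ContDiffOn ℝ 1 v B) (hG : ContDiff ℝ 1 G) {ε : ℝ} (hε : 0 < ε)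
    (hG0 : ∀ s ≤ ε, G s = 0) : IsC1TestFun B (B.indicator fun x => G (v x)) := by
  set K := closure B ∩ v ⁻¹' Ici ε with hK
  have hKc : IsCompact K :=
    hBb.isCompact_closure.of_isClosed_subset (hv.preimage_isClosed_of_isClosed isClosed_closure
      isClosed_Ici) inter_subset_left
  have hKB : K ⊆ B := by
    rintro x ⟨hx, hεx⟩
    by_contra hxB
    have := hfr x (by rw [frontier, hB.interior_eq]; exact ⟨hx, hxB⟩)
    have h' : ε ≤ v x := hεx
    linarith
  have hzero : ∀ x ∉ K, B.indicator (fun x => G (v x)) x = 0 := by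
    intro x hx
    by_cases hxB : x ∈ B
    · rw [indicator_of_mem hxB]
      refine hG0 _ (le_of_not_ge fun h => hx ⟨subset_closure hxB, h⟩)
    · exact indicator_of_notMem hxB _
  have hts : tsupport (B.indicator fun x => G (v x)) ⊆ K :=
    closure_minimal (fun x hx => by_contra fun h => hx (hzero x h)) hKc.isClosed
  refine ⟨contDiff_iff_contDiffAt.2 fun x => ?_, HasCompactSupport.intro hKc hzero, hts.trans hKB⟩
  by_cases hx : x ∈ tsupport (B.indicator fun x => G (v x))
  swap
  · exact contDiffAt_const.congr_of_eventuallyEq (notMem_tsupport_iff_eventuallyEq.1 hx)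
  have hxB := hKB (hts hx)
  have h1 : ContDiffAt ℝ 1 (fun x => G (v x)) x :=
    hG.contDiffAt.comp x (hd.contDiffAt (hB.mem_nhds hxB))
  refine h1.congr_of_eventuallyEq ?_
  filter_upwards [hB.mem_nhds hxB] with y hy using indicator_of_mem hy _

lemma gradient_indicator_comp (hB : IsOpen B) (hd : ContDiffOn ℝ 1 v B) (hG : ContDiff ℝ 1 G)
    {x : EuclideanSpace ℝ (Fin N)} (hx : x ∈ B) :
    gradient (B.indicator fun x => G (v x)) x = deriv G (v x) • gradient v x := by
  have h1 := ((hd.contDiffAt (hB.mem_nhds hx)).differentiableAt one_ne_zero).hasGradientAt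
  have h2 := h1.comp_real (hG.differentiable one_ne_zero (v x)).hasDerivAt
  rw [← h2.gradient]
  have h3 : (B.indicator fun x => G (v x)) =ᶠ[𝓝 x] fun x => G (v x) := by
    filter_upwards [hB.mem_nhds hx] with y hy using indicator_of_mem hy _
  rw [gradient_eq_toDual_symm, gradient_eq_toDual_symm]
  simp only [h3.fderiv_eq]

/-- A smooth step from `0` to `1` on `[ε, 2 ε]`. -/
def smoothStep (ε s : ℝ) : ℝ := Real.smoothTransition (s / ε - 1)

lemma contDiff_smoothStep (ε : ℝ) : ContDiff ℝ 1 (smoothStep ε) :=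
  (Real.smoothTransition.contDiff).comp (by fun_prop)

lemma smoothStep_nonneg (ε s : ℝ) : 0 ≤ smoothStep ε s := Real.smoothTransition.nonneg _

lemma smoothStep_le_one (ε s : ℝ) : smoothStep ε s ≤ 1 := Real.smoothTransition.le_one _

lemma smoothStep_eq_zero {ε s : ℝ} (hε : 0 < ε) (hs : s ≤ ε) : smoothStep ε s = 0 :=
  Real.smoothTransition.zero_of_nonpos (by linarith [(div_le_one hε).2 hs])

lemma smoothStep_eq_one {ε s : ℝ} (hε : 0 < ε) (hs : 2 * ε ≤ s) : smoothStep ε s = 1 :=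
  Real.smoothTransition.one_of_one_le (by linarith [(le_div_iff₀ hε).2 hs])

lemma smoothStep_pos {ε s : ℝ} (hε : 0 < ε) (hs : ε < s) : 0 < smoothStep ε s :=
  Real.smoothTransition.pos_of_pos (by linarith [(one_lt_div hε).2 hs])

lemma monotone_smoothStep {ε : ℝ} (hε : 0 < ε) : Monotone (smoothStep ε) := fun s t h =>
  Real.smoothTransition.monotone (by gcongr)

lemma deriv_smoothStep_nonneg {ε : ℝ} (hε : 0 < ε) (s : ℝ) : 0 ≤ deriv (smoothStep ε) s :=
  (monotone_smoothStep hε).deriv_nonneg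

/-- A smooth convex approximation of the positive part. -/
def smoothPosPart (s : ℝ) : ℝ := ∫ t in (0 : ℝ)..s, smoothStep 1 t

lemma hasDerivAt_smoothPosPart (s : ℝ) : HasDerivAt smoothPosPart (smoothStep 1 s) s :=
  (contDiff_smoothStep 1).continuous.integral_hasStrictDerivAt 0 s |>.hasDerivAt

lemma deriv_smoothPosPart : deriv smoothPosPart = smoothStep 1 :=
  funext fun s => (hasDerivAt_smoothPosPart s).deriv

lemma contDiff_smoothPosPart : ContDiff ℝ 1 smoothPosPart :=
  contDiff_one_iff_deriv.2 ⟨fun s => (hasDerivAt_smoothPosPart s).differentiableAt,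
    by rw [deriv_smoothPosPart]; exact (contDiff_smoothStep 1).continuous⟩

lemma smoothPosPart_eq_zero {s : ℝ} (hs : s ≤ 1) : smoothPosPart s = 0 := by
  refine intervalIntegral.integral_zero_ae (Eventually.of_forall fun t ht => ?_)
  refine smoothStep_eq_zero one_pos (ht.2.trans (max_le zero_le_one hs))

lemma smoothPosPart_nonneg {s : ℝ} (hs : 0 ≤ s) : 0 ≤ smoothPosPart s :=
  intervalIntegral.integral_nonneg hs fun t _ => smoothStep_nonneg 1 t

lemma smoothPosPart_le {s : ℝ} (hs : 0 ≤ s) : smoothPosPart s ≤ s := by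
  have h := intervalIntegral.integral_mono_on (μ := volume) hs
    ((contDiff_smoothStep 1).continuous.intervalIntegrable 0 s)
    (continuous_const.intervalIntegrable 0 s) fun t _ => smoothStep_le_one 1 t
  simpa [smoothPosPart] using h

lemma le_smoothPosPart_add_two {s : ℝ} (hs : 0 ≤ s) : s ≤ smoothPosPart s + 2 := by
  rcases le_total s 2 with h | h
  · linarith [smoothPosPart_nonneg hs]
  · have hc := (contDiff_smoothStep 1).continuous
    have h1 : smoothPosPart s = smoothPosPart 2 + ∫ t in (2 : ℝ)..s, smoothStep 1 t :=
      (intervalIntegral.integral_add_adjacent_intervals (hc.intervalIntegrable _ _)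
        (hc.intervalIntegrable _ _)).symm
    have h2 : ∫ t in (2 : ℝ)..s, smoothStep 1 t = ∫ t in (2 : ℝ)..s, (1 : ℝ) := by
      refine intervalIntegral.integral_congr fun t ht => ?_
      rw [uIcc_of_le h] at ht
      exact smoothStep_eq_one one_pos (by linarith [ht.1])
    rw [intervalIntegral.integral_const, smul_eq_mul] at h2
    linarith [smoothPosPart_nonneg (zero_le_two (α := ℝ))]

end Cutoff

section Comparison

variable {N : ℕ} {B : Set (EuclideanSpace ℝ (Fin N))} {p : ℝ}

/-- The flux `‖v‖^(p-2) v` of the `p`-Laplacian. -/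
def pFlux (p : ℝ) (v : EuclideanSpace ℝ (Fin N)) : EuclideanSpace ℝ (Fin N) := ‖v‖ ^ (p - 2) • v

lemma pFlux_neg (v : EuclideanSpace ℝ (Fin N)) : pFlux p (-v) = -pFlux p v := by
  simp [pFlux]

lemma pFlux_two (v : EuclideanSpace ℝ (Fin N)) : pFlux 2 v = v := by
  simp [pFlux]

lemma continuous_pFlux (hp : 1 < p) : Continuous (pFlux (N := N) p) := by
  have h := (contDiff_norm_rpow (E := EuclideanSpace ℝ (Fin N)) hp).continuous_gradient
  have h2 : pFlux (N := N) p = fun x => p⁻¹ • gradient (fun y => ‖y‖ ^ p) x := by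
    funext x
    have h3 : HasGradientAt (fun y : EuclideanSpace ℝ (Fin N) => ‖y‖ ^ p)
        ((p * ‖x‖ ^ (p - 2)) • x) x := by
      rw [hasGradientAt_iff_hasFDerivAt, map_smul]
      exact hasFDerivAt_norm_rpow x hp
    rw [h3.gradient, pFlux, smul_smul, inv_mul_cancel_left₀ (by positivity)]
  rw [h2]
  exact h.const_smul p⁻¹

lemma rpow_sub_two_mul_self (hp : 1 < p) {s : ℝ} (hs : 0 ≤ s) : s ^ (p - 2) * s = s ^ (p - 1) := by
  rcases hs.eq_or_lt with rfl | hs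
  · rw [mul_zero, Real.zero_rpow (by linarith)]
  · rw [← Real.rpow_add_one hs.ne']; ring_nf

lemma inner_pFlux_sub_nonneg (hp : 1 < p) (x y : EuclideanSpace ℝ (Fin N)) :
    0 ≤ ⟪pFlux p x - pFlux p y, x - y⟫ := by
  have h1 := real_inner_le_norm x y
  have hx := Real.rpow_nonneg (norm_nonneg x) (p - 2)
  have hy := Real.rpow_nonneg (norm_nonneg y) (p - 2)
  have h2 : 0 ≤ (‖x‖ ^ (p - 1) - ‖y‖ ^ (p - 1)) * (‖x‖ - ‖y‖) := by
    rcases le_total ‖x‖ ‖y‖ with h | h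
    · have := Real.rpow_le_rpow (norm_nonneg _) h (by linarith : 0 ≤ p - 1)
      exact mul_nonneg_of_nonpos_of_nonpos (by linarith) (by linarith)
    · have := Real.rpow_le_rpow (norm_nonneg _) h (by linarith : 0 ≤ p - 1)
      exact mul_nonneg (by linarith) (by linarith)
  rw [← rpow_sub_two_mul_self hp (norm_nonneg x), ← rpow_sub_two_mul_self hp (norm_nonneg y)] at h2
  have h3 : ⟪pFlux p x - pFlux p y, x - y⟫ =
      ‖x‖ ^ (p - 2) * ‖x‖ ^ 2 + ‖y‖ ^ (p - 2) * ‖y‖ ^ 2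
        - (‖x‖ ^ (p - 2) + ‖y‖ ^ (p - 2)) * ⟪x, y⟫ := by
    simp only [pFlux, inner_sub_left, inner_sub_right, real_inner_smul_left,
      real_inner_self_eq_norm_sq, real_inner_comm y x]
    ring
  rw [h3]
  nlinarith [mul_le_mul_of_nonneg_left h1 (add_nonneg hx hy)]

lemma hasGradientAt_norm_sub_rpow (x₀ x : EuclideanSpace ℝ (Fin N)) {β : ℝ} (hβ : 1 < β) :
    HasGradientAt (fun y => ‖y - x₀‖ ^ β) ((β * ‖x - x₀‖ ^ (β - 2)) • (x - x₀)) x := by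
  rw [hasGradientAt_iff_hasFDerivAt, map_smul]
  exact (hasFDerivAt_norm_rpow (x - x₀) hβ).comp x ((hasFDerivAt_id x).sub_const x₀)

lemma pFlux_radial (hp : 1 < p) (z : EuclideanSpace ℝ (Fin N)) {c β : ℝ} (hc : 0 < c)
    (hβ : 1 < β) :
    pFlux p ((c * (β * ‖z‖ ^ (β - 2))) • z) =
      (c * β) ^ (p - 1) • (‖z‖ ^ ((β - 1) * (p - 1) - 1) • z) := by
  rcases eq_or_ne z 0 with rfl | hz
  · simp [pFlux]
  have hz' : 0 < ‖z‖ := norm_pos_iff.2 hz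
  have hcβ : 0 < c * β := by positivity
  rw [pFlux, norm_smul, smul_smul, smul_smul]
  congr 1
  rw [Real.norm_of_nonneg (by positivity),
    show c * (β * ‖z‖ ^ (β - 2)) * ‖z‖ = (c * β) * ‖z‖ ^ (β - 1) by
      rw [← rpow_sub_two_mul_self hβ hz'.le]; ring,
    Real.mul_rpow hcβ.le (by positivity), ← Real.rpow_mul hz'.le,
    show c * (β * ‖z‖ ^ (β - 2)) = (c * β) * ‖z‖ ^ (β - 2) by ring,
    ← rpow_sub_two_mul_self hp hcβ.le,
    show (β - 1) * (p - 1) - 1 = (β - 1) * (p - 2) + (β - 2) by ring, Real.rpow_add hz']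
  ring

lemma integrable_of_continuousOn {f : EuclideanSpace ℝ (Fin N) → ℝ}
    {K : Set (EuclideanSpace ℝ (Fin N))} (hK : IsCompact K) (hf : ContinuousOn f K)
    (h0 : ∀ x ∉ K, f x = 0) : Integrable f :=
  (integrableOn_iff_integrable_of_support_subset fun x hx => by_contra fun h => hx (h0 x h)).1
    (hf.integrableOn_compact hK)

lemma IsC1TestFun.integrable_mul {φ g : EuclideanSpace ℝ (Fin N) → ℝ} (hφ : IsC1TestFun B φ)
    (hg : ContinuousOn g B) : Integrable fun x => g x * φ x :=
  integrable_of_continuousOn hφ.2.isCompact ((hg.mono hφ.3).mul hφ.continuous.continuousOn)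
    fun x hx => by simp [image_eq_zero_of_notMem_tsupport hx]

lemma IsC1TestFun.integrable_inner {φ : EuclideanSpace ℝ (Fin N) → ℝ}
    {F : EuclideanSpace ℝ (Fin N) → EuclideanSpace ℝ (Fin N)} (hφ : IsC1TestFun B φ)
    (hF : ContinuousOn F B) : Integrable fun x => ⟪F x, gradient φ x⟫ :=
  integrable_of_continuousOn hφ.2.isCompact
    ((hF.mono hφ.3).inner hφ.continuous_gradient.continuousOn)
    fun x hx => by simp [gradient_of_notMem_tsupport hx]

lemma IsC1TestFun.setIntegral_mul {φ : EuclideanSpace ℝ (Fin N) → ℝ} (hφ : IsC1TestFun B φ)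
    (g : EuclideanSpace ℝ (Fin N) → ℝ) : ∫ x in B, g x * φ x = ∫ x, g x * φ x :=
  setIntegral_eq_integral_of_forall_compl_eq_zero fun x hx => by simp [hφ.eq_zero hx]

lemma IsC1TestFun.setIntegral_inner {φ : EuclideanSpace ℝ (Fin N) → ℝ} (hφ : IsC1TestFun B φ)
    (F : EuclideanSpace ℝ (Fin N) → EuclideanSpace ℝ (Fin N)) :
    ∫ x in B, ⟪F x, gradient φ x⟫ = ∫ x, ⟪F x, gradient φ x⟫ :=
  setIntegral_eq_integral_of_forall_compl_eq_zero fun x hx => by simp [hφ.gradient_eq_zero hx]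

/-- `u` is a `C¹` weak solution of `-Δ_p u = g` in `B`, continuous up to the boundary. -/
structure IsPSolution (B : Set (EuclideanSpace ℝ (Fin N))) (p : ℝ)
    (u g : EuclideanSpace ℝ (Fin N) → ℝ) : Prop where
  continuousOn : ContinuousOn u (closure B)
  contDiffOn : ContDiffOn ℝ 1 u B
  continuousOn_rhs : ContinuousOn g B
  weak : ∀ φ, IsC1TestFun B φ → ∫ x, ⟪pFlux p (gradient u x), gradient φ x⟫ = ∫ x, g x * φ x

lemma IsPSolution.mono {D : Set (EuclideanSpace ℝ (Fin N))}
    {u g : EuclideanSpace ℝ (Fin N) → ℝ} (h : IsPSolution D p u g) (hBD : B ⊆ D) :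
    IsPSolution B p u g :=
  ⟨h.1.mono (closure_mono hBD), h.2.mono hBD, h.3.mono hBD, fun φ hφ => h.4 φ (hφ.mono hBD)⟩

/-- Weak comparison principle. -/
lemma IsPSolution.comparison (hp : 1 < p) (hB : IsOpen B) (hBb : Bornology.IsBounded B)
    {u w g k : EuclideanSpace ℝ (Fin N) → ℝ} (hu : IsPSolution B p u g)
    (hw : IsPSolution B p w k) (hfr : ∀ x ∈ frontier B, u x ≤ w x)
    (hlt : ∀ x ∈ B, w x < u x → g x < k x) : ∀ x ∈ B, u x ≤ w x := by
  by_contra! ⟨x₁, hx₁, hux₁⟩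
  set ε := (u x₁ - w x₁) / 2 with hε
  have hε0 : 0 < ε := by rw [hε]; linarith
  have hd := hu.contDiffOn.sub hw.contDiffOn
  set φ := B.indicator fun x => smoothStep ε (u x - w x) with hφdef
  have hφ : IsC1TestFun B φ := isC1TestFun_indicator_comp hB hBb
    (hu.continuousOn.sub hw.continuousOn) (fun x hx => sub_nonpos.2 (hfr x hx)) hd
    (contDiff_smoothStep ε) hε0 (fun s hs => smoothStep_eq_zero hε0 hs)
  have hφB : ∀ x ∈ B, φ x = smoothStep ε (u x - w x) := fun x hx => indicator_of_mem hx _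
  have hFu : ContinuousOn (fun x => pFlux p (gradient u x)) B :=
    (continuous_pFlux hp).comp_continuousOn (hu.contDiffOn.continuousOn_gradient hB)
  have hFw : ContinuousOn (fun x => pFlux p (gradient w x)) B :=
    (continuous_pFlux hp).comp_continuousOn (hw.contDiffOn.continuousOn_gradient hB)
  have h1 : 0 ≤ ∫ x, ⟪pFlux p (gradient u x) - pFlux p (gradient w x), gradient φ x⟫ := by
    refine integral_nonneg fun x => ?_
    by_cases hx : x ∈ B
    · have e1 := gradient_indicator_comp hB hd (contDiff_smoothStep ε) hx
      have e2 : gradient (fun y => u y - w y) x = gradient u x - gradient w x := by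
        have du := (hu.contDiffOn.contDiffAt (hB.mem_nhds hx)).differentiableAt one_ne_zero
        have dw := (hw.contDiffOn.contDiffAt (hB.mem_nhds hx)).differentiableAt one_ne_zero
        simp only [gradient_eq_toDual_symm, fderiv_fun_sub du dw, map_sub]
      simp only [Pi.zero_apply]
      rw [hφdef, e1, e2, real_inner_smul_right]
      exact mul_nonneg (deriv_smoothStep_nonneg hε0 _) (inner_pFlux_sub_nonneg hp _ _)
    · simp [hφ.gradient_eq_zero hx]
  have h2 : ∫ x, ⟪pFlux p (gradient u x) - pFlux p (gradient w x), gradient φ x⟫ =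
      -∫ x in B, (k x - g x) * φ x := by
    rw [hφ.setIntegral_mul (fun x => k x - g x)]
    simp only [inner_sub_left, sub_mul]
    rw [integral_sub (hφ.integrable_inner hFu) (hφ.integrable_inner hFw), hu.weak φ hφ,
      hw.weak φ hφ, integral_sub (hφ.integrable_mul hw.3) (hφ.integrable_mul hu.3)]
    ring
  have h3 : ∀ x ∈ B, 0 ≤ (k x - g x) * φ x := by
    intro x hx
    rcases le_or_gt (u x) (w x) with h | h
    · rw [hφB x hx, smoothStep_eq_zero hε0 (by linarith), mul_zero]
    · rw [hφB x hx]
      exact mul_nonneg (by linarith [hlt x hx h]) (smoothStep_nonneg _ _)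
  have h4 : 0 < ∫ x in B, (k x - g x) * φ x := by
    rw [setIntegral_pos_iff_support_of_nonneg_ae
      ((ae_restrict_iff' hB.measurableSet).2 (Eventually.of_forall h3))
      (hφ.integrable_mul (hw.3.sub hu.3)).integrableOn]
    have hV : IsOpen (B ∩ (fun y => u y - w y) ⁻¹' Ioi ε) :=
      hd.continuousOn.isOpen_inter_preimage hB isOpen_Ioi
    refine (hV.measure_pos volume ⟨x₁, hx₁, ?_⟩).trans_le (measure_mono ?_)
    · simp only [mem_preimage, mem_Ioi]
      linarith
    · rintro x ⟨hx, hxε⟩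
      have hxε' : ε < u x - w x := hxε
      refine ⟨?_, hx⟩
      simp only [Function.mem_support, hφB x hx]
      exact (mul_pos (by linarith [hlt x hx (by linarith)]) (smoothStep_pos hε0 hxε')).ne'
  linarith

end Comparison

section Barriers

variable {N : ℕ} {B : Set (EuclideanSpace ℝ (Fin N))} {p q : ℝ}

lemma IsPSolution.const_sub {u g : EuclideanSpace ℝ (Fin N) → ℝ}
    (h : IsPSolution B p u g) (d : ℝ) : IsPSolution B p (fun x => d - u x) fun x => -g x := by
  refine ⟨continuousOn_const.sub h.1, contDiffOn_const.sub h.2, h.3.neg, fun φ hφ => ?_⟩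
  have h1 : ∀ x, gradient (fun x => d - u x) x = -gradient u x := fun x => by
    simp only [gradient_eq_toDual_symm, fderiv_const_sub, map_neg]
  simp only [h1, pFlux_neg, inner_neg_left, integral_neg, h.4 φ hφ, neg_mul]

lemma isPSolution_radial (hp : 1 < p) (x₀ : EuclideanSpace ℝ (Fin N)) {c β : ℝ} (hc : 0 < c)
    (hβ : 1 < β) (hγ : 0 ≤ (β - 1) * (p - 1) - 1) :
    IsPSolution B p (fun x => c * ‖x - x₀‖ ^ β) fun x =>
      -((c * β) ^ (p - 1) * (N + ((β - 1) * (p - 1) - 1)) *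
        ‖x - x₀‖ ^ ((β - 1) * (p - 1) - 1)) := by
  have hd : ContDiff ℝ 1 fun x => c * ‖x - x₀‖ ^ β :=
    contDiff_const.mul ((contDiff_norm_rpow hβ).comp (contDiff_id.sub contDiff_const))
  have hgrad : ∀ x, gradient (fun x => c * ‖x - x₀‖ ^ β) x =
      (c * (β * ‖x - x₀‖ ^ (β - 2))) • (x - x₀) := by
    intro x
    have := (hasGradientAt_norm_sub_rpow x₀ x hβ).comp_real (G := fun t => c * t)
      ((hasDerivAt_id _).const_mul c)
    rw [this.gradient, smul_smul, mul_one]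
  refine ⟨hd.continuous.continuousOn, hd.contDiffOn, ?_, fun φ hφ => ?_⟩
  · have : Continuous fun x => ‖x - x₀‖ ^ ((β - 1) * (p - 1) - 1) :=
      (continuous_id.sub continuous_const).norm.rpow_const fun _ => Or.inr hγ
    exact (continuous_const.mul this).neg.continuousOn
  · simp only [hgrad, pFlux_radial hp _ hc hβ, real_inner_smul_left (x := _ • _)]
    rw [integral_const_mul, integral_radial_field hφ x₀ hγ, ← integral_const_mul,
      ← integral_neg, ← integral_const_mul]
    congr 1
    ext x
    ring

/-- A subsolution with strong absorption on a ball vanishes at the centre. -/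
lemma exists_deadCore_threshold (N : ℕ) (h1q : 1 < q) (hqp : q < p) {M r : ℝ} (hM : 0 < M)
    (hr : 0 < r) :
    ∃ κ₀ : ℝ, ∀ (y : EuclideanSpace ℝ (Fin N)) (u g : EuclideanSpace ℝ (Fin N) → ℝ) (κ : ℝ),
      κ₀ ≤ κ → IsPSolution (Metric.ball y r) p u g →
      (∀ x ∈ Metric.closedBall y r, 0 ≤ u x ∧ u x ≤ M) →
      (∀ x ∈ Metric.ball y r, g x ≤ -(κ * u x ^ (q - 1))) → u y = 0 := by
  have hp : 1 < p := h1q.trans hqp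
  set β := p / (p - q) with hβdef
  have hpq : 0 < p - q := by linarith
  have hβ : 1 < β := by rw [hβdef, lt_div_iff₀ hpq]; linarith
  have hγ : (β - 1) * (p - 1) - 1 = β * (q - 1) := by rw [hβdef]; field_simp; ring
  have hγ0 : 0 ≤ β * (q - 1) := mul_nonneg (by linarith) (by linarith)
  set c := M / r ^ β with hc
  have hc0 : 0 < c := by positivity
  set L := (c * β) ^ (p - 1) * (N + β * (q - 1)) with hL
  have hL0 : 0 ≤ L := by positivity
  have hcq : 0 < c ^ (q - 1) := by positivity
  refine ⟨L / c ^ (q - 1) + 1, fun y u g κ hκ hu hbd hg => ?_⟩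
  have hw := isPSolution_radial (B := Metric.ball y r) hp y hc0 hβ (hγ ▸ hγ0)
  rw [hγ] at hw
  have hκ0 : 0 < κ := (by positivity : 0 < L / c ^ (q - 1) + 1).trans_le hκ
  have h := hu.comparison hp Metric.isOpen_ball Metric.isBounded_ball hw ?_ ?_ y
    (Metric.mem_ball_self hr)
  · rw [sub_self, norm_zero, Real.zero_rpow (by positivity), mul_zero] at h
    exact le_antisymm h (hbd y (Metric.mem_closedBall_self hr.le)).1
  · intro x hx
    have hx' : ‖x - y‖ = r := by
      rw [← dist_eq_norm]
      exact Metric.frontier_ball_subset_sphere hx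
    rw [hx', hc, div_mul_cancel₀ _ (by positivity)]
    exact (hbd x (by rw [Metric.mem_closedBall, dist_eq_norm, hx'])).2
  · intro x hx hlt
    refine (hg x hx).trans_lt (neg_lt_neg ?_)
    have h1 : (c * ‖x - y‖ ^ β) ^ (q - 1) < u x ^ (q - 1) :=
      Real.rpow_lt_rpow (by positivity) hlt (by linarith)
    calc L * ‖x - y‖ ^ (β * (q - 1))
        = L / c ^ (q - 1) * (c * ‖x - y‖ ^ β) ^ (q - 1) := by
          rw [Real.mul_rpow hc0.le (by positivity), ← Real.rpow_mul (norm_nonneg _)]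
          field_simp
      _ ≤ κ * (c * ‖x - y‖ ^ β) ^ (q - 1) := by
          gcongr
          linarith
      _ < κ * u x ^ (q - 1) := by gcongr

/-- A priori bound for subsolutions with sublinear growth. -/
lemma exists_bound_of_sublinear (hN : 1 ≤ N) (h1q : 1 < q) (hqp : q < p) (hB : IsOpen B)
    (hBb : Bornology.IsBounded B) {A : ℝ} (hA : 0 ≤ A) :
    ∃ M : ℝ, ∀ u g : EuclideanSpace ℝ (Fin N) → ℝ, IsPSolution B p u g →
      (∀ x ∈ B, 0 ≤ u x) → (∀ x ∈ frontier B, u x = 0) →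
      (∀ x ∈ B, g x ≤ A * u x ^ (q - 1)) → ∀ x ∈ closure B, u x ≤ M := by
  have hp : 1 < p := h1q.trans hqp
  obtain ⟨R, hR0, hR⟩ := hBb.closure.exists_pos_norm_le
  set β := p / (p - 1) with hβdef
  have hp1 : 0 < p - 1 := by linarith
  have hβ : 1 < β := by rw [hβdef, lt_div_iff₀ hp1]; linarith
  have hγ : (β - 1) * (p - 1) - 1 = 0 := by rw [hβdef]; field_simp; ring
  have hN0 : (0 : ℝ) < N := by exact_mod_cast hN
  set s := β / (2 * R ^ β) with hs
  have hs0 : 0 < s := by positivity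
  set T := A / (s ^ (p - 1) * N) with hT
  have hT0 : 0 ≤ T := by positivity
  refine ⟨T ^ (p - q)⁻¹, fun u g hu h0 hfr hg x hx => ?_⟩
  obtain ⟨z, hz, hmax⟩ := hBb.isCompact_closure.exists_isMaxOn ⟨x, hx⟩ hu.1
  refine (hmax hx).trans (le_of_not_gt fun hlt => ?_)
  have hz0 : 0 < u z := (by positivity : 0 ≤ T ^ (p - q)⁻¹).trans_lt hlt
  have hzT : T < u z ^ (p - q) := by
    have := Real.rpow_lt_rpow (by positivity) hlt (by linarith : 0 < p - q)
    rwa [← Real.rpow_mul hT0, inv_mul_cancel₀ (by linarith), Real.rpow_one] at this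
  set c := u z / (2 * R ^ β) with hc
  have hc0 : 0 < c := by positivity
  have hw := (isPSolution_radial (B := B) hp 0 hc0 hβ hγ.ge).const_sub (c * R ^ β)
  rw [hγ] at hw
  have hle : ∀ y ∈ closure B, c * ‖y - 0‖ ^ β ≤ c * R ^ β := fun y hy => by
    rw [sub_zero]
    have := hR y hy
    gcongr
  have hzB : z ∈ B := by
    by_contra hzB
    exact hz0.ne' (hfr z (by rw [frontier, hB.interior_eq]; exact ⟨hz, hzB⟩))
  have h := hu.comparison hp hB hBb hw ?_ ?_ z hzB
  · have h1 : c * R ^ β = u z / 2 := by rw [hc]; field_simp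
    have h2 : 0 ≤ c * ‖z - 0‖ ^ β := by positivity
    linarith
  · intro y hy
    rw [hfr y hy]
    linarith [hle y (frontier_subset_closure hy)]
  · intro y hy _
    have h1 : u y ^ (q - 1) ≤ u z ^ (q - 1) :=
      Real.rpow_le_rpow (h0 y hy) (hmax (subset_closure hy)) (by linarith)
    have h2 : c * β = u z * s := by rw [hc, hs]; ring
    simp only [Real.rpow_zero, mul_one, neg_neg, add_zero]
    rw [h2, Real.mul_rpow hz0.le hs0.le]
    calc g y ≤ A * u y ^ (q - 1) := hg y hy
      _ ≤ A * u z ^ (q - 1) := by gcongr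
      _ = T * u z ^ (q - 1) * (s ^ (p - 1) * N) := by rw [hT]; field_simp
      _ < u z ^ (p - q) * u z ^ (q - 1) * (s ^ (p - 1) * N) := by gcongr
      _ = _ := by
        rw [← Real.rpow_add hz0, show p - q + (q - 1) = p - 1 by ring]
        ring

end Barriers

section Truncation

variable {N : ℕ} {D : Set (EuclideanSpace ℝ (Fin N))}

lemma IsC1TestFun.add_const_mul {φ ψ : EuclideanSpace ℝ (Fin N) → ℝ} (hφ : IsC1TestFun D φ)
    (hψ : IsC1TestFun D ψ) (t : ℝ) : IsC1TestFun D fun x => φ x + t * ψ x :=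
  ⟨hφ.1.add (contDiff_const.mul hψ.1), hφ.2.add hψ.2.mul_left, by
    refine (tsupport_add φ fun x => t * ψ x).trans (union_subset hφ.3 ?_)
    exact (tsupport_mul_subset_right (f := fun _ => t) (g := ψ)).trans hψ.3⟩

lemma IsC1TestFun.gradient_add_const_mul {φ ψ : EuclideanSpace ℝ (Fin N) → ℝ}
    (hφ : IsC1TestFun D φ) (hψ : IsC1TestFun D ψ) (t : ℝ) (x : EuclideanSpace ℝ (Fin N)) :
    gradient (fun x => φ x + t * ψ x) x = gradient φ x + t • gradient ψ x := by
  have h := (hφ.differentiable x).hasFDerivAt.add ((hψ.differentiable x).hasFDerivAt.const_mul t)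
  simp only [gradient_eq_toDual_symm, ← map_smul, ← map_add]
  exact congrArg _ h.fderiv

lemma integral_add_const_mul_add_const_mul {f g h : EuclideanSpace ℝ (Fin N) → ℝ}
    (hf : Integrable f) (hg : Integrable g) (hh : Integrable h) (s t : ℝ) :
    ∫ x, (f x + s * g x + t * h x) = (∫ x, f x) + s * (∫ x, g x) + t * ∫ x, h x := by
  have hfg : Integrable fun x => f x + s * g x := hf.add (hg.const_mul s)
  rw [integral_add hfg (hh.const_mul t), integral_add hf (hg.const_mul s), integral_const_mul,
    integral_const_mul]

/-- Small excess in the Poincaré inequality forces almost superharmonicity. -/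
lemma almostSuperharmonic_of_poincare {lam E : ℝ} (hlam : 0 ≤ lam)
    (hP : ∀ φ, IsC1TestFun D φ → lam * ∫ x, φ x ^ 2 ≤ ∫ x, ‖gradient φ x‖ ^ 2)
    {φ : EuclideanSpace ℝ (Fin N) → ℝ} (hφ : IsC1TestFun D φ) (h0 : ∀ x, 0 ≤ φ x)
    (hE : (∫ x, ‖gradient φ x‖ ^ 2) - lam * ∫ x, φ x ^ 2 ≤ E) :
    AlmostSuperharmonic D φ √E := by
  refine ⟨hφ, h0, Real.sqrt_nonneg _, fun ψ hψ hψ0 => ?_⟩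
  have hE0 : 0 ≤ E := by linarith [hP φ hφ]
  have i1 : ∀ {f g : EuclideanSpace ℝ (Fin N) → ℝ}, IsC1TestFun D f → IsC1TestFun D g →
      Integrable fun x => f x * g x := fun hf hg => hg.integrable_mul hf.continuous.continuousOn
  have i2 : ∀ {f g : EuclideanSpace ℝ (Fin N) → ℝ}, IsC1TestFun D f → IsC1TestFun D g →
      Integrable fun x => ⟪gradient f x, gradient g x⟫ :=
    fun hf hg => hg.integrable_inner hf.continuous_gradient.continuousOn
  simp only [← real_inner_self_eq_norm_sq] at hP hE ⊢
  simp only [pow_two] at hP hE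
  set a := (∫ x, ⟪gradient ψ x, gradient ψ x⟫) - lam * ∫ x, ψ x * ψ x with ha
  set b := (∫ x, ⟪gradient φ x, gradient ψ x⟫) - lam * ∫ x, φ x * ψ x with hb
  set c := (∫ x, ⟪gradient φ x, gradient φ x⟫) - lam * ∫ x, φ x * φ x with hc
  have hquad : ∀ t : ℝ, 0 ≤ a * (t * t) + 2 * b * t + c := by
    intro t
    have h := hP _ (hφ.add_const_mul hψ t)
    have e1 : ∫ x, (φ x + t * ψ x) * (φ x + t * ψ x) =
        (∫ x, φ x * φ x) + 2 * t * (∫ x, φ x * ψ x) + t * t * ∫ x, ψ x * ψ x := by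
      rw [← integral_add_const_mul_add_const_mul (i1 hφ hφ) (i1 hφ hψ) (i1 hψ hψ)]
      congr 1
      ext x
      ring
    have e2 : ∫ x, ⟪gradient (fun x => φ x + t * ψ x) x, gradient (fun x => φ x + t * ψ x) x⟫ =
        (∫ x, ⟪gradient φ x, gradient φ x⟫) + 2 * t * (∫ x, ⟪gradient φ x, gradient ψ x⟫)
          + t * t * ∫ x, ⟪gradient ψ x, gradient ψ x⟫ := by
      rw [← integral_add_const_mul_add_const_mul (i2 hφ hφ) (i2 hφ hψ) (i2 hψ hψ)]
      congr 1
      ext x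
      simp only [hφ.gradient_add_const_mul hψ, inner_add_left, inner_add_right,
        real_inner_smul_left, real_inner_smul_right, real_inner_comm (gradient φ x)]
      ring
    rw [e1, e2] at h
    rw [ha, hb, hc]
    linarith
  have hdisc : b ^ 2 ≤ a * c := by
    have := discrim_le_zero hquad
    rw [discrim] at this
    linarith
  have hψψ : 0 ≤ ∫ x, ψ x * ψ x := integral_nonneg fun x => mul_self_nonneg _
  have hφψ : 0 ≤ ∫ x, φ x * ψ x := integral_nonneg fun x => mul_nonneg (h0 x) (hψ0 x)
  have hgrad : 0 ≤ ∫ x, ⟪gradient ψ x, gradient ψ x⟫ :=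
    integral_nonneg fun x => real_inner_self_nonneg
  have hc0 : 0 ≤ c := by linarith [hquad 0]
  have hb2 : b ^ 2 ≤ E * ∫ x, ⟪gradient ψ x, gradient ψ x⟫ := by
    refine hdisc.trans ?_
    rw [mul_comm]
    refine mul_le_mul hE ?_ (by linarith [hP ψ hψ]) hE0
    rw [ha]
    linarith [mul_nonneg hlam hψψ]
  have h1 : |b| ≤ √E * √(∫ x, ⟪gradient ψ x, gradient ψ x⟫) := by
    rw [← Real.sqrt_mul hE0]
    exact Real.abs_le_sqrt hb2
  linarith [neg_abs_le b, mul_nonneg hlam hφψ]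

variable {u g : EuclideanSpace ℝ (Fin N) → ℝ}

/-- The truncation of `u` on `D`, extended by zero. -/
def truncation (D : Set (EuclideanSpace ℝ (Fin N))) (u : EuclideanSpace ℝ (Fin N) → ℝ) :
    EuclideanSpace ℝ (Fin N) → ℝ := D.indicator fun x => smoothPosPart (u x)

lemma truncation_of_mem {x : EuclideanSpace ℝ (Fin N)} (hx : x ∈ D) :
    truncation D u x = smoothPosPart (u x) := indicator_of_mem hx _

lemma truncation_nonneg (h0 : ∀ x ∈ D, 0 ≤ u x) (x : EuclideanSpace ℝ (Fin N)) :
    0 ≤ truncation D u x :=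
  indicator_nonneg (fun x hx => smoothPosPart_nonneg (h0 x hx)) x

lemma truncation_le {x : EuclideanSpace ℝ (Fin N)} (hx : x ∈ D) (h0 : 0 ≤ u x) :
    truncation D u x ≤ u x := by
  rw [truncation_of_mem hx]
  exact smoothPosPart_le h0

lemma le_truncation_add_two {x : EuclideanSpace ℝ (Fin N)} (hx : x ∈ D) (h0 : 0 ≤ u x) :
    u x ≤ truncation D u x + 2 := by
  rw [truncation_of_mem hx]
  exact le_smoothPosPart_add_two h0

lemma gradient_truncation (hD : IsOpen D) (hu : ContDiffOn ℝ 1 u D)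
    {x : EuclideanSpace ℝ (Fin N)} (hx : x ∈ D) :
    gradient (truncation D u) x = smoothStep 1 (u x) • gradient u x := by
  rw [truncation, gradient_indicator_comp hD hu contDiff_smoothPosPart hx, deriv_smoothPosPart]

lemma IsPSolution.isC1TestFun_truncation (hD : IsOpen D) (hDb : Bornology.IsBounded D)
    (hu : IsPSolution D 2 u g) (hfr : ∀ x ∈ frontier D, u x ≤ 0) :
    IsC1TestFun D (truncation D u) :=
  isC1TestFun_indicator_comp hD hDb hu.1 hfr hu.2 contDiff_smoothPosPart one_pos
    fun _ hs => smoothPosPart_eq_zero hs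

/-- The truncation is a subsolution. -/
lemma IsPSolution.integral_inner_truncation_le (hD : IsOpen D) (hDb : Bornology.IsBounded D)
    (hu : IsPSolution D 2 u g) (h0 : ∀ x ∈ D, 0 ≤ u x) (hfr : ∀ x ∈ frontier D, u x ≤ 0) {c : ℝ}
    (hc : 0 ≤ c) (hg : ∀ x ∈ D, g x ≤ c * (truncation D u x + 3))
    {ψ : EuclideanSpace ℝ (Fin N) → ℝ} (hψ : IsC1TestFun univ ψ) (hψ0 : ∀ x, 0 ≤ ψ x) :
    ∫ x, ⟪gradient (truncation D u) x, gradient ψ x⟫ ≤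
      c * ∫ x, (truncation D u x + 3) * ψ x := by
  have hU := hu.isC1TestFun_truncation hD hDb hfr
  set V := D.indicator fun x => smoothStep 1 (u x) with hVdef
  have hV : IsC1TestFun D V := isC1TestFun_indicator_comp hD hDb hu.1 hfr hu.2
    (contDiff_smoothStep 1) one_pos fun _ hs => smoothStep_eq_zero one_pos hs
  have hVψ := hV.mul hψ
  have hgu := hu.2.continuousOn_gradient hD
  calc ∫ x, ⟪gradient (truncation D u) x, gradient ψ x⟫
      ≤ ∫ x, ⟪gradient u x, gradient (fun y => V y * ψ y) x⟫ := by
        refine integral_mono (hψ.integrable_inner hU.continuous_gradient.continuousOn)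
          (hVψ.integrable_inner hgu) fun x => ?_
        by_cases hx : x ∈ D
        · simp only
          rw [gradient_truncation hD hu.2 hx, gradient_mul_of_differentiableAt
            (hV.differentiable x) (hψ.differentiable x), hVdef,
            gradient_indicator_comp hD hu.2 (contDiff_smoothStep 1) hx, indicator_of_mem hx,
            inner_add_right, real_inner_smul_left, real_inner_smul_right, real_inner_smul_right,
            real_inner_smul_right, real_inner_self_eq_norm_sq]
          have := mul_nonneg (hψ0 x) (mul_nonneg (deriv_smoothStep_nonneg one_pos (u x))
            (sq_nonneg ‖gradient u x‖))
          linarith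
        · simp only
          rw [hU.gradient_eq_zero hx, hVψ.gradient_eq_zero hx]
          simp
    _ = ∫ x, g x * (V x * ψ x) := by simpa only [pFlux_two] using hu.weak _ hVψ
    _ ≤ ∫ x, c * ((truncation D u x + 3) * ψ x) := by
        refine integral_mono (hVψ.integrable_mul hu.3) ((hψ.integrable_mul
          (hU.continuous.add continuous_const).continuousOn).const_mul c) fun x => ?_
        have h3 := truncation_nonneg h0 x
        by_cases hx : x ∈ D
        · simp only [hVdef, indicator_of_mem hx]
          have h1 := smoothStep_nonneg 1 (u x)
          have h2 := smoothStep_le_one 1 (u x)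
          calc g x * (smoothStep 1 (u x) * ψ x)
              ≤ c * (truncation D u x + 3) * (smoothStep 1 (u x) * ψ x) :=
                mul_le_mul_of_nonneg_right (hg x hx) (mul_nonneg h1 (hψ0 x))
            _ ≤ c * (truncation D u x + 3) * (1 * ψ x) := by
                gcongr
                exact hψ0 x
            _ = _ := by ring
        · simp only [hVdef, indicator_of_notMem hx, zero_mul, mul_zero]
          have := hψ0 x
          positivity
    _ = _ := integral_const_mul _ _

/-- The energy inequality for the truncation. -/
lemma IsPSolution.integral_norm_gradient_truncation_le (hD : IsOpen D)
    (hDb : Bornology.IsBounded D) (hu : IsPSolution D 2 u g) (hfr : ∀ x ∈ frontier D, u x ≤ 0) :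
    ∫ x, ‖gradient (truncation D u) x‖ ^ 2 ≤ ∫ x, g x * truncation D u x := by
  have hU := hu.isC1TestFun_truncation hD hDb hfr
  have hw := hu.weak _ hU
  simp only [pFlux_two] at hw
  rw [← hw]
  simp only [← real_inner_self_eq_norm_sq]
  refine integral_mono (hU.integrable_inner hU.continuous_gradient.continuousOn)
    (hU.integrable_inner (hu.2.continuousOn_gradient hD)) fun x => ?_
  by_cases hx : x ∈ D
  · simp only
    rw [gradient_truncation hD hu.2 hx, real_inner_smul_left]
    rw [real_inner_smul_right, real_inner_self_eq_norm_sq]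
    exact mul_le_of_le_one_left (mul_nonneg (smoothStep_nonneg 1 _) (sq_nonneg _))
      (smoothStep_le_one 1 _)
  · simp only
    rw [hU.gradient_eq_zero hx]
    simp

end Truncation

section ConnectedBound

variable {N : ℕ} {D : Set (EuclideanSpace ℝ (Fin N))} {q : ℝ}

lemma le_add_rpow_mul_rpow (hq : 1 < q) {s τ : ℝ} (hs : 0 ≤ s) (hτ : 0 < τ) :
    s ≤ τ + τ ^ (1 - q) * s ^ q := by
  rcases le_total s τ with h | h
  · exact le_add_of_le_of_nonneg h (by positivity)
  · have hs' : 0 < s := hτ.trans_le h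
    have h1 : s ^ (1 - q) ≤ τ ^ (1 - q) := Real.rpow_le_rpow_of_nonpos hτ h (by linarith)
    calc s = s ^ (1 - q) * s ^ q := by rw [← Real.rpow_add hs']; simp
      _ ≤ τ ^ (1 - q) * s ^ q := by gcongr
      _ ≤ _ := le_add_of_nonneg_left hτ.le

lemma le_rpow_of_le_add_mul_rpow {θ c X : ℝ} (hθ0 : 0 ≤ θ) (hθ : θ < 1) (hX : 1 ≤ X)
    (h : X ≤ 2 + c * X ^ θ) : X ≤ (2 + c) ^ (1 - θ)⁻¹ := by
  have hX0 : 0 < X := by linarith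
  have h1 : 1 ≤ X ^ θ := Real.one_le_rpow hX hθ0
  have h2 : X ^ (1 - θ) ≤ 2 + c := by
    rw [Real.rpow_sub hX0, Real.rpow_one, div_le_iff₀ (by linarith)]
    linarith
  calc X = (X ^ (1 - θ)) ^ (1 - θ)⁻¹ := by
        rw [← Real.rpow_mul hX0.le, mul_inv_cancel₀ (by linarith), Real.rpow_one]
    _ ≤ _ := Real.rpow_le_rpow (by positivity) h2 (inv_nonneg.2 (by linarith))

lemma integrable_truncation_rpow {U : EuclideanSpace ℝ (Fin N) → ℝ} (hU : IsC1TestFun D U)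
    (hq : 0 < q) : Integrable fun x => U x ^ q :=
  integrable_of_continuousOn hU.2.isCompact
    (hU.continuous.rpow_const fun _ => Or.inr hq.le).continuousOn
    fun x hx => by rw [image_eq_zero_of_notMem_tsupport hx, Real.zero_rpow hq.ne']

lemma IsPSolution.energy_le (hD : IsOpen D) (hDb : Bornology.IsBounded D) (h1q : 1 < q)
    {lam A κ T : ℝ} (hlam : 0 ≤ lam) (hA : 0 ≤ A) (hκ : 0 ≤ κ)
    {u b : EuclideanSpace ℝ (Fin N) → ℝ}
    (hu : IsPSolution D 2 u fun x => lam * u x + b x * u x ^ (q - 1)) (h0 : ∀ x ∈ D, 0 ≤ u x)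
    (hfr : ∀ x ∈ frontier D, u x ≤ 0) (hbA : ∀ x ∈ D, b x ≤ A)
    {W : Set (EuclideanSpace ℝ (Fin N))} (hW : MeasurableSet W) (hbW : ∀ x ∈ W, b x ≤ -κ)
    (hT : ∀ x ∈ D, u x ≤ T) :
    (∫ x, ‖gradient (truncation D u) x‖ ^ 2) - lam * (∫ x, truncation D u x ^ 2) +
      κ * (∫ x in W, truncation D u x ^ q) ≤
      (2 * lam + A * T ^ (q - 1)) * ∫ x, truncation D u x := by
  have hU := hu.isC1TestFun_truncation hD hDb hfr
  set U := truncation D u with hUdef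
  have hUq := integrable_truncation_rpow hU (zero_lt_one.trans h1q)
  have i1 : Integrable fun x => U x * U x := hU.integrable_mul hU.continuous.continuousOn
  have h1 := hu.integral_norm_gradient_truncation_le hD hDb hfr
  have h2 : ∫ x, (lam * u x + b x * u x ^ (q - 1)) * U x ≤
      ∫ x, (lam * (U x * U x) + (2 * lam + A * T ^ (q - 1)) * U x
        - κ * W.indicator (fun x => U x ^ q) x) := by
    refine integral_mono (hU.integrable_mul hu.3) (((i1.const_mul _).add
      (hU.integrable.const_mul _)).sub ((hUq.indicator hW).const_mul _)) fun x => ?_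
    by_cases hx : x ∈ D
    · have hUx : 0 ≤ U x := truncation_nonneg h0 x
      have hux := h0 x hx
      have huU : U x ≤ u x := truncation_le hx hux
      have hu2 : u x ≤ U x + 2 := le_truncation_add_two hx hux
      have hp : 0 ≤ u x ^ (q - 1) := by positivity
      have e1 : lam * u x * U x ≤ lam * (U x + 2) * U x := by gcongr
      have e2 : b x * u x ^ (q - 1) * U x ≤
          A * T ^ (q - 1) * U x - κ * W.indicator (fun x => U x ^ q) x := by
        have e3 : A * u x ^ (q - 1) * U x ≤ A * T ^ (q - 1) * U x := by
          gcongr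
          exact hT x hx
        have e5 : 0 ≤ u x ^ (q - 1) * U x := by positivity
        by_cases hxW : x ∈ W
        · rw [indicator_of_mem hxW]
          have e4 : U x ^ q ≤ u x ^ (q - 1) * U x := by
            calc U x ^ q = U x ^ (q - 1) * U x := by
                  rw [← Real.rpow_add_one' hUx (by linarith)]
                  simp
              _ ≤ u x ^ (q - 1) * U x := by
                  gcongr
          have e6 := mul_le_mul_of_nonneg_right (hbW x hxW) e5
          have e7 := mul_le_mul_of_nonneg_left e4 hκ
          have e8 := mul_nonneg hA e5
          linarith
        · rw [indicator_of_notMem hxW]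
          have e6 := mul_le_mul_of_nonneg_right (hbA x hx) e5
          linarith
      simp only
      linarith
    · have hUx : U x = 0 := hU.eq_zero hx
      have : W.indicator (fun x => U x ^ q) x = 0 := by
        by_cases hxW : x ∈ W
        · rw [indicator_of_mem hxW, hUx, Real.zero_rpow (by linarith)]
        · exact indicator_of_notMem hxW _
      simp [hUx, this]
  have i2 : Integrable fun x => lam * (U x * U x) + (2 * lam + A * T ^ (q - 1)) * U x :=
    (i1.const_mul _).add (hU.integrable.const_mul _)
  rw [integral_sub i2 ((hUq.indicator hW).const_mul _), integral_add (i1.const_mul _)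
    (hU.integrable.const_mul _), integral_const_mul, integral_const_mul, integral_const_mul,
    integral_indicator hW] at h2
  simp only [pow_two] at h1 ⊢
  linarith

/-- A priori bound on a connected domain below the Poincaré constant, when the absorption is strong
on some ball. -/
lemma exists_bound_of_connected (hD : IsOpen D) (hDc : IsPreconnected D)
    (hDb : Bornology.IsBounded D) {x₀ : EuclideanSpace ℝ (Fin N)} {r : ℝ} (hr : 0 < r)
    (hx₀ : x₀ ∈ D) (h1q : 1 < q) (hq2 : q < 2) {lam A : ℝ}
    (hlam : 0 ≤ lam) (hA : 0 ≤ A)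
    (hP : ∀ φ, IsC1TestFun D φ → lam * ∫ x, φ x ^ 2 ≤ ∫ x, ‖gradient φ x‖ ^ 2) :
    ∃ M κ₀ : ℝ, ∀ κ, κ₀ ≤ κ → ∀ u b : EuclideanSpace ℝ (Fin N) → ℝ,
      IsPSolution D 2 u (fun x => lam * u x + b x * u x ^ (q - 1)) → (∀ x ∈ D, 0 ≤ u x) →
      (∀ x ∈ frontier D, u x ≤ 0) → (∀ x ∈ D, b x ≤ A) → (∀ x ∈ Metric.ball x₀ r, b x ≤ -κ) →
      ∀ x ∈ D, u x ≤ M := by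
  obtain ⟨C₁, hC₁, hsup⟩ := exists_sup_bound N (add_nonneg hlam hA) (zero_le_three (α := ℝ))
  obtain ⟨K, hKD, hK, hKvol⟩ := hD.measurableSet.exists_isCompact_sdiff_lt
    hDb.measure_lt_top.ne (ε := ENNReal.ofReal (1 / (4 * (C₁ + 1))))
    (by rw [Ne, ENNReal.ofReal_eq_zero, not_le]; positivity) (μ := volume)
  have hKvol' : C₁ * volume.real (D \ K) ≤ 1 / 4 := by
    have h1 : volume.real (D \ K) ≤ 1 / (4 * (C₁ + 1)) :=
      ENNReal.toReal_le_of_le_ofReal (by positivity) hKvol.le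
    calc C₁ * volume.real (D \ K) ≤ (C₁ + 1) * (1 / (4 * (C₁ + 1))) := by
          gcongr
          linarith
      _ = 1 / 4 := by field_simp
  obtain ⟨C₂, hC₂, hharnack⟩ := exists_harnack hD hDc hx₀ hr hK hKD
  set ω := volume.real (Metric.ball x₀ r) with hω
  set C₃ := 2 * lam + A * (C₁ + 2) ^ (q - 1) with hC₃
  have hC₃0 : 0 ≤ C₃ := by positivity
  set τ := 1 / (8 * (C₂ + 1) * (ω + 1)) with hτ
  have hω0 : 0 ≤ ω := measureReal_nonneg
  have hτ0 : 0 < τ := by positivity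
  have hτω : C₂ * (τ * ω) ≤ 1 / 8 := by
    calc C₂ * (τ * ω) ≤ (C₂ + 1) * (τ * (ω + 1)) := by gcongr <;> linarith
      _ = 1 / 8 := by rw [hτ]; field_simp
  set κ₀ := 8 * C₂ * τ ^ (1 - q) * C₃ + 1 with hκ₀
  have hκ₀0 : 0 < κ₀ := by positivity
  refine ⟨(C₁ + 2) * (2 + 2 * (C₂ * √C₃)) ^ (1 - q / 2)⁻¹, κ₀,
    fun κ hκ u b hu h0 hfr hbA hbκ => ?_⟩
  have hκ0 : 0 < κ := hκ₀0.trans_le hκ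
  have hU := hu.isC1TestFun_truncation hD hDb hfr
  have hU0 : ∀ x, 0 ≤ truncation D u x := truncation_nonneg h0
  set X := (∫ x, truncation D u x) + 1 with hX
  have hX1 : 1 ≤ X := by
    have : 0 ≤ ∫ x, truncation D u x := integral_nonneg fun x => hU0 x
    linarith
  have hX0 : 0 < X := by linarith
  have hUX : ∀ x, truncation D u x ≤ C₁ * X := by
    refine hsup _ (hU.mono (subset_univ _)) hU0 fun ψ hψ hψ0 =>
      hu.integral_inner_truncation_le hD hDb h0 hfr (add_nonneg hlam hA) (fun x hx => ?_) hψ hψ0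
    have e1 := le_truncation_add_two hx (h0 x hx)
    have e2 : u x ^ (q - 1) ≤ 1 + u x := by
      rcases le_total (u x) 1 with h | h
      · linarith [Real.rpow_le_one (h0 x hx) h (by linarith : 0 ≤ q - 1), h0 x hx]
      · have := Real.rpow_le_rpow_of_exponent_le h (by linarith : q - 1 ≤ 1)
        rw [Real.rpow_one] at this
        linarith
    have e3 : b x * u x ^ (q - 1) ≤ A * (truncation D u x + 3) :=
      (mul_le_mul_of_nonneg_right (hbA x hx) (Real.rpow_nonneg (h0 x hx) _)).trans
        (mul_le_mul_of_nonneg_left (by linarith) hA)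
    have e4 : lam * u x ≤ lam * (truncation D u x + 3) :=
      mul_le_mul_of_nonneg_left (by linarith) hlam
    linarith
  have huX : ∀ x ∈ D, u x ≤ (C₁ + 2) * X := fun x hx => by
    linarith [le_truncation_add_two hx (h0 x hx), hUX x]
  have hen := hu.energy_le hD hDb h1q hlam hA hκ0.le h0 hfr hbA measurableSet_ball hbκ huX
  have hen' : (2 * lam + A * ((C₁ + 2) * X) ^ (q - 1)) * ∫ x, truncation D u x ≤ C₃ * X ^ q := by
    have e1 : X ≤ X ^ q := by
      simpa using Real.rpow_le_rpow_of_exponent_le hX1 h1q.le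
    have e2 : X ^ (q - 1) * X = X ^ q := by
      rw [← Real.rpow_add_one hX0.ne']
      simp
    calc _ ≤ (2 * lam + A * ((C₁ + 2) * X) ^ (q - 1)) * X := by
          gcongr
          linarith
      _ = 2 * lam * X + A * (C₁ + 2) ^ (q - 1) * (X ^ (q - 1) * X) := by
          rw [Real.mul_rpow (by positivity) hX0.le]
          ring
      _ ≤ 2 * lam * X ^ q + A * (C₁ + 2) ^ (q - 1) * X ^ q := by rw [e2]; gcongr
      _ = _ := by ring
  have hballq : κ * ∫ x in Metric.ball x₀ r, truncation D u x ^ q ≤ C₃ * X ^ q := by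
    linarith [hP _ hU]
  have hASH := almostSuperharmonic_of_poincare (E := C₃ * X ^ q) hlam hP hU hU0 (by
    have : 0 ≤ κ * ∫ x in Metric.ball x₀ r, truncation D u x ^ q :=
      mul_nonneg hκ0.le (integral_nonneg fun x => Real.rpow_nonneg (hU0 x) _)
    linarith)
  have hsqrt : √(C₃ * X ^ q) = √C₃ * X ^ (q / 2) := by
    rw [Real.sqrt_mul hC₃0, Real.sqrt_eq_rpow (X ^ q), ← Real.rpow_mul hX0.le]
    ring_nf
  have hHar := hharnack _ _ hASH
  rw [hsqrt] at hHar
  have hball : C₂ * ∫ x in Metric.ball x₀ r, truncation D u x ≤ X / 4 := by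
    have hUq := integrable_truncation_rpow hU (zero_lt_one.trans h1q)
    have ic : Integrable (fun _ : EuclideanSpace ℝ (Fin N) => τ * X)
        (volume.restrict (Metric.ball x₀ r)) := integrableOn_const measure_ball_lt_top.ne
    have e1 : ∫ x in Metric.ball x₀ r, truncation D u x ≤
        τ * X * ω + (τ * X) ^ (1 - q) * ∫ x in Metric.ball x₀ r, truncation D u x ^ q := by
      calc ∫ x in Metric.ball x₀ r, truncation D u x
          ≤ ∫ x in Metric.ball x₀ r,
              (τ * X + (τ * X) ^ (1 - q) * truncation D u x ^ q) := by
            refine integral_mono hU.integrable.restrict (ic.add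
              (hUq.restrict.const_mul _)) fun x => ?_
            exact le_add_rpow_mul_rpow h1q (hU0 x) (by positivity)
        _ = _ := by
            rw [integral_add ic
              (hUq.restrict.const_mul _), setIntegral_const, smul_eq_mul, integral_const_mul,
              mul_comm ω]
    have e2 : (τ * X) ^ (1 - q) * (κ * ∫ x in Metric.ball x₀ r, truncation D u x ^ q) ≤
        τ ^ (1 - q) * C₃ * X := by
      calc _ ≤ (τ * X) ^ (1 - q) * (C₃ * X ^ q) := by gcongr
        _ = τ ^ (1 - q) * C₃ * (X ^ (1 - q) * X ^ q) := by
            rw [Real.mul_rpow hτ0.le hX0.le]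
            ring
        _ = _ := by rw [← Real.rpow_add hX0]; simp
    have e3 : C₂ * ((τ * X) ^ (1 - q) *
        ∫ x in Metric.ball x₀ r, truncation D u x ^ q) ≤ X / 8 := by
      refine le_of_mul_le_mul_left ?_ hκ0
      calc _ = C₂ * ((τ * X) ^ (1 - q) *
            (κ * ∫ x in Metric.ball x₀ r, truncation D u x ^ q)) := by ring
        _ ≤ C₂ * (τ ^ (1 - q) * C₃ * X) := by gcongr
        _ = (κ₀ - 1) * (X / 8) := by rw [hκ₀]; ring
        _ ≤ κ * (X / 8) := by gcongr; linarith
    have e4 := mul_le_mul_of_nonneg_right hτω hX0.le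
    have e5 := mul_le_mul_of_nonneg_left e1 hC₂
    linarith
  have hdiff : ∫ x in D \ K, truncation D u x ≤ X / 4 := by
    have hfin : volume (D \ K) ≠ ⊤ := (hKvol.trans_le le_top).ne
    calc ∫ x in D \ K, truncation D u x ≤ ∫ x in D \ K, C₁ * X :=
          integral_mono hU.integrable.restrict (integrableOn_const hfin) hUX
      _ = C₁ * volume.real (D \ K) * X := by
          rw [setIntegral_const, smul_eq_mul]
          ring
      _ ≤ 1 / 4 * X := by gcongr
      _ = _ := by ring
  have hsplit : ∫ x, truncation D u x =
      (∫ x in K, truncation D u x) + ∫ x in D \ K, truncation D u x := by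
    rw [← setIntegral_union disjoint_sdiff_right (hD.measurableSet.diff hK.measurableSet)
      hU.integrable.integrableOn hU.integrable.integrableOn, union_sdiff_cancel hKD]
    exact (setIntegral_eq_integral_of_forall_compl_eq_zero fun x hx => hU.eq_zero hx).symm
  have hXle : X ≤ 2 + 2 * (C₂ * √C₃) * X ^ (q / 2) := by linarith
  have hXb := le_rpow_of_le_add_mul_rpow (by linarith) (by linarith) hX1 hXle
  exact fun x hx => (huX x hx).trans (by gcongr)

end ConnectedBound

section DeadCore

variable {N : ℕ} {Ω : Set (EuclideanSpace ℝ (Fin N))} {p q lam : ℝ}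

lemma DirichletSol.isPSolution (hΩ : IsOpen Ω) (h1q : 1 < q) (hqp : q < p)
    {b u : EuclideanSpace ℝ (Fin N) → ℝ} (hb : ContinuousOn b Ω) (h : DirichletSol Ω p q lam b u) :
    IsPSolution Ω p u fun x => lam * u x ^ (p - 1) + b x * u x ^ (q - 1) := by
  obtain ⟨hc, hd, hg, -, -, -, hw⟩ := h
  have hcΩ := hc.mono subset_closure
  have hrhs : ContinuousOn (fun x => lam * u x ^ (p - 1) + b x * u x ^ (q - 1)) Ω :=
    (continuousOn_const.mul (hcΩ.rpow_const fun _ _ => Or.inr (by linarith))).add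
      (hb.mul (hcΩ.rpow_const fun _ _ => Or.inr (by linarith)))
  refine ⟨hc, contDiffOn_one_of_gradient hΩ hd hg, hrhs, fun φ hφ => ?_⟩
  rw [← hφ.setIntegral_inner, ← hφ.setIntegral_mul]
  refine weak_form_extend hΩ ((continuous_pFlux (h1q.trans hqp)).comp_continuousOn hg) hrhs
    (fun ψ hψ => ?_) hφ
  simpa only [Function.comp_apply, pFlux, real_inner_smul_left] using hw ψ hψ

lemma mul_integral_sq_le_of_le_lambda1 (hlam : lam ≤ lambda1 Ω 2)
    {φ : EuclideanSpace ℝ (Fin N) → ℝ} (hφ : IsTestFun Ω φ) :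
    lam * ∫ x in Ω, φ x ^ 2 ≤ ∫ x in Ω, ‖gradient φ x‖ ^ 2 := by
  have hI : 0 ≤ ∫ x in Ω, φ x ^ 2 := integral_nonneg fun x => sq_nonneg _
  have hG : 0 ≤ ∫ x in Ω, ‖gradient φ x‖ ^ 2 := integral_nonneg fun x => sq_nonneg _
  rcases hI.eq_or_lt with h | h
  · rwa [← h, mul_zero]
  set c := (√(∫ x in Ω, φ x ^ 2))⁻¹ with hc
  have hc2 : c ^ 2 = (∫ x in Ω, φ x ^ 2)⁻¹ := by rw [hc, inv_pow, Real.sq_sqrt hI]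
  have hgrad : ∀ x, gradient (fun y => c * φ y) x = c • gradient φ x := fun x => by
    simp only [gradient_eq_toDual_symm]
    rw [fderiv_const_mul (hφ.1.differentiable (by simp) x), map_smul]
  have hmem : ∫ x in Ω, ‖gradient (fun y => c * φ y) x‖ ^ (2 : ℝ) ∈
      {E : ℝ | ∃ φ : EuclideanSpace ℝ (Fin N) → ℝ, IsTestFun Ω φ ∧
        (∫ x in Ω, |φ x| ^ (2 : ℝ)) = 1 ∧ E = ∫ x in Ω, ‖gradient φ x‖ ^ (2 : ℝ)} := by
    refine ⟨_, ⟨contDiff_const.mul hφ.1, hφ.2.1.mul_left, (tsupport_mul_subset_right).trans hφ.2.2⟩,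
      ?_, rfl⟩
    simp only [Real.rpow_two, sq_abs, mul_pow]
    rw [integral_const_mul, hc2, inv_mul_cancel₀ h.ne']
  have hle : lam ≤ ∫ x in Ω, ‖gradient (fun y => c * φ y) x‖ ^ (2 : ℝ) := by
    refine hlam.trans (csInf_le ⟨0, ?_⟩ hmem)
    rintro E ⟨ψ, -, -, rfl⟩
    exact integral_nonneg fun x => by positivity
  simp only [Real.rpow_two, hgrad, norm_smul, mul_pow, Real.norm_eq_abs, sq_abs] at hle
  rwa [integral_const_mul, hc2, inv_mul_eq_div, le_div_iff₀ h] at hle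

lemma frontier_connectedComponentIn_subset (hΩ : IsOpen Ω) (x : EuclideanSpace ℝ (Fin N)) :
    frontier (connectedComponentIn Ω x) ⊆ frontier Ω := by
  intro y hy
  have hD : IsOpen (connectedComponentIn Ω x) := hΩ.connectedComponentIn
  rw [hD.frontier_eq] at hy
  rw [hΩ.frontier_eq]
  refine ⟨closure_mono (connectedComponentIn_subset Ω x) hy.1, fun hyΩ => hy.2 ?_⟩
  obtain ⟨z, hz1, hz2⟩ := mem_closure_iff.1 hy.1 _ hΩ.connectedComponentIn
    (mem_connectedComponentIn hyΩ)
  rw [connectedComponentIn_eq hz2, ← connectedComponentIn_eq hz1]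
  exact mem_connectedComponentIn hyΩ

/-- Bound near a point where the absorption is strong, uniform in the strength of absorption. -/
lemma exists_bound_on_ball (hN : 1 ≤ N) (hΩ : IsOpen Ω) (hΩb : Bornology.IsBounded Ω)
    (h1q : 1 < q) (hqp : q < p) (hlam : lam ≤ 0 ∨ (p = 2 ∧ lam ≤ lambda1 Ω p)) {A : ℝ} (hA : 0 ≤ A)
    {x₀ : EuclideanSpace ℝ (Fin N)} {r : ℝ} (hr : 0 < r) (hball : Metric.ball x₀ r ⊆ Ω) :
    ∃ M κ₀ : ℝ, ∀ κ, κ₀ ≤ κ → ∀ u b : EuclideanSpace ℝ (Fin N) → ℝ,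
      IsPSolution Ω p u (fun x => lam * u x ^ (p - 1) + b x * u x ^ (q - 1)) →
      (∀ x ∈ Ω, 0 ≤ u x) → (∀ x ∈ frontier Ω, u x = 0) → (∀ x ∈ Ω, b x ≤ A) →
      (∀ x ∈ Metric.ball x₀ r, b x ≤ -κ) → ∀ x ∈ Metric.ball x₀ r, u x ≤ M := by
  rcases le_or_gt lam 0 with hl | hl
  · obtain ⟨M, hM⟩ := exists_bound_of_sublinear (p := p) hN h1q hqp hΩ hΩb hA
    refine ⟨M, 0, fun κ _ u b hu h0 hfr hb _ x hx => hM u _ hu h0 hfr (fun y hy => ?_) x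
      (subset_closure (hball hx))⟩
    have h1 := mul_le_mul_of_nonneg_right (hb y hy) (Real.rpow_nonneg (h0 y hy) (q - 1))
    have h2 := mul_nonpos_of_nonpos_of_nonneg hl (Real.rpow_nonneg (h0 y hy) (p - 1))
    linarith
  · obtain ⟨rfl, hl1⟩ := hlam.resolve_left hl.not_ge
    have hx₀ : x₀ ∈ Ω := hball (Metric.mem_ball_self hr)
    set D := connectedComponentIn Ω x₀ with hD
    have hDΩ : D ⊆ Ω := connectedComponentIn_subset Ω x₀
    obtain ⟨M, κ₀, hM⟩ := exists_bound_of_connected (D := D) hΩ.connectedComponentIn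
      isPreconnected_connectedComponentIn (hΩb.subset hDΩ) hr (mem_connectedComponentIn hx₀) h1q hqp
      hl.le hA fun φ hφ => poincare_extend hΩ
        (fun ψ hψ => mul_integral_sq_le_of_le_lambda1 hl1 hψ) (hφ.mono hDΩ)
    refine ⟨M, κ₀, fun κ hκ u b hu h0 hfr hb hbκ x hx => hM κ hκ u b ?_
      (fun y hy => h0 y (hDΩ hy))
      (fun y hy => (hfr y (frontier_connectedComponentIn_subset hΩ x₀ hy)).le)
      (fun y hy => hb y (hDΩ hy)) hbκ x ?_⟩
    · have h := hu.mono hDΩ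
      simpa [show (2 : ℝ) - 1 = 1 by norm_num] using h
    · exact (convex_ball x₀ r).isPreconnected.subset_connectedComponentIn
        (Metric.mem_ball_self hr) hball hx

lemma exists_vanishing_near (hN : 1 ≤ N) (hΩ : IsOpen Ω) (hΩb : Bornology.IsBounded Ω)
    (h1q : 1 < q) (hqp : q < p) (hlam : lam ≤ 0 ∨ (p = 2 ∧ lam ≤ lambda1 Ω p))
    {a : EuclideanSpace ℝ (Fin N) → ℝ} (ha : ContinuousOn a (closure Ω))
    {x₀ : EuclideanSpace ℝ (Fin N)} (hx₀ : x₀ ∈ Ω) (hax₀ : a x₀ < 0) :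
    ∃ t ∈ 𝓝 x₀, ∃ n₀ : ℕ, ∀ n : ℕ, n₀ ≤ n → ∀ u : EuclideanSpace ℝ (Fin N) → ℝ,
      DirichletSol Ω p q lam (fun x => max (a x) 0 - (n : ℝ) * max (-a x) 0) u →
      ∀ x ∈ t, u x = 0 := by
  have haΩ := ha.mono subset_closure
  obtain ⟨A, hA⟩ := (hΩb.isCompact_closure).bddAbove_image ha
  set δ := -a x₀ / 2 with hδ
  have hδ0 : 0 < δ := by rw [hδ]; linarith
  obtain ⟨ρ, hρ0, hρ⟩ : ∃ ρ > 0, Metric.ball x₀ ρ ⊆ {x | x ∈ Ω ∧ a x < -δ} := by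
    refine Metric.mem_nhds_iff.1 (Filter.inter_mem (hΩ.mem_nhds hx₀) ?_)
    exact (haΩ.continuousAt (hΩ.mem_nhds hx₀)).eventually_lt_const (by rw [hδ]; linarith)
  obtain ⟨M, κ₀, hM⟩ := exists_bound_on_ball (A := max A 0) hN hΩ hΩb h1q hqp hlam
    (le_max_right _ _) hρ0 fun x hx => (hρ hx).1
  set M' := max M 1 with hM'
  have hM'0 : 0 < M' := zero_lt_one.trans_le (le_max_right _ _)
  have hr : 0 < ρ / 3 := by positivity
  obtain ⟨κ₁, hκ₁⟩ := exists_deadCore_threshold N h1q hqp hM'0 hr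
  obtain ⟨n₀, hn₀⟩ := exists_nat_ge (max κ₀ (κ₁ + max lam 0 * M' ^ (p - q)) / δ)
  refine ⟨_, Metric.ball_mem_nhds x₀ hr, n₀, fun n hn u hu y hy => ?_⟩
  have hnδ : max κ₀ (κ₁ + max lam 0 * M' ^ (p - q)) ≤ n * δ := by
    rw [← div_le_iff₀ hδ0]
    exact hn₀.trans (by exact_mod_cast hn)
  set b : EuclideanSpace ℝ (Fin N) → ℝ := fun x => max (a x) 0 - (n : ℝ) * max (-a x) 0 with hb
  have hbc : ContinuousOn b Ω := (haΩ.sup continuousOn_const).sub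
    (continuousOn_const.mul (haΩ.neg.sup continuousOn_const))
  have hsol := hu.isPSolution hΩ h1q hqp hbc
  obtain ⟨-, -, -, h0, hfr, -⟩ := hu
  have hbA : ∀ x ∈ Ω, b x ≤ max A 0 := fun x hx => by
    have h1 : a x ≤ A := hA (mem_image_of_mem a (subset_closure hx))
    have h2 : 0 ≤ (n : ℝ) * max (-a x) 0 := by positivity
    have h3 : max (a x) 0 ≤ max A 0 := max_le_max_right 0 h1
    simp only [hb]
    linarith
  have hbδ : ∀ x ∈ Metric.ball x₀ ρ, b x ≤ -(n * δ) := fun x hx => by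
    have h1 := (hρ hx).2
    have h2 : (n : ℝ) * δ ≤ n * max (-a x) 0 := by
      gcongr
      exact le_max_of_le_left (by linarith)
    have h3 : max (a x) 0 = 0 := max_eq_right (by linarith)
    simp only [hb, h3]
    linarith
  have hbd := hM _ ((le_max_left _ _).trans hnδ) u b hsol h0 hfr hbA hbδ
  have hsub : Metric.closedBall y (ρ / 3) ⊆ Metric.ball x₀ ρ :=
    Metric.closedBall_subset_ball' (by linarith [Metric.mem_ball.1 hy])
  have hsub' := Metric.ball_subset_closedBall.trans hsub
  refine hκ₁ y u _ (n * δ - max lam 0 * M' ^ (p - q))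
    (by linarith [(le_max_right κ₀ _).trans hnδ]) (hsol.mono fun x hx => (hρ (hsub' hx)).1)
    (fun x hx => ⟨h0 x (hρ (hsub hx)).1, (hbd x (hsub hx)).trans (le_max_left _ _)⟩)
    fun x hx => ?_
  have hux := h0 x (hρ (hsub' hx)).1
  have huM : u x ≤ M' := (hbd x (hsub' hx)).trans (le_max_left _ _)
  have hq0 : 0 ≤ u x ^ (q - 1) := Real.rpow_nonneg hux _
  have e1 : u x ^ (p - 1) ≤ M' ^ (p - q) * u x ^ (q - 1) := by
    rw [show p - 1 = (p - q) + (q - 1) by ring, Real.rpow_add_of_nonneg hux (by linarith)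
      (by linarith)]
    gcongr
  have e2 : lam * u x ^ (p - 1) ≤ max lam 0 * (M' ^ (p - q) * u x ^ (q - 1)) :=
    mul_le_mul (le_max_left _ _) e1 (Real.rpow_nonneg hux _) (le_max_right _ _)
  have e3 := mul_le_mul_of_nonneg_right (hbδ x (hsub' hx)) hq0
  linarith

end DeadCore

end Auxiliary

/-- Dead core formation: if `Ω' ⋐ Ω_a^-` and `a_n := a⁺ - n a⁻`, and either `λ ≤ 0` or
`p = 2` and `λ ≤ λ₁`, then for all large `n` every Dirichlet weak solution of `(P_λ)` with
weight `a_n` vanishes on `Ω'`. -/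
theorem dead_core_formation
    {N : ℕ} (hN : 1 ≤ N) (Ω : Set (EuclideanSpace ℝ (Fin N)))
    (hΩne : Ω.Nonempty) (hΩo : IsOpen Ω) (hΩb : Bornology.IsBounded Ω)
    (p q : ℝ) (h1q : 1 < q) (hqp : q < p)
    (a : EuclideanSpace ℝ (Fin N) → ℝ) (ha : ContinuousOn a (closure Ω))
    (haplus : ∃ x ∈ Ω, 0 < a x) (haminus : ∃ x ∈ Ω, a x < 0)
    (Ω' : Set (EuclideanSpace ℝ (Fin N))) (hΩ'o : IsOpen Ω')
    (hΩ'cpt : IsCompact (closure Ω'))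
    (hΩ'sub : closure Ω' ⊆ {x | x ∈ Ω ∧ a x < 0})
    (lam : ℝ) (hlam : lam ≤ 0 ∨ (p = 2 ∧ lam ≤ lambda1 Ω p)) :
    ∃ n₀ : ℕ, ∀ n : ℕ, n₀ ≤ n →
      ∀ u : EuclideanSpace ℝ (Fin N) → ℝ,
        DirichletSol Ω p q lam (fun x => max (a x) 0 - (n : ℝ) * max (-a x) 0) u →
        ∀ x ∈ Ω', u x = 0 := by
  suffices h : ∃ n₀ : ℕ, ∀ n : ℕ, n₀ ≤ n → ∀ u : EuclideanSpace ℝ (Fin N) → ℝ,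
      DirichletSol Ω p q lam (fun x => max (a x) 0 - (n : ℝ) * max (-a x) 0) u →
      ∀ x ∈ closure Ω', u x = 0 by
    obtain ⟨n₀, h⟩ := h
    exact ⟨n₀, fun n hn u hu x hx => h n hn u hu x (subset_closure hx)⟩
  refine hΩ'cpt.induction_on ⟨0, by simp⟩ ?_ ?_ fun x hx => ?_
  · rintro s t hst ⟨n₀, h⟩
    exact ⟨n₀, fun n hn u hu x hx => h n hn u hu x (hst hx)⟩
  · rintro s t ⟨n₁, h₁⟩ ⟨n₂, h₂⟩
    refine ⟨max n₁ n₂, fun n hn u hu x hx => ?_⟩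
    exact hx.elim (h₁ n ((le_max_left _ _).trans hn) u hu x)
      (h₂ n ((le_max_right _ _).trans hn) u hu x)
  · obtain ⟨t, ht, h⟩ := exists_vanishing_near hN hΩo hΩb h1q hqp hlam ha (hΩ'sub hx).1
      (hΩ'sub hx).2
    exact ⟨t, mem_nhdsWithin_of_mem_nhds ht, h⟩
end
end

section
/- Suppose λ < λ' < 0. Let u be a Dirichlet weak solution of (P_λ) with u(x) > 0 for every x ∈ Ω_a^+, and let v be a Dirichlet weak solution of (P_{λ'}) with v(x) > 0 for every x ∈ Ω_a^+. Then u(x) ≤ v(x) for every x ∈ Ω, and u is not identically equal to v on Ω. -/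
open MeasureTheory RealInnerProductSpace

noncomputable section

/-! ### Scalar and vector inequalities -/

/-- Young's inequality in the form needed for the Picone-type inequality. -/
lemma young_picone {p q m n t : ℝ} (h1q : 1 < q) (hqp : q < p) (hm : 0 ≤ m) (hn : 0 ≤ n)
    (ht : 0 < t) :
    q * t ^ (q - 1) * (m ^ (p - 1) * n) ≤ (q - 1) * t ^ q * m ^ p + m ^ (p - q) * n ^ q := by
  have hq0 : 0 < q := by linarith
  have hy := Real.young_inequality_of_nonneg (a := n) (b := (t * m) ^ (q - 1)) hn (by positivity)
    (Real.HolderConjugate.conjExponent h1q)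
  rw [← Real.rpow_mul (by positivity), Real.conjExponent,
    mul_div_cancel₀ _ (by linarith : q - 1 ≠ 0), Real.mul_rpow ht.le hm,
    Real.mul_rpow ht.le hm] at hy
  have e1 : m ^ (p - 1) = m ^ (p - q) * m ^ (q - 1) := by
    rw [← Real.rpow_add_of_nonneg hm (by linarith) (by linarith)]
    congr 1; ring
  have e2 : m ^ p = m ^ (p - q) * m ^ q := by
    rw [← Real.rpow_add_of_nonneg hm (by linarith) (by linarith)]
    congr 1; ring
  have hmq : 0 ≤ m ^ (p - q) := by positivity
  have hy' : q * (n * (t ^ (q - 1) * m ^ (q - 1))) ≤ n ^ q + (q - 1) * (t ^ q * m ^ q) := by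
    have := mul_le_mul_of_nonneg_left hy hq0.le
    have h3 : q * (n ^ q / q + t ^ q * m ^ q / (q / (q - 1)))
        = n ^ q + (q - 1) * (t ^ q * m ^ q) := by
      field_simp
    linarith
  rw [e1, e2]
  nlinarith [mul_le_mul_of_nonneg_left hy' hmq]

/-- The scalar form of the generalized Picone inequality. -/
lemma picone_scalar {p q m n t : ℝ} (h1q : 1 < q) (hqp : q < p) (hm : 0 ≤ m) (hn : 0 ≤ n)
    (ht : 0 < t) :
    q * t ^ (q - 1) * (m ^ (p - 1) * n) + q * t⁻¹ ^ (q - 1) * (n ^ (p - 1) * m)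
      ≤ m ^ p * (1 + (q - 1) * t ^ q) + n ^ p * (1 + (q - 1) * t⁻¹ ^ q) := by
  have h1 := young_picone h1q hqp hm hn ht
  have h2 := young_picone h1q hqp hn hm (inv_pos.2 ht)
  have key : ∀ x : ℝ, 0 ≤ x → x ^ p = x ^ (p - q) * x ^ q := fun x hx => by
    rw [← Real.rpow_add_of_nonneg hx (by linarith) (by linarith)]
    congr 1; ring
  have h3 : m ^ (p - q) * n ^ q + n ^ (p - q) * m ^ q ≤ m ^ p + n ^ p := by
    rw [key m hm, key n hn]
    rcases le_total m n with h | h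
    · have a1 := Real.rpow_le_rpow hm h (by linarith : 0 ≤ p - q)
      have a2 := Real.rpow_le_rpow hm h (by linarith : 0 ≤ q)
      nlinarith
    · have a1 := Real.rpow_le_rpow hn h (by linarith : 0 ≤ p - q)
      have a2 := Real.rpow_le_rpow hn h (by linarith : 0 ≤ q)
      nlinarith
  linarith

lemma rpow_sub_two_mul_inner_le {E : Type*} [NormedAddCommGroup E] [InnerProductSpace ℝ E]
    {p : ℝ} (hp : 1 < p) (X Y : E) :
    ‖X‖ ^ (p - 2) * ⟪X, Y⟫ ≤ ‖X‖ ^ (p - 1) * ‖Y‖ := by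
  rcases eq_or_ne X 0 with rfl | hX
  · simp [Real.zero_rpow (by linarith : p - 1 ≠ 0)]
  · have e : ‖X‖ ^ (p - 1) = ‖X‖ ^ (p - 2) * ‖X‖ := by
      rw [← Real.rpow_add_one (by simpa using hX)]
      congr 1; ring
    rw [e, mul_assoc]
    exact mul_le_mul_of_nonneg_left (real_inner_le_norm X Y) (by positivity)

lemma rpow_sub_two_mul_inner_self {E : Type*} [NormedAddCommGroup E] [InnerProductSpace ℝ E]
    {p : ℝ} (hp : 1 < p) (X : E) :
    ‖X‖ ^ (p - 2) * ⟪X, X⟫ = ‖X‖ ^ p := by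
  rcases eq_or_ne X 0 with rfl | hX
  · simp [Real.zero_rpow (by linarith : p ≠ 0)]
  · rw [real_inner_self_eq_norm_sq, ← Real.rpow_two, ← Real.rpow_add (by simpa using hX)]
    congr 1; ring

/-- Hidden convexity: the pointwise lower bound for the `p`-Laplacian tested with
`g (U ^ q - V ^ q) * U ^ (1 - q)` and `g (U ^ q - V ^ q) * V ^ (1 - q)`, where `d = g'` and
`e = t * g' t - g t` at `t = U ^ q - V ^ q`. -/
lemma hidden_convexity {E : Type*} [NormedAddCommGroup E] [InnerProductSpace ℝ E]
    {p q U V d e g : ℝ} (h1q : 1 < q) (hqp : q < p) (hU : 0 < U) (hV : 0 < V) (hd : 0 ≤ d)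
    (he : 0 ≤ e) (hg : g = (U ^ q - V ^ q) * d - e) (X Y : E) :
    -((q - 1) * e * V ^ (-q) * ‖Y‖ ^ p) ≤
      ‖X‖ ^ (p - 2) * ⟪X, (U ^ (1 - q) * d) • ((q * U ^ (q - 1)) • X - (q * V ^ (q - 1)) • Y)
          + (g * ((1 - q) * U ^ (-q))) • X⟫
      - ‖Y‖ ^ (p - 2) * ⟪Y, (V ^ (1 - q) * d) • ((q * U ^ (q - 1)) • X - (q * V ^ (q - 1)) • Y)
          + (g * ((1 - q) * V ^ (-q))) • Y⟫ := by
  have hp : 1 < p := by linarith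
  have hP := picone_scalar h1q hqp (norm_nonneg X) (norm_nonneg Y) (div_pos hV hU)
  have i1 := rpow_sub_two_mul_inner_le hp X Y
  have i2 := rpow_sub_two_mul_inner_le hp Y X
  have s1 := rpow_sub_two_mul_inner_self hp X
  have s2 := rpow_sub_two_mul_inner_self hp Y
  rw [inv_div, Real.div_rpow hV.le hU.le, Real.div_rpow hV.le hU.le, Real.div_rpow hU.le hV.le,
    Real.div_rpow hU.le hV.le] at hP
  have eU : U ^ (1 - q) = (U ^ (q - 1))⁻¹ := by rw [← Real.rpow_neg hU.le]; congr 1; ring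
  have eV : V ^ (1 - q) = (V ^ (q - 1))⁻¹ := by rw [← Real.rpow_neg hV.le]; congr 1; ring
  rw [eU, eV, Real.rpow_neg hU.le, Real.rpow_neg hV.le]
  have pU : 0 < U ^ (q - 1) := by positivity
  have pV : 0 < V ^ (q - 1) := by positivity
  have pU' : 0 < U ^ q := by positivity
  have pV' : 0 < V ^ q := by positivity
  simp only [inner_add_right, inner_smul_right, inner_sub_right]
  generalize U ^ (q - 1) = u1 at *
  generalize V ^ (q - 1) = v1 at *
  generalize U ^ q = u2 at *
  generalize V ^ q = v2 at *
  set A := ‖X‖ ^ p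
  set B := ‖Y‖ ^ p
  have hA : 0 ≤ A := by positivity
  have hB : 0 ≤ B := by positivity
  generalize ‖X‖ ^ (p - 2) = x2 at *
  generalize ‖Y‖ ^ (p - 2) = y2 at *
  have j1 := mul_le_mul_of_nonneg_left i1 (by positivity : 0 ≤ q * (v1 / u1))
  have j2 := mul_le_mul_of_nonneg_left i2 (by positivity : 0 ≤ q * (u1 / v1))
  have hQ : 0 ≤ A * (1 + (q - 1) * (v2 / u2)) + B * (1 + (q - 1) * (u2 / v2))
      - q * (v1 / u1) * (x2 * ⟪X, Y⟫) - q * (u1 / v1) * (y2 * ⟪Y, X⟫) := by linarith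
  have hdQ := mul_nonneg hd hQ
  have hE : 0 ≤ (q - 1) * e * (A / u2) := by
    have : 0 ≤ q - 1 := by linarith
    positivity
  have key : x2 * (u1⁻¹ * d * (q * u1 * ⟪X, X⟫ - q * v1 * ⟪X, Y⟫)
        + g * ((1 - q) * u2⁻¹) * ⟪X, X⟫)
      - y2 * (v1⁻¹ * d * (q * u1 * ⟪Y, X⟫ - q * v1 * ⟪Y, Y⟫)
        + g * ((1 - q) * v2⁻¹) * ⟪Y, Y⟫)
      = d * (A * (1 + (q - 1) * (v2 / u2)) + B * (1 + (q - 1) * (u2 / v2))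
        - q * (v1 / u1) * (x2 * ⟪X, Y⟫) - q * (u1 / v1) * (y2 * ⟪Y, X⟫))
        + (q - 1) * e * (A / u2) - (q - 1) * e * v2⁻¹ * B := by
    rw [← s1, ← s2, hg]
    field_simp
    ring
  linarith

/-! ### A continuously differentiable truncation -/

/-- A `C^1` nondecreasing approximation of the positive part, vanishing on `(-∞, δ]`. -/
def softPos (δ t : ℝ) : ℝ := max t δ - 2 * δ + δ ^ 2 / max t δ

/-- The derivative of `softPos`. -/
def softPosDeriv (δ t : ℝ) : ℝ := 1 - δ ^ 2 / max t δ ^ 2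

lemma softPos_eq_zero {δ t : ℝ} (h : t ≤ δ) : softPos δ t = 0 := by
  rw [softPos, max_eq_right h]
  field_simp
  ring

lemma continuous_softPos {δ : ℝ} (hδ : 0 < δ) : Continuous (softPos δ) := by
  have : ∀ t, max t δ ≠ 0 := fun t => (lt_max_of_lt_right hδ).ne'
  unfold softPos
  fun_prop (disch := exact this _)

lemma continuous_softPosDeriv {δ : ℝ} (hδ : 0 < δ) : Continuous (softPosDeriv δ) := by
  have : ∀ t, max t δ ^ 2 ≠ 0 := fun t => pow_ne_zero _ (lt_max_of_lt_right hδ).ne'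
  unfold softPosDeriv
  fun_prop (disch := exact this _)

lemma hasDerivAt_softPos {δ : ℝ} (hδ : 0 < δ) (t : ℝ) :
    HasDerivAt (softPos δ) (softPosDeriv δ t) t := by
  refine hasDerivAt_of_hasDerivAt_of_ne' (x := δ) (fun y hy => ?_)
    (continuous_softPos hδ).continuousAt (continuous_softPosDeriv hδ).continuousAt t
  rcases lt_or_gt_of_ne hy with h | h
  · have e : softPos δ =ᶠ[nhds y] fun _ => 0 := by
      filter_upwards [gt_mem_nhds h] with z hz using softPos_eq_zero hz.le
    have e2 : softPosDeriv δ y = 0 := by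
      rw [softPosDeriv, max_eq_right h.le, div_self (by positivity), sub_self]
    rw [e2]
    exact (hasDerivAt_const y (0 : ℝ)).congr_of_eventuallyEq e
  · have e : softPos δ =ᶠ[nhds y] fun z => z - 2 * δ + δ ^ 2 / z := by
      filter_upwards [lt_mem_nhds h] with z hz
      rw [softPos, max_eq_left hz.le]
    have hy0 : y ≠ 0 := by linarith
    refine HasDerivAt.congr_of_eventuallyEq ?_ e
    have := ((hasDerivAt_id y).sub_const (2 * δ)).add ((hasDerivAt_inv hy0).const_mul (δ ^ 2))
    refine this.congr_deriv ?_
    rw [softPosDeriv, max_eq_left h.le]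
    field_simp
    ring

lemma contDiff_softPos {δ : ℝ} (hδ : 0 < δ) : ContDiff ℝ 1 (softPos δ) := by
  rw [contDiff_one_iff_deriv]
  refine ⟨fun t => (hasDerivAt_softPos hδ t).differentiableAt, ?_⟩
  have : deriv (softPos δ) = softPosDeriv δ := funext fun t => (hasDerivAt_softPos hδ t).deriv
  rw [this]
  exact continuous_softPosDeriv hδ

lemma softPosDeriv_nonneg {δ : ℝ} (hδ : 0 < δ) (t : ℝ) : 0 ≤ softPosDeriv δ t := by
  have h : δ ≤ max t δ := le_max_right _ _
  rw [softPosDeriv, sub_nonneg, div_le_one (pow_pos (hδ.trans_le h) 2)]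
  gcongr

lemma softPos_nonneg {δ : ℝ} (hδ : 0 < δ) (t : ℝ) : 0 ≤ softPos δ t := by
  have h : 0 < max t δ := hδ.trans_le (le_max_right _ _)
  have : softPos δ t = (max t δ - δ) ^ 2 / max t δ := by
    rw [softPos]
    field_simp
    ring
  rw [this]
  positivity

lemma abs_softPos_sub_le {δ : ℝ} (hδ : 0 < δ) (t : ℝ) : |softPos δ t - max t 0| ≤ 2 * δ := by
  rcases le_total t δ with h | h
  · rw [softPos_eq_zero h, zero_sub, abs_neg, abs_of_nonneg (le_max_right _ _)]
    exact max_le (by linarith) (by linarith)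
  · have ht : 0 < t := hδ.trans_le h
    rw [softPos, max_eq_left h, max_eq_left ht.le, abs_le]
    have h1 : 0 ≤ δ ^ 2 / t := by positivity
    have h2 : δ ^ 2 / t ≤ δ := by rw [div_le_iff₀ ht]; nlinarith
    constructor <;> linarith

lemma softPos_le {δ : ℝ} (hδ : 0 < δ) (t : ℝ) : softPos δ t ≤ max t 0 := by
  rcases le_total t δ with h | h
  · rw [softPos_eq_zero h]
    exact le_max_right _ _
  · have ht : 0 < t := hδ.trans_le h
    have h2 : δ ^ 2 / t ≤ δ := by rw [div_le_iff₀ ht]; nlinarith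
    rw [softPos, max_eq_left h, max_eq_left ht.le]
    linarith

lemma softPos_defect_mem {δ : ℝ} (hδ : 0 < δ) (t : ℝ) :
    0 ≤ t * softPosDeriv δ t - softPos δ t ∧ t * softPosDeriv δ t - softPos δ t ≤ 2 * δ := by
  rcases le_total t δ with h | h
  · rw [softPos_eq_zero h, softPosDeriv, max_eq_right h, div_self (by positivity)]
    constructor <;> linarith
  · have ht : 0 < t := hδ.trans_le h
    have h2 : δ ^ 2 / t ≤ δ := by rw [div_le_iff₀ ht]; nlinarith
    have h1 : 0 ≤ δ ^ 2 / t := by positivity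
    have e : t * softPosDeriv δ t - softPos δ t = 2 * δ - 2 * (δ ^ 2 / t) := by
      rw [softPos, softPosDeriv, max_eq_left h]
      field_simp
      ring
    rw [e]
    constructor <;> linarith

/-! ### Extending the weak formulation to `C^1` test functions -/

section Mollify

open Filter Topology Metric Function Convolution

variable {E : Type*} [NormedAddCommGroup E] [NormedSpace ℝ E] [FiniteDimensional ℝ E]
  [MeasurableSpace E] [BorelSpace E]

lemma norm_normed_convolution_le {F : Type*} [NormedAddCommGroup F] [NormedSpace ℝ F]
    [CompleteSpace F] (μ : Measure E) [μ.IsAddHaarMeasure] (b : ContDiffBump (0 : E))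
    {f : E → F} {M : ℝ} (hf : Continuous f) (hM : ∀ x, ‖f x‖ ≤ M) (x : E) :
    ‖(b.normed μ ⋆[ContinuousLinearMap.lsmul ℝ ℝ, μ] f) x‖ ≤ 3 * M := by
  have := b.dist_normed_convolution_le (μ := μ) (x₀ := x) (ε := 2 * M)
    hf.aestronglyMeasurable (fun y _ => by
      rw [dist_eq_norm]
      linarith [norm_sub_le (f y) (f x), hM x, hM y])
  rw [dist_eq_norm] at this
  linarith [norm_le_norm_add_norm_sub' ((b.normed μ
    ⋆[ContinuousLinearMap.lsmul ℝ ℝ, μ] f) x) (f x), hM x]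

/-- A compactly supported `C^1` function is approximated by smooth functions supported in a
common compact neighbourhood, with uniform bounds, pointwise together with the derivative. -/
lemma exists_smooth_approx (μ : Measure E) [μ.IsAddHaarMeasure] {Ω : Set E} (hΩ : IsOpen Ω)
    {w : E → ℝ} (hw : ContDiff ℝ 1 w)
    (hc : HasCompactSupport w) (hs : tsupport w ⊆ Ω) :
    ∃ (K : Set E) (C : ℝ) (φ : ℕ → E → ℝ), IsCompact K ∧ K ⊆ Ω ∧
      (∀ n, ContDiff ℝ (⊤ : ℕ∞) (φ n)) ∧ (∀ n, HasCompactSupport (φ n)) ∧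
      (∀ n, tsupport (φ n) ⊆ K) ∧ (∀ n x, ‖φ n x‖ ≤ C) ∧ (∀ n x, ‖fderiv ℝ (φ n) x‖ ≤ C) ∧
      (∀ x, Tendsto (fun n => φ n x) atTop (𝓝 (w x))) ∧
      (∀ x, Tendsto (fun n => fderiv ℝ (φ n) x) atTop (𝓝 (fderiv ℝ w x))) := by
  have hcK : IsCompact (tsupport w) := hc
  obtain ⟨r, hr, hrΩ⟩ := hcK.exists_cthickening_subset_open hΩ hs
  have hK : IsCompact (cthickening r (tsupport w)) := hcK.cthickening
  have hdw : Continuous (fderiv ℝ w) := hw.continuous_fderiv one_ne_zero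
  obtain ⟨C₁, hC₁⟩ := hc.exists_bound_of_continuous hw.continuous
  obtain ⟨C₂, hC₂⟩ := (hc.fderiv ℝ).exists_bound_of_continuous hdw
  let b : ℕ → ContDiffBump (0 : E) := fun n =>
    ⟨r / (n + 1) / 2, r / (n + 1), by positivity, half_lt_self (by positivity)⟩
  have hb : Tendsto (fun n => (b n).rOut) atTop (𝓝 0) :=
    tendsto_const_div_atTop_nhds_zero_nat r |>.comp (tendsto_add_atTop_nat 1) |>.congr
      fun n => by simp [b]
  have hbr : ∀ n, (b n).rOut ≤ r := fun n => div_le_self hr.le (by simp)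
  let φ : ℕ → E → ℝ := fun n => (b n).normed μ ⋆[ContinuousLinearMap.lsmul ℝ ℝ, μ] w
  have hderiv : ∀ n x, fderiv ℝ (φ n) x =
      ((b n).normed μ ⋆[ContinuousLinearMap.lsmul ℝ ℝ, μ] fderiv ℝ w) x := fun n x =>
    (hc.hasFDerivAt_convolution_right (ContinuousLinearMap.lsmul ℝ ℝ)
      ((b n).continuous_normed.locallyIntegrable) hw x).fderiv
  have hsupp : ∀ n, tsupport (φ n) ⊆ cthickening r (tsupport w) := fun n => by
    refine closure_minimal ?_ isClosed_cthickening
    refine (support_convolution_subset_swap (ContinuousLinearMap.lsmul ℝ ℝ)).trans ?_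
    rintro _ ⟨y, hy, z, hz, rfl⟩
    rw [(b n).support_normed_eq] at hz
    refine mem_cthickening_of_dist_le (y + z) y r _ (subset_tsupport _ hy) ?_
    have : ‖z‖ < (b n).rOut := by simpa using hz
    simpa [dist_eq_norm] using this.le.trans (hbr n)
  refine ⟨cthickening r (tsupport w), max (3 * C₁) (3 * C₂), φ, hK, hrΩ,
    fun n => ?_, fun n => ?_, hsupp, fun n x => ?_, fun n x => ?_,
    fun x => ?_, fun x => ?_⟩
  · exact (b n).hasCompactSupport_normed.contDiff_convolution_left _ (b n).contDiff_normed
      hw.continuous.locallyIntegrable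
  · exact hK.of_isClosed_subset (isClosed_tsupport _) (hsupp n)
  · exact (norm_normed_convolution_le μ (b n) hw.continuous hC₁ x).trans (le_max_left _ _)
  · rw [hderiv]
    exact (norm_normed_convolution_le μ (b n) hdw hC₂ x).trans (le_max_right _ _)
  · exact ContDiffBump.convolution_tendsto_right_of_continuous hb hw.continuous x
  · simp only [hderiv]
    exact ContDiffBump.convolution_tendsto_right_of_continuous hb hdw x

lemma integrableOn_fderiv_apply {μ : Measure E} {Ω : Set E} {F : E → E} {w : E → ℝ}
    (hF : IntegrableOn F (tsupport w) μ)
    (hFm : AEStronglyMeasurable F (μ.restrict Ω))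
    (hw : ContDiff ℝ 1 w) (hc : HasCompactSupport w) :
    IntegrableOn (fun x => fderiv ℝ w x (F x)) Ω μ := by
  have hdw : Continuous (fderiv ℝ w) := hw.continuous_fderiv one_ne_zero
  obtain ⟨C, hC⟩ := (hc.fderiv ℝ).exists_bound_of_continuous hdw
  have hm : MeasurableSet (tsupport w) := (isClosed_tsupport w).measurableSet
  have hi : Integrable (fun x => C * (tsupport w).indicator (fun x => ‖F x‖) x) (μ.restrict Ω) :=
    (((integrable_indicator_iff hm).2 hF.norm).mono_measure Measure.restrict_le_self).const_mul C
  refine hi.mono' ?_ (ae_of_all _ fun x => ?_)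
  · exact (ContinuousLinearMap.id ℝ (E →L[ℝ] ℝ)).aestronglyMeasurable_comp₂
      hdw.aestronglyMeasurable hFm
  · by_cases hx : x ∈ tsupport w
    · rw [Set.indicator_of_mem hx]
      exact (ContinuousLinearMap.le_opNorm _ _).trans
        (mul_le_mul_of_nonneg_right (hC x) (norm_nonneg _))
    · have : fderiv ℝ w x = 0 := by
        by_contra h
        exact hx (support_fderiv_subset ℝ h)
      simp [this, hx]

/-- A weak identity valid for smooth compactly supported test functions is valid for compactly
supported `C^1` test functions. -/
lemma weak_identity_of_contDiff_one {μ : Measure E} [μ.IsAddHaarMeasure] {Ω : Set E}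
    (hΩ : IsOpen Ω) {F : E → E} {f : E → ℝ}
    (hF : ∀ K ⊆ Ω, IsCompact K → IntegrableOn F K μ)
    (hFm : AEStronglyMeasurable F (μ.restrict Ω))
    (hf : IntegrableOn f Ω μ)
    (h : ∀ φ : E → ℝ, ContDiff ℝ (⊤ : ℕ∞) φ → HasCompactSupport φ → tsupport φ ⊆ Ω →
      ∫ x in Ω, fderiv ℝ φ x (F x) ∂μ = ∫ x in Ω, f x * φ x ∂μ)
    {w : E → ℝ} (hw : ContDiff ℝ 1 w) (hc : HasCompactSupport w) (hs : tsupport w ⊆ Ω) :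
    ∫ x in Ω, fderiv ℝ w x (F x) ∂μ = ∫ x in Ω, f x * w x ∂μ := by
  obtain ⟨K, C, φ, hK, hKΩ, h1, h2, h3, h4, h5, h6, h7⟩ :=
    exists_smooth_approx μ hΩ hw hc hs
  have t1 : Tendsto (fun n => ∫ x in Ω, fderiv ℝ (φ n) x (F x) ∂μ) atTop
      (𝓝 (∫ x in Ω, fderiv ℝ w x (F x) ∂μ)) := by
    refine tendsto_integral_of_dominated_convergence
      (fun x => C * K.indicator (fun x => ‖F x‖) x) (fun n => ?_) ?_ (fun n => ?_) ?_
    · exact (ContinuousLinearMap.id ℝ (E →L[ℝ] ℝ)).aestronglyMeasurable_comp₂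
        ((h1 n).continuous_fderiv (by simp)).aestronglyMeasurable hFm
    · exact (((integrable_indicator_iff hK.measurableSet).2
        (hF K hKΩ hK).norm).mono_measure Measure.restrict_le_self).const_mul C
    · refine ae_of_all _ fun x => ?_
      by_cases hx : x ∈ K
      · rw [Set.indicator_of_mem hx]
        exact (ContinuousLinearMap.le_opNorm _ _).trans
          (mul_le_mul_of_nonneg_right (h5 n x) (norm_nonneg _))
      · have : fderiv ℝ (φ n) x = 0 := by
          by_contra h
          exact hx (h3 n (support_fderiv_subset ℝ h))
        simp [this, hx]
    · exact ae_of_all _ fun x =>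
        ((ContinuousLinearMap.apply ℝ ℝ (F x)).continuous.tendsto _).comp (h7 x)
  have t2 : Tendsto (fun n => ∫ x in Ω, f x * φ n x ∂μ) atTop
      (𝓝 (∫ x in Ω, f x * w x ∂μ)) := by
    refine tendsto_integral_of_dominated_convergence (fun x => ‖f x‖ * C) (fun n => ?_) ?_
      (fun n => ?_) ?_
    · exact hf.aestronglyMeasurable.mul (h1 n).continuous.aestronglyMeasurable
    · exact hf.norm.mul_const C
    · refine ae_of_all _ fun x => ?_
      rw [norm_mul]
      exact mul_le_mul_of_nonneg_left (h4 n x) (norm_nonneg _)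
    · exact ae_of_all _ fun x => (h6 x).const_mul _
  refine tendsto_nhds_unique t1 (t2.congr fun n => ?_)
  exact (h (φ n) (h1 n) (h2 n) ((h3 n).trans hKΩ)).symm

end Mollify

/-! ### Admissible test functions -/

section Solutions

open Filter Topology

variable {N : ℕ} {Ω : Set (EuclideanSpace ℝ (Fin N))} {p q lam : ℝ}
  {a u v z : EuclideanSpace ℝ (Fin N) → ℝ}

lemma integrableOn_of_continuousOn_closure (hΩb : Bornology.IsBounded Ω)
    {f : EuclideanSpace ℝ (Fin N) → ℝ} (hf : ContinuousOn f (closure Ω)) : IntegrableOn f Ω :=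
  (hf.integrableOn_compact hΩb.isCompact_closure).mono_set subset_closure

/-- The right-hand side of the equation is continuous up to the boundary. -/
lemma DirichletSol.continuousOn_rhs (h1q : 1 < q) (hqp : q < p)
    (ha : ContinuousOn a (closure Ω)) (hu : ContinuousOn u (closure Ω)) :
    ContinuousOn (fun x => lam * u x ^ (p - 1) + a x * u x ^ (q - 1)) (closure Ω) :=
  ((hu.rpow_const fun _ _ => Or.inr (by linarith)).const_mul lam).add
    (ha.mul (hu.rpow_const fun _ _ => Or.inr (by linarith)))

/-- The weak formulation holds for compactly supported `C^1` test functions. -/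
lemma DirichletSol.weak_contDiff_one (hΩo : IsOpen Ω) (hΩb : Bornology.IsBounded Ω)
    (h1q : 1 < q) (hqp : q < p) (ha : ContinuousOn a (closure Ω))
    (hu : DirichletSol Ω p q lam a u) {w : EuclideanSpace ℝ (Fin N) → ℝ}
    (hw : ContDiff ℝ 1 w) (hc : HasCompactSupport w) (hs : tsupport w ⊆ Ω) :
    IntegrableOn (fun x => ‖gradient u x‖ ^ (p - 2) * fderiv ℝ w x (gradient u x)) Ω ∧
    ∫ x in Ω, ‖gradient u x‖ ^ (p - 2) * fderiv ℝ w x (gradient u x)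
      = ∫ x in Ω, (lam * u x ^ (p - 1) + a x * u x ^ (q - 1)) * w x := by
  obtain ⟨hcont, -, hgrad, -, -, -, hweak⟩ := hu
  have hFm : AEStronglyMeasurable (fun x => ‖gradient u x‖ ^ (p - 2) • gradient u x)
      (volume.restrict Ω) := by
    have hg := hgrad.aestronglyMeasurable (μ := volume) hΩo.measurableSet
    exact (hg.norm.aemeasurable.pow_const _).aestronglyMeasurable.smul hg
  have hF : ∀ K ⊆ Ω, IsCompact K →
      IntegrableOn (fun x => ‖gradient u x‖ ^ (p - 2) • gradient u x) K := by
    intro K hK hKc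
    have hb : IntegrableOn (fun x => ‖gradient u x‖ ^ (p - 1)) K :=
      (((hgrad.mono hK).norm).rpow_const fun _ _ =>
        Or.inr (by linarith)).integrableOn_compact hKc
    refine hb.mono' (hFm.mono_set hK) (ae_of_all _ fun x => ?_)
    rw [norm_smul, Real.norm_of_nonneg (by positivity)]
    rcases eq_or_ne (gradient u x) 0 with h | h
    · rw [h]
      simp [Real.zero_rpow (by linarith : p - 1 ≠ 0)]
    · rw [← Real.rpow_add_one (by simpa using h)]
      exact le_of_eq (by congr 1; ring)
  have hsmul : ∀ φ : EuclideanSpace ℝ (Fin N) → ℝ, ∀ x,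
      fderiv ℝ φ x (‖gradient u x‖ ^ (p - 2) • gradient u x)
        = ‖gradient u x‖ ^ (p - 2) * fderiv ℝ φ x (gradient u x) := fun φ x => by
    rw [map_smul, smul_eq_mul]
  have hf := integrableOn_of_continuousOn_closure hΩb
    (DirichletSol.continuousOn_rhs (lam := lam) h1q hqp ha hcont)
  constructor
  · have := integrableOn_fderiv_apply (hF _ hs hc) hFm hw hc
    simpa only [hsmul] using this
  · have := weak_identity_of_contDiff_one hΩo hF hFm hf (fun φ h1 h2 h3 => ?_) hw hc hs
    · simpa only [hsmul] using this
    · rw [← hweak φ ⟨h1, h2, h3⟩]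
      simp only [hsmul, inner_gradient_right, conj_trivial]

lemma contDiffOn_of_continuousOn_gradient (hΩo : IsOpen Ω)
    (hd : ∀ x ∈ Ω, DifferentiableAt ℝ u x) (hg : ContinuousOn (fun x => gradient u x) Ω) :
    ContDiffOn ℝ 1 u Ω := by
  rw [show (1 : WithTop ℕ∞) = 0 + 1 from rfl, contDiffOn_succ_iff_fderiv_of_isOpen hΩo]
  refine ⟨fun x hx => (hd x hx).differentiableWithinAt, by simp, ?_⟩
  rw [contDiffOn_zero, ← toDual_comp_gradient]
  exact (InnerProductSpace.toDual ℝ _).continuous.comp_continuousOn hg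

/-- The test function `g (U ^ q - V ^ q) * Z ^ (1 - q)` with `U = u + ε`, `V = v + ε`,
`Z = z + ε` and `g = softPos δ`, extended by zero outside `Ω`. -/
def piconeTest (Ω : Set (EuclideanSpace ℝ (Fin N))) (q ε δ : ℝ)
    (u v z : EuclideanSpace ℝ (Fin N) → ℝ) : EuclideanSpace ℝ (Fin N) → ℝ :=
  Ω.indicator fun x => softPos δ ((u x + ε) ^ q - (v x + ε) ^ q) * (z x + ε) ^ (1 - q)

lemma tsupport_piconeTest_subset {ε δ : ℝ} (hΩo : IsOpen Ω) (hΩb : Bornology.IsBounded Ω)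
    (hq : 0 ≤ q) (hδ : 0 < δ)
    (hu : ContinuousOn u (closure Ω)) (hv : ContinuousOn v (closure Ω))
    (hu0 : ∀ x ∈ frontier Ω, u x = 0) (hv0 : ∀ x ∈ frontier Ω, v x = 0) :
    HasCompactSupport (piconeTest Ω q ε δ u v z) ∧
      tsupport (piconeTest Ω q ε δ u v z) ⊆ Ω := by
  have hcont : ContinuousOn (fun x => (u x + ε) ^ q - (v x + ε) ^ q) (closure Ω) :=
    ((hu.add_const ε).rpow_const fun _ _ => Or.inr hq).sub
      ((hv.add_const ε).rpow_const fun _ _ => Or.inr hq)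
  set K := closure Ω ∩ (fun x => (u x + ε) ^ q - (v x + ε) ^ q) ⁻¹' Set.Ici δ with hK
  have hKcl : IsClosed K := hcont.preimage_isClosed_of_isClosed isClosed_closure isClosed_Ici
  have hKc : IsCompact K := hΩb.isCompact_closure.of_isClosed_subset hKcl Set.inter_subset_left
  have hKΩ : K ⊆ Ω := by
    rintro x ⟨hx1, hx2⟩
    by_contra hx
    have hxf : x ∈ frontier Ω := by
      rw [hΩo.frontier_eq]
      exact ⟨hx1, hx⟩
    simp only [Set.mem_preimage, hu0 x hxf, hv0 x hxf, sub_self, Set.mem_Ici] at hx2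
    linarith
  have hsub : tsupport (piconeTest Ω q ε δ u v z) ⊆ K := by
    refine closure_minimal (fun x hx => ?_) hKcl
    by_cases hxΩ : x ∈ Ω
    · refine ⟨subset_closure hxΩ, ?_⟩
      by_contra h
      refine hx ?_
      rw [piconeTest, Set.indicator_of_mem hxΩ, softPos_eq_zero (not_le.1 h).le, zero_mul]
    · exact absurd (Set.indicator_of_notMem hxΩ _) hx
  exact ⟨hKc.of_isClosed_subset (isClosed_tsupport _) hsub, hsub.trans hKΩ⟩

lemma contDiff_piconeTest {ε δ : ℝ} (hΩo : IsOpen Ω) (hε : 0 < ε) (hδ : 0 < δ)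
    (hu : ContDiffOn ℝ 1 u Ω) (hv : ContDiffOn ℝ 1 v Ω) (hz : ContDiffOn ℝ 1 z Ω)
    (hu0 : ∀ x ∈ Ω, 0 ≤ u x) (hv0 : ∀ x ∈ Ω, 0 ≤ v x) (hz0 : ∀ x ∈ Ω, 0 ≤ z x)
    (hs : tsupport (piconeTest Ω q ε δ u v z) ⊆ Ω) :
    ContDiff ℝ 1 (piconeTest Ω q ε δ u v z) := by
  rw [contDiff_iff_contDiffAt]
  intro x
  by_cases hx : x ∈ Ω
  · have hn := hΩo.mem_nhds hx
    have hc : ∀ {f : EuclideanSpace ℝ (Fin N) → ℝ} (r : ℝ), ContDiffOn ℝ 1 f Ω →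
        (∀ x ∈ Ω, 0 ≤ f x) → ContDiffAt ℝ 1 (fun y => (f y + ε) ^ r) x := fun r hf hf0 =>
      ((hf.contDiffAt hn).add contDiffAt_const).rpow_const_of_ne
        (add_pos_of_nonneg_of_pos (hf0 x hx) hε).ne'
    have := (((contDiff_softPos hδ).contDiffAt.comp x
      ((hc q hu hu0).sub (hc q hv hv0))).mul (hc (1 - q) hz hz0))
    refine this.congr_of_eventuallyEq ?_
    filter_upwards [hn] with y hy
    rw [piconeTest, Set.indicator_of_mem hy]
    rfl
  · have hx' : x ∉ tsupport (piconeTest Ω q ε δ u v z) := fun h => hx (hs h)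
    exact contDiffAt_const.congr_of_eventuallyEq (notMem_tsupport_iff_eventuallyEq.1 hx')

lemma fderiv_piconeTest {ε δ : ℝ} (hΩo : IsOpen Ω) (hε : 0 < ε) (hδ : 0 < δ)
    (hu : ∀ x ∈ Ω, DifferentiableAt ℝ u x) (hv : ∀ x ∈ Ω, DifferentiableAt ℝ v x)
    (hz : ∀ x ∈ Ω, DifferentiableAt ℝ z x)
    (hu0 : ∀ x ∈ Ω, 0 ≤ u x) (hv0 : ∀ x ∈ Ω, 0 ≤ v x) (hz0 : ∀ x ∈ Ω, 0 ≤ z x)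
    {x : EuclideanSpace ℝ (Fin N)} (hx : x ∈ Ω) (y : EuclideanSpace ℝ (Fin N)) :
    fderiv ℝ (piconeTest Ω q ε δ u v z) x y =
      ⟪y, ((z x + ε) ^ (1 - q) * softPosDeriv δ ((u x + ε) ^ q - (v x + ε) ^ q)) •
          ((q * (u x + ε) ^ (q - 1)) • gradient u x - (q * (v x + ε) ^ (q - 1)) • gradient v x)
        + (softPos δ ((u x + ε) ^ q - (v x + ε) ^ q) * ((1 - q) * (z x + ε) ^ (-q))) •
          gradient z x⟫ := by
  have hpow : ∀ {f : EuclideanSpace ℝ (Fin N) → ℝ} (r : ℝ),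
      (∀ x ∈ Ω, DifferentiableAt ℝ f x) → (∀ x ∈ Ω, 0 ≤ f x) →
      HasFDerivAt (fun y => (f y + ε) ^ r) ((r * (f x + ε) ^ (r - 1)) • fderiv ℝ f x) x :=
    fun r hf hf0 => ((hf x hx).hasFDerivAt.add_const ε).rpow_const
      (Or.inl (add_pos_of_nonneg_of_pos (hf0 x hx) hε).ne')
  have h := (((hasDerivAt_softPos hδ _).comp_hasFDerivAt x
    ((hpow q hu hu0).sub (hpow q hv hv0))).mul (hpow (1 - q) hz hz0))
  have h' := h.congr_of_eventuallyEq (f₁ := piconeTest Ω q ε δ u v z) (by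
    filter_upwards [hΩo.mem_nhds hx] with y hy
    rw [piconeTest, Set.indicator_of_mem hy]
    rfl)
  rw [h'.fderiv, show 1 - q - 1 = -q by ring]
  simp only [inner_add_right, inner_smul_right, inner_sub_right, inner_gradient_right,
    conj_trivial, add_apply, smul_apply,
    sub_apply, smul_eq_mul, Function.comp_apply, Pi.sub_apply]
  ring

/-- The energy inequality obtained by testing both equations with the Picone test functions. -/
lemma energy_inequality {lam' ε δ : ℝ} (hΩo : IsOpen Ω) (hΩb : Bornology.IsBounded Ω)
    (h1q : 1 < q) (hqp : q < p) (ha : ContinuousOn a (closure Ω))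
    (hu : DirichletSol Ω p q lam a u) (hv : DirichletSol Ω p q lam' a v)
    (hε : 0 < ε) (hδ : 0 < δ) :
    IntegrableOn (fun x =>
      ((lam * u x ^ (p - 1) + a x * u x ^ (q - 1)) * (u x + ε) ^ (1 - q)
        - (lam' * v x ^ (p - 1) + a x * v x ^ (q - 1)) * (v x + ε) ^ (1 - q))
        * softPos δ ((u x + ε) ^ q - (v x + ε) ^ q)) Ω ∧
    -((q - 1) * (2 * δ) * ε ^ (-q) * ∫ x in Ω, ‖gradient v x‖ ^ p) ≤
      ∫ x in Ω, ((lam * u x ^ (p - 1) + a x * u x ^ (q - 1)) * (u x + ε) ^ (1 - q)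
        - (lam' * v x ^ (p - 1) + a x * v x ^ (q - 1)) * (v x + ε) ^ (1 - q))
        * softPos δ ((u x + ε) ^ q - (v x + ε) ^ q) := by
  obtain ⟨hcu, hdu, hgu, hu0, hbu, -, -⟩ := id hu
  obtain ⟨hcv, hdv, hgv, hv0, hbv, hiv, -⟩ := id hv
  have hC1u := contDiffOn_of_continuousOn_gradient hΩo hdu hgu
  have hC1v := contDiffOn_of_continuousOn_gradient hΩo hdv hgv
  have hq0 : 0 ≤ q := by linarith
  obtain ⟨c1, s1⟩ := tsupport_piconeTest_subset (ε := ε) (z := u) hΩo hΩb hq0 hδ hcu hcv hbu hbv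
  obtain ⟨c2, s2⟩ := tsupport_piconeTest_subset (ε := ε) (z := v) hΩo hΩb hq0 hδ hcu hcv hbu hbv
  have d1 := contDiff_piconeTest hΩo hε hδ hC1u hC1v hC1u hu0 hv0 hu0 s1
  have d2 := contDiff_piconeTest hΩo hε hδ hC1u hC1v hC1v hu0 hv0 hv0 s2
  obtain ⟨i1, e1⟩ := hu.weak_contDiff_one hΩo hΩb h1q hqp ha d1 c1 s1
  obtain ⟨i2, e2⟩ := hv.weak_contDiff_one hΩo hΩb h1q hqp ha d2 c2 s2
  have hprod : ∀ {μ₀ : ℝ} {f w : EuclideanSpace ℝ (Fin N) → ℝ}, ContinuousOn f (closure Ω) →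
      ContDiff ℝ 1 w → IntegrableOn
        (fun x => (μ₀ * f x ^ (p - 1) + a x * f x ^ (q - 1)) * w x) Ω := fun hf hw =>
    integrableOn_of_continuousOn_closure hΩb
      ((DirichletSol.continuousOn_rhs h1q hqp ha hf).mul hw.continuous.continuousOn)
  have hcongr : Set.EqOn (fun x =>
      (lam * u x ^ (p - 1) + a x * u x ^ (q - 1)) * piconeTest Ω q ε δ u v u x
        - (lam' * v x ^ (p - 1) + a x * v x ^ (q - 1)) * piconeTest Ω q ε δ u v v x)
      (fun x => ((lam * u x ^ (p - 1) + a x * u x ^ (q - 1)) * (u x + ε) ^ (1 - q)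
        - (lam' * v x ^ (p - 1) + a x * v x ^ (q - 1)) * (v x + ε) ^ (1 - q))
        * softPos δ ((u x + ε) ^ q - (v x + ε) ^ q)) Ω := fun x hx => by
    simp only [piconeTest, Set.indicator_of_mem hx]
    ring
  refine ⟨((hprod hcu d1).sub (hprod hcv d2)).congr_fun hcongr hΩo.measurableSet, ?_⟩
  rw [← setIntegral_congr_fun hΩo.measurableSet hcongr,
    integral_sub (hprod hcu d1) (hprod hcv d2), ← e1, ← e2]
  rw [← integral_sub i1 i2, ← integral_const_mul, ← integral_neg]
  refine setIntegral_mono_on (hiv.const_mul _).neg (i1.sub i2) hΩo.measurableSet fun x hx => ?_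
  have hU : 0 < u x + ε := add_pos_of_nonneg_of_pos (hu0 x hx) hε
  have hV : 0 < v x + ε := add_pos_of_nonneg_of_pos (hv0 x hx) hε
  rw [fderiv_piconeTest hΩo hε hδ hdu hdv hdu hu0 hv0 hu0 hx,
    fderiv_piconeTest hΩo hε hδ hdu hdv hdv hu0 hv0 hv0 hx]
  set t := (u x + ε) ^ q - (v x + ε) ^ q with ht
  obtain ⟨hd0, hd1⟩ := softPos_defect_mem hδ t
  refine le_trans ?_ (hidden_convexity h1q hqp hU hV (softPosDeriv_nonneg hδ t) hd0
    (by rw [← ht]; ring) (gradient u x) (gradient v x))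
  have hq1 : 0 ≤ q - 1 := by linarith
  have hεV : (v x + ε) ^ (-q) ≤ ε ^ (-q) :=
    Real.rpow_le_rpow_of_nonpos hε (by linarith [hv0 x hx]) (by linarith)
  gcongr

/-! ### Comparison -/

lemma rpow_mul_add_rpow_eq {s ε r : ℝ} (hs : 0 ≤ s) (hε : 0 < ε) :
    s ^ (r - 1) * (s + ε) ^ (1 - r) = (s / (s + ε)) ^ (r - 1) := by
  rw [Real.div_rpow hs (by positivity), div_eq_mul_inv, ← Real.rpow_neg (by positivity), neg_sub]

lemma rpow_mul_add_rpow_mono {s t ε r : ℝ} (hr : 1 ≤ r) (hs : 0 ≤ s) (hst : s ≤ t)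
    (hε : 0 < ε) :
    s ^ (r - 1) * (s + ε) ^ (1 - r) ≤ t ^ (r - 1) * (t + ε) ^ (1 - r) := by
  have ht := hs.trans hst
  rw [rpow_mul_add_rpow_eq hs hε, rpow_mul_add_rpow_eq ht hε]
  refine Real.rpow_le_rpow (by positivity) ?_ (by linarith)
  rw [div_le_div_iff₀ (by positivity) (by positivity)]
  nlinarith

lemma rpow_mul_add_rpow_le_one {s ε r : ℝ} (hr : 1 ≤ r) (hs : 0 ≤ s) (hε : 0 < ε) :
    s ^ (r - 1) * (s + ε) ^ (1 - r) ≤ 1 := by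
  rw [rpow_mul_add_rpow_eq hs hε]
  refine Real.rpow_le_one (by positivity) ?_ (by linarith)
  rw [div_le_one (by positivity)]
  linarith

lemma tendsto_rpow_mul_add_rpow {s r : ℝ} (hs : 0 < s) :
    Tendsto (fun ε => s ^ (r - 1) * (s + ε) ^ (1 - r)) (𝓝[>] 0) (𝓝 1) := by
  have h : ContinuousAt (fun ε => s ^ (r - 1) * (s + ε) ^ (1 - r)) 0 :=
    continuousAt_const.mul ((continuousAt_const.add continuousAt_id).rpow_const
      (Or.inl (by simpa using hs.ne')))
  have e : s ^ (r - 1) * (s + 0) ^ (1 - r) = 1 := by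
    rw [add_zero, ← Real.rpow_add hs]
    simp
  have := h.tendsto
  rw [e] at this
  exact this.mono_left nhdsWithin_le_nhds

/-- Pointwise upper bound for the integrand in the energy inequality. -/
lemma integrand_le {lam' ε s t b G : ℝ} (h1q : 1 < q) (hqp : q < p)
    (hlam' : lam' < 0) (hs : 0 ≤ s) (hts : s ≤ t) (hε : 0 < ε) (hG : 0 ≤ G) :
    ((lam * t ^ (p - 1) + b * t ^ (q - 1)) * (t + ε) ^ (1 - q)
        - (lam' * s ^ (p - 1) + b * s ^ (q - 1)) * (s + ε) ^ (1 - q)) * G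
      ≤ (max b 0 * (1 - s ^ (q - 1) * (s + ε) ^ (1 - q))
        - (lam' - lam) * (t ^ (p - q) * (t ^ (q - 1) * (t + ε) ^ (1 - q)))) * G := by
  refine mul_le_mul_of_nonneg_right ?_ hG
  have ht := hs.trans hts
  have key : ∀ x : ℝ, 0 ≤ x → x ^ (p - 1) = x ^ (p - q) * x ^ (q - 1) := fun x hx => by
    rw [← Real.rpow_add_of_nonneg hx (by linarith) (by linarith)]
    congr 1; ring
  rw [key t ht, key s hs]
  have m1 := rpow_mul_add_rpow_mono h1q.le hs hts hε
  have m2 := rpow_mul_add_rpow_le_one h1q.le ht hε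
  have m0 : 0 ≤ s ^ (q - 1) * (s + ε) ^ (1 - q) := by positivity
  have m3 : s ^ (p - q) ≤ t ^ (p - q) := Real.rpow_le_rpow hs hts (by linarith)
  have m4 : 0 ≤ s ^ (p - q) := by positivity
  set α := t ^ (q - 1) * (t + ε) ^ (1 - q) with hα
  set β := s ^ (q - 1) * (s + ε) ^ (1 - q) with hβ
  have e : (lam * (t ^ (p - q) * t ^ (q - 1)) + b * t ^ (q - 1)) * (t + ε) ^ (1 - q)
        - (lam' * (s ^ (p - q) * s ^ (q - 1)) + b * s ^ (q - 1)) * (s + ε) ^ (1 - q)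
      = lam * (t ^ (p - q) * α) - lam' * (s ^ (p - q) * β) + b * (α - β) := by
    rw [hα, hβ]
    ring
  rw [e]
  have h1 : s ^ (p - q) * β ≤ t ^ (p - q) * α := mul_le_mul m3 m1 m0 (m4.trans m3)
  have h2 : b * (α - β) ≤ max b 0 * (1 - β) :=
    mul_le_mul (le_max_left _ _) (by linarith) (by linarith) (le_max_right _ _)
  nlinarith

/-- The comparison `u ≤ v` of solutions for parameters `lam < lam' < 0`. -/
lemma DirichletSol.le_of_lt {lam' : ℝ} (hΩo : IsOpen Ω) (hΩb : Bornology.IsBounded Ω)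
    (h1q : 1 < q) (hqp : q < p) (ha : ContinuousOn a (closure Ω))
    (hll : lam < lam') (hlam' : lam' < 0)
    (hu : DirichletSol Ω p q lam a u) (hv : DirichletSol Ω p q lam' a v)
    (hvpos : ∀ x ∈ Ω, 0 < a x → 0 < v x) : ∀ x ∈ Ω, u x ≤ v x := by
  obtain ⟨hcu, -, -, hu0, -, -, -⟩ := id hu
  obtain ⟨hcv, -, -, hv0, -, -, -⟩ := id hv
  have hpow : ∀ (r : ℝ) {f : EuclideanSpace ℝ (Fin N) → ℝ}, 0 ≤ r → ContinuousOn f (closure Ω) →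
      ContinuousOn (fun x => f x ^ r) (closure Ω) := fun r f hr hf =>
    hf.rpow_const fun _ _ => Or.inr hr
  have hq0 : 0 ≤ q := by linarith
  let G : ℝ → EuclideanSpace ℝ (Fin N) → ℝ := fun ε x =>
    softPos (ε * ε ^ q) ((u x + ε) ^ q - (v x + ε) ^ q)
  let I : ℝ → EuclideanSpace ℝ (Fin N) → ℝ := fun ε x =>
    ((lam * u x ^ (p - 1) + a x * u x ^ (q - 1)) * (u x + ε) ^ (1 - q)
      - (lam' * v x ^ (p - 1) + a x * v x ^ (q - 1)) * (v x + ε) ^ (1 - q)) * G ε x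
  let H : ℝ → EuclideanSpace ℝ (Fin N) → ℝ := fun ε x =>
    (max (a x) 0 * (1 - v x ^ (q - 1) * (v x + ε) ^ (1 - q))
      - (lam' - lam) * (u x ^ (p - q) * (u x ^ (q - 1) * (u x + ε) ^ (1 - q)))) * G ε x
  let H₀ : EuclideanSpace ℝ (Fin N) → ℝ := fun x =>
    -((lam' - lam) * u x ^ (p - q)) * max (u x ^ q - v x ^ q) 0
  have hδ : ∀ {ε : ℝ}, 0 < ε → 0 < ε * ε ^ q := fun h => by positivity
  have hGnn : ∀ {ε : ℝ}, 0 < ε → ∀ x, 0 ≤ G ε x := fun h x => softPos_nonneg (hδ h) _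
  have hGzero : ∀ {ε : ℝ}, 0 < ε → ∀ x ∈ Ω, u x ≤ v x → G ε x = 0 := fun {ε} h x hx huv =>
    softPos_eq_zero ((sub_nonpos.2 (Real.rpow_le_rpow (by linarith [hu0 x hx])
      (by linarith) hq0)).trans (hδ h).le)
  have hGc : ∀ {ε : ℝ}, 0 < ε → ContinuousOn (G ε) Ω := fun {ε} h =>
    (continuous_softPos (hδ h)).comp_continuousOn
      (((hpow q hq0 (hcu.add_const ε)).sub (hpow q hq0 (hcv.add_const ε))).mono subset_closure)
  have hneg : ∀ {ε : ℝ} {f : EuclideanSpace ℝ (Fin N) → ℝ}, 0 < ε → ContinuousOn f (closure Ω) →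
      (∀ x ∈ Ω, 0 ≤ f x) → ContinuousOn (fun x => (f x + ε) ^ (1 - q)) Ω :=
    fun {ε f} h hf hf0 => ((hf.mono subset_closure).add_const ε).rpow_const fun x hx =>
      Or.inl (add_pos_of_nonneg_of_pos (hf0 x hx) h).ne'
  have hHc : ∀ {ε : ℝ}, 0 < ε → ContinuousOn (H ε) Ω := fun {ε} h =>
    ((((ha.mono subset_closure).sup continuousOn_const).mul
      (continuousOn_const.sub (((hpow (q - 1) (by linarith) hcv).mono subset_closure).mul
        (hneg h hcv hv0)))).sub
      (continuousOn_const.mul (((hpow (p - q) (by linarith) hcu).mono subset_closure).mul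
        (((hpow (q - 1) (by linarith) hcu).mono subset_closure).mul (hneg h hcu hu0))))).mul
      (hGc h)
  have hHI : ∀ {ε : ℝ}, 0 < ε → ∀ x ∈ Ω, I ε x ≤ H ε x := fun {ε} h x hx => by
    rcases le_total (u x) (v x) with huv | huv
    · simp only [I, H, hGzero h x hx huv, mul_zero, le_refl]
    · exact integrand_le h1q hqp hlam' (hv0 x hx) huv h (hGnn h x)
  obtain ⟨M, hM⟩ := hΩb.isCompact_closure.exists_bound_of_continuousOn hcu
  obtain ⟨A, hA⟩ := hΩb.isCompact_closure.exists_bound_of_continuousOn ha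
  have hbound : ∀ ε ∈ Set.Ioo (0 : ℝ) 1, ∀ x ∈ Ω,
      ‖H ε x‖ ≤ (|A| + (lam' - lam) * |M| ^ (p - q)) * (|M| + 1) ^ q := by
    rintro ε ⟨h0, h1⟩ x hx
    have hux : u x ≤ |M| :=
      (le_abs_self _).trans ((hM x (subset_closure hx)).trans (le_abs_self M))
    have hax : max (a x) 0 ≤ |A| := max_le
      ((le_abs_self _).trans ((hA x (subset_closure hx)).trans (le_abs_self A))) (abs_nonneg A)
    have hux0 := hu0 x hx
    have hvx0 := hv0 x hx
    have b1 := rpow_mul_add_rpow_le_one h1q.le hux0 h0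
    have b2 := rpow_mul_add_rpow_le_one h1q.le hvx0 h0
    have b3 : 0 ≤ u x ^ (q - 1) * (u x + ε) ^ (1 - q) := by positivity
    have b4 : 0 ≤ v x ^ (q - 1) * (v x + ε) ^ (1 - q) := by positivity
    have b5 : u x ^ (p - q) ≤ |M| ^ (p - q) := Real.rpow_le_rpow hux0 hux (by linarith)
    have b6 : (u x + ε) ^ q ≤ (|M| + 1) ^ q :=
      Real.rpow_le_rpow (by linarith) (by linarith) hq0
    have b7 : 0 ≤ (v x + ε) ^ q := by positivity
    have b8 : 0 ≤ (u x + ε) ^ q := by positivity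
    have hGle : G ε x ≤ (|M| + 1) ^ q :=
      (softPos_le (hδ h0) _).trans (max_le (by linarith) (b8.trans b6))
    have b9 : 0 ≤ u x ^ (p - q) := by positivity
    have b10 : max (a x) 0 * (1 - v x ^ (q - 1) * (v x + ε) ^ (1 - q)) ≤ |A| * 1 :=
      mul_le_mul hax (by linarith) (by linarith) (abs_nonneg A)
    have b11 : 0 ≤ max (a x) 0 * (1 - v x ^ (q - 1) * (v x + ε) ^ (1 - q)) :=
      mul_nonneg (le_max_right _ _) (by linarith)
    have b12 : u x ^ (p - q) * (u x ^ (q - 1) * (u x + ε) ^ (1 - q)) ≤ |M| ^ (p - q) * 1 :=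
      mul_le_mul b5 b1 b3 (b9.trans b5)
    have b13 : (lam' - lam) * (u x ^ (p - q) * (u x ^ (q - 1) * (u x + ε) ^ (1 - q)))
        ≤ (lam' - lam) * (|M| ^ (p - q) * 1) :=
      mul_le_mul_of_nonneg_left b12 (by linarith)
    have b14 : 0 ≤ (lam' - lam) * (u x ^ (p - q) * (u x ^ (q - 1) * (u x + ε) ^ (1 - q))) :=
      mul_nonneg (by linarith) (mul_nonneg b9 b3)
    rw [norm_mul, Real.norm_of_nonneg (hGnn h0 x)]
    refine mul_le_mul ?_ hGle (hGnn h0 x) ?_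
    · rw [Real.norm_eq_abs, abs_le]
      constructor <;> linarith
    · linarith
  have hfin : IsFiniteMeasure ((volume : Measure (EuclideanSpace ℝ (Fin N))).restrict Ω) :=
    ⟨by simpa using hΩb.measure_lt_top⟩
  have hlim : ∀ x ∈ Ω, Tendsto (fun ε => H ε x) (𝓝[>] 0) (𝓝 (H₀ x)) := by
    intro x hx
    rcases le_or_gt (u x) (v x) with huv | huv
    · have e : H₀ x = 0 := by
        simp only [H₀]
        rw [max_eq_right (sub_nonpos.2 (Real.rpow_le_rpow (hu0 x hx) huv hq0)), mul_zero]
      rw [e]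
      refine tendsto_const_nhds.congr' ?_
      filter_upwards [self_mem_nhdsWithin] with ε hε
      simp only [H, hGzero hε x hx huv, mul_zero]
    · have hux : 0 < u x := (hv0 x hx).trans_lt huv
      have l1 : Tendsto (fun ε => max (a x) 0 * (1 - v x ^ (q - 1) * (v x + ε) ^ (1 - q)))
          (𝓝[>] 0) (𝓝 0) := by
        rcases le_or_gt (a x) 0 with hax | hax
        · simp [max_eq_right hax]
        · have := ((tendsto_rpow_mul_add_rpow (r := q) (hvpos x hx hax)).const_sub 1).const_mul
            (max (a x) 0)
          simpa using this
      have l2 := ((tendsto_rpow_mul_add_rpow (r := q) hux).const_mul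
        (u x ^ (p - q))).const_mul (lam' - lam)
      have l3 : Tendsto (fun ε => max ((u x + ε) ^ q - (v x + ε) ^ q) 0) (𝓝[>] 0)
          (𝓝 (max (u x ^ q - v x ^ q) 0)) := by
        have hc : ∀ y : ℝ, Continuous fun ε : ℝ => (y + ε) ^ q := fun y =>
          (continuous_const.add continuous_id).rpow_const fun _ => Or.inr hq0
        have hm : Continuous fun ε : ℝ => max ((u x + ε) ^ q - (v x + ε) ^ q) 0 :=
          ((hc (u x)).sub (hc (v x))).max continuous_const
        have := hm.tendsto 0
        simp only [add_zero] at this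
        exact this.mono_left nhdsWithin_le_nhds
      have l4 : Tendsto (fun ε : ℝ => 2 * (ε * ε ^ q)) (𝓝[>] 0) (𝓝 0) := by
        have hc : Continuous fun ε : ℝ => 2 * (ε * ε ^ q) :=
          continuous_const.mul (continuous_id.mul (continuous_id.rpow_const fun _ => Or.inr hq0))
        have := hc.tendsto 0
        simp only [zero_mul, mul_zero] at this
        exact this.mono_left nhdsWithin_le_nhds
      have l5 : Tendsto (fun ε => G ε x - max ((u x + ε) ^ q - (v x + ε) ^ q) 0) (𝓝[>] 0)
          (𝓝 0) := by
        refine squeeze_zero_norm' ?_ l4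
        filter_upwards [self_mem_nhdsWithin] with ε hε
        exact abs_softPos_sub_le (hδ hε) _
      have l6 : Tendsto (fun ε => G ε x) (𝓝[>] 0) (𝓝 (max (u x ^ q - v x ^ q) 0)) := by
        simpa using l5.add l3
      have := (l1.sub l2).mul l6
      simpa [H₀, H] using this
  have hconv : Tendsto (fun ε => ∫ x in Ω, H ε x) (𝓝[>] 0) (𝓝 (∫ x in Ω, H₀ x)) := by
    refine tendsto_integral_filter_of_dominated_convergence
      (fun _ => (|A| + (lam' - lam) * |M| ^ (p - q)) * (|M| + 1) ^ q) ?_ ?_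
      (integrable_const _) ?_
    · filter_upwards [self_mem_nhdsWithin] with ε hε
      exact (hHc hε).aestronglyMeasurable hΩo.measurableSet
    · filter_upwards [Ioo_mem_nhdsGT (zero_lt_one (α := ℝ))] with ε hε
      filter_upwards [ae_restrict_mem hΩo.measurableSet] with x hx using hbound ε hε x hx
    · filter_upwards [ae_restrict_mem hΩo.measurableSet] with x hx using hlim x hx
  have hlow : ∀ ε ∈ Set.Ioo (0 : ℝ) 1,
      -((q - 1) * (2 * ε) * ∫ x in Ω, ‖gradient v x‖ ^ p) ≤ ∫ x in Ω, H ε x := by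
    intro ε hε
    obtain ⟨hint, hle⟩ := energy_inequality hΩo hΩb h1q hqp ha hu hv hε.1 (hδ hε.1)
    have hHint : IntegrableOn (H ε) Ω :=
      (integrable_const ((|A| + (lam' - lam) * |M| ^ (p - q)) * (|M| + 1) ^ q)).mono'
        ((hHc hε.1).aestronglyMeasurable hΩo.measurableSet)
        (by filter_upwards [ae_restrict_mem hΩo.measurableSet] with x hx using hbound ε hε x hx)
    have e : (q - 1) * (2 * (ε * ε ^ q)) * ε ^ (-q) = (q - 1) * (2 * ε) := by
      have h0 : ε ^ q ≠ 0 := (Real.rpow_pos_of_pos hε.1 q).ne'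
      rw [Real.rpow_neg hε.1.le]
      field_simp
    rw [e] at hle
    exact hle.trans (setIntegral_mono_on hint hHint hΩo.measurableSet fun x hx => hHI hε.1 x hx)
  have hge : 0 ≤ ∫ x in Ω, H₀ x := by
    have l0 : Tendsto (fun ε : ℝ => -((q - 1) * (2 * ε) * ∫ x in Ω, ‖gradient v x‖ ^ p))
        (𝓝[>] 0) (𝓝 0) := by
      have hc : Continuous fun ε : ℝ => -((q - 1) * (2 * ε) * ∫ x in Ω, ‖gradient v x‖ ^ p) := by
        fun_prop
      have := hc.tendsto 0
      simp only [mul_zero, zero_mul, neg_zero] at this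
      exact this.mono_left nhdsWithin_le_nhds
    refine le_of_tendsto_of_tendsto l0 hconv ?_
    filter_upwards [Ioo_mem_nhdsGT (zero_lt_one (α := ℝ))] with ε hε using hlow ε hε
  have hH₀c : ContinuousOn H₀ (closure Ω) :=
    (continuousOn_const.mul (hpow (p - q) (by linarith) hcu)).neg.mul
      (((hpow q hq0 hcu).sub (hpow q hq0 hcv)).sup continuousOn_const)
  have hH₀np : ∀ x ∈ Ω, 0 ≤ -H₀ x := fun x hx => by
    have hux := hu0 x hx
    simp only [H₀, neg_mul, neg_neg]
    exact mul_nonneg (mul_nonneg (by linarith) (by positivity)) (le_max_right _ _)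
  have hae : (fun x => -H₀ x) =ᵐ[volume.restrict Ω] 0 := by
    have hnn : 0 ≤ᵐ[volume.restrict Ω] fun x => -H₀ x := by
      filter_upwards [ae_restrict_mem hΩo.measurableSet] with x hx using hH₀np x hx
    refine (integral_eq_zero_iff_of_nonneg_ae hnn
      (integrableOn_of_continuousOn_closure hΩb hH₀c).neg).1 (le_antisymm ?_ ?_)
    · rw [integral_neg]
      linarith
    · exact integral_nonneg_of_ae hnn
  have hzero := Measure.eqOn_open_of_ae_eq hae hΩo (hH₀c.mono subset_closure).neg
    continuousOn_const
  intro x hx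
  by_contra! huv
  have hux : 0 < u x := (hv0 x hx).trans_lt huv
  have h0 := hzero hx
  simp only [H₀, neg_mul, neg_neg, Pi.zero_apply] at h0
  have h1 : 0 < u x ^ q - v x ^ q :=
    sub_pos.2 (Real.rpow_lt_rpow (hv0 x hx) huv (by linarith))
  have h2 : 0 < (lam' - lam) * u x ^ (p - q) * max (u x ^ q - v x ^ q) 0 :=
    mul_pos (mul_pos (by linarith) (by positivity)) (lt_max_of_lt_left h1)
  exact h2.ne' h0

/-- A solution for one parameter that is also a solution for another one vanishes. -/
lemma DirichletSol.eq_zero_of_eqOn {lam' : ℝ} (hΩo : IsOpen Ω) (hΩb : Bornology.IsBounded Ω)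
    (h1q : 1 < q) (hqp : q < p) (ha : ContinuousOn a (closure Ω)) (hne : lam ≠ lam')
    (hu : DirichletSol Ω p q lam a u) (hv : DirichletSol Ω p q lam' a v)
    (huv : ∀ x ∈ Ω, u x = v x) : ∀ x ∈ Ω, u x = 0 := by
  obtain ⟨hcu, -, -, hu0, -, -, hwu⟩ := hu
  obtain ⟨-, -, -, -, -, -, hwv⟩ := hv
  have hgrad : ∀ x ∈ Ω, gradient u x = gradient v x := fun x hx =>
    Filter.EventuallyEq.gradient_eq (by filter_upwards [hΩo.mem_nhds hx] with y hy using huv y hy)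
  have hpc : ContinuousOn (fun x => u x ^ (p - 1)) (closure Ω) :=
    hcu.rpow_const fun _ _ => Or.inr (by linarith)
  have hae : ∀ᵐ x, x ∈ Ω → u x ^ (p - 1) = 0 := by
    refine hΩo.ae_eq_zero_of_integral_contDiff_smul_eq_zero
      (integrableOn_of_continuousOn_closure hΩb hpc).locallyIntegrableOn fun φ h1 h2 h3 => ?_
    have hφc : ContinuousOn φ (closure Ω) := h1.continuous.continuousOn
    have key : ∫ x in Ω, (lam * u x ^ (p - 1) + a x * u x ^ (q - 1)) * φ x
        = ∫ x in Ω, (lam' * u x ^ (p - 1) + a x * u x ^ (q - 1)) * φ x := by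
      rw [← hwu φ ⟨h1, h2, h3⟩]
      refine Eq.trans ?_ ((hwv φ ⟨h1, h2, h3⟩).trans ?_)
      · exact setIntegral_congr_fun hΩo.measurableSet fun x hx => by simp only [hgrad x hx]
      · exact setIntegral_congr_fun hΩo.measurableSet fun x hx => by simp only [huv x hx]
    have hint : ∀ μ₀ : ℝ, IntegrableOn
        (fun x => (μ₀ * u x ^ (p - 1) + a x * u x ^ (q - 1)) * φ x) Ω := fun μ₀ =>
      integrableOn_of_continuousOn_closure hΩb
        ((DirichletSol.continuousOn_rhs h1q hqp ha hcu).mul hφc)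
    rw [← sub_eq_zero, ← integral_sub (hint lam) (hint lam')] at key
    have e : (fun x => (lam * u x ^ (p - 1) + a x * u x ^ (q - 1)) * φ x
        - (lam' * u x ^ (p - 1) + a x * u x ^ (q - 1)) * φ x)
        = fun x => (lam - lam') * (φ x • u x ^ (p - 1)) := by
      funext x
      rw [smul_eq_mul]
      ring
    rw [e, integral_const_mul] at key
    rw [← setIntegral_eq_integral_of_forall_compl_eq_zero (s := Ω) fun x hx => by
      rw [image_eq_zero_of_notMem_tsupport fun h => hx (h3 h), zero_smul]]
    exact (mul_eq_zero.1 key).resolve_left (sub_ne_zero.2 hne)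
  have hzero : Set.EqOn (fun x => u x ^ (p - 1)) 0 Ω :=
    Measure.eqOn_open_of_ae_eq ((ae_restrict_iff' hΩo.measurableSet).2 hae) hΩo
      (hpc.mono subset_closure) continuousOn_const
  exact fun x hx => (Real.rpow_eq_zero (hu0 x hx) (by linarith)).1 (hzero hx)

end Solutions

/-- Monotonicity in `λ`: if `λ < λ' < 0`, `u` solves `(P_λ)` and `v` solves `(P_{λ'})`,
both positive on `Ω_a^+`, then `u ≤ v` in `Ω` and `u ≢ v` in `Ω`. -/
theorem monotonicity_in_lambda
    {N : ℕ} (hN : 1 ≤ N) (Ω : Set (EuclideanSpace ℝ (Fin N)))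
    (hΩne : Ω.Nonempty) (hΩo : IsOpen Ω) (hΩb : Bornology.IsBounded Ω)
    (p q : ℝ) (h1q : 1 < q) (hqp : q < p)
    (a : EuclideanSpace ℝ (Fin N) → ℝ) (ha : ContinuousOn a (closure Ω))
    (haplus : ∃ x ∈ Ω, 0 < a x) (haminus : ∃ x ∈ Ω, a x < 0)
    (lam lam' : ℝ) (hll : lam < lam') (hlam' : lam' < 0)
    (u v : EuclideanSpace ℝ (Fin N) → ℝ)
    (hu : DirichletSol Ω p q lam a u) (hv : DirichletSol Ω p q lam' a v)
    (hupos : ∀ x ∈ Ω, 0 < a x → 0 < u x) (hvpos : ∀ x ∈ Ω, 0 < a x → 0 < v x) :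
    (∀ x ∈ Ω, u x ≤ v x) ∧ ¬ (∀ x ∈ Ω, u x = v x) := by
  refine ⟨hu.le_of_lt hΩo hΩb h1q hqp ha hll hlam' hv hvpos, fun huv => ?_⟩
  obtain ⟨x, hx, hax⟩ := haplus
  exact (hupos x hx hax).ne' (hu.eq_zero_of_eqOn hΩo hΩb h1q hqp ha hll.ne hv huv x hx)
end
end
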